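/- (Derivative bounds) There exists a universal constant C > 0, depending only on n, Λ, M and C₀, such that: if η is a viscosity solution of the linearized oblique problem on K₁⁺ with |η| ≤ 1 on K₁⁺, then η is twice continuously differentiable in the x variable at every point of K_{1/2}, and |∇η(x,t)| ≤ C and ‖D²η(x,t)‖ ≤ C for all (x,t) ∈ K_{1/2}. -/

import Mathlib

open Set MeasureTheory Metric
open scoped RealInnerProductSpace
noncomputable section
abbrev Eucl (n : ℕ) : Type := EuclideanSpace ℝ (Fin n)
abbrev SpaceTime (n : ℕ) : Type := Eucl n × ℝ
noncomputable def matOpNorm {n : ℕ} (A : Matrix (Fin n) (Fin n) ℝ) : ℝ :=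
  ‖(LinearMap.toContinuousLinearMap (Matrix.toEuclideanLin A))‖
def UniformlyElliptic {n : ℕ} (Λ : ℝ) (F : Matrix (Fin n) (Fin n) ℝ → ℝ) : Prop :=
  ∀ M N : Matrix (Fin n) (Fin n) ℝ, M.IsSymm → N.IsSymm → N.PosSemidef →
    Λ⁻¹ * matOpNorm N ≤ F (M + N) - F M ∧ F (M + N) - F M ≤ Λ * matOpNorm N
noncomputable def pucciMinus {n : ℕ} (R : Matrix (Fin n) (Fin n) ℝ) (a b : ℝ) : ℝ :=
  if h : R.IsHermitian then
    a * ∑ i, max (h.eigenvalues i) 0 + b * ∑ i, min (h.eigenvalues i) 0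
  else 0
noncomputable def pucciPlus {n : ℕ} (R : Matrix (Fin n) (Fin n) ℝ) (a b : ℝ) : ℝ :=
  if h : R.IsHermitian then
    a * ∑ i, min (h.eigenvalues i) 0 + b * ∑ i, max (h.eigenvalues i) 0
  else 0
def cylE {n : ℕ} (x₀ : Eucl n) (t₀ ρ : ℝ) : Set (SpaceTime n) :=
  (ball x₀ ρ) ×ˢ (Ioc (t₀ - ρ ^ 2) t₀)
structure ParabolicTest {n : ℕ} (φ : SpaceTime n → ℝ) (D : Set (SpaceTime n))
    (φt : SpaceTime n → ℝ) (gφ : SpaceTime n → Eucl n)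
    (Hφ : SpaceTime n → Matrix (Fin n) (Fin n) ℝ) : Prop where
  contPhi : ContinuousOn φ D
  contPhit : ContinuousOn φt D
  contGrad : ContinuousOn gφ D
  contHess : ContinuousOn Hφ D
  symmHess : ∀ p ∈ D, (Hφ p).IsSymm
  timeDeriv : ∀ p ∈ D, HasDerivWithinAt (fun s : ℝ => φ (p.1, s)) (φt p) {s : ℝ | (p.1, s) ∈ D} p.2
  spaceGrad : ∀ p ∈ D, HasGradientWithinAt (fun y => φ (y, p.2)) (gφ p) {y | (y, p.2) ∈ D} p.1
  spaceHess : ∀ p ∈ D, HasFDerivWithinAt (fun y => gφ (y, p.2))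
      (LinearMap.toContinuousLinearMap (Matrix.toEuclideanLin (Hφ p))) {y | (y, p.2) ∈ D} p.1
def TouchesAbove {n : ℕ} (φ u : SpaceTime n → ℝ) (E : Set (SpaceTime n)) (p₀ : SpaceTime n) :
    Prop :=
  p₀ ∈ E ∧ φ p₀ = u p₀ ∧ ∀ p ∈ E, u p ≤ φ p
def TouchesBelow {n : ℕ} (φ u : SpaceTime n → ℝ) (E : Set (SpaceTime n)) (p₀ : SpaceTime n) :
    Prop :=
  p₀ ∈ E ∧ φ p₀ = u p₀ ∧ ∀ p ∈ E, φ p ≤ u p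
def ViscSub {n : ℕ} (F : Matrix (Fin n) (Fin n) ℝ → ℝ) (u : SpaceTime n → ℝ)
    (D : Set (SpaceTime n)) : Prop :=
  ∀ (φ φt : SpaceTime n → ℝ) (gφ : SpaceTime n → Eucl n)
    (Hφ : SpaceTime n → Matrix (Fin n) (Fin n) ℝ) (p₀ : SpaceTime n) (ρ : ℝ),
    0 < ρ → p₀ ∈ D → cylE p₀.1 p₀.2 ρ ⊆ D →
    ParabolicTest φ (cylE p₀.1 p₀.2 ρ) φt gφ Hφ →
    TouchesAbove φ u (cylE p₀.1 p₀.2 ρ) p₀ →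
    φt p₀ ≤ F (Hφ p₀)
def ViscSup {n : ℕ} (F : Matrix (Fin n) (Fin n) ℝ → ℝ) (u : SpaceTime n → ℝ)
    (D : Set (SpaceTime n)) : Prop :=
  ∀ (φ φt : SpaceTime n → ℝ) (gφ : SpaceTime n → Eucl n)
    (Hφ : SpaceTime n → Matrix (Fin n) (Fin n) ℝ) (p₀ : SpaceTime n) (ρ : ℝ),
    0 < ρ → p₀ ∈ D → cylE p₀.1 p₀.2 ρ ⊆ D →
    ParabolicTest φ (cylE p₀.1 p₀.2 ρ) φt gφ Hφ →
    TouchesBelow φ u (cylE p₀.1 p₀.2 ρ) p₀ →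
    F (Hφ p₀) ≤ φt p₀
end
def lastC {d : ℕ} (x : Eucl (d + 1)) : ℝ := x (Fin.last d)
def Kc (d : ℕ) (r : ℝ) : Set (SpaceTime (d + 1)) :=
  {p | p.1 ∈ ball 0 r ∧ 0 < lastC p.1 ∧ p.2 ∈ Ioc (-r) 0}
def Fc (d : ℕ) (r : ℝ) : Set (SpaceTime (d + 1)) :=
  {p | p.1 ∈ ball 0 r ∧ lastC p.1 = 0 ∧ p.2 ∈ Ioc (-r) 0}
def KcP (d : ℕ) (r : ℝ) : Set (SpaceTime (d + 1)) := Kc d r ∪ Fc d r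
def bdryK (d : ℕ) : Set (SpaceTime (d + 1)) :=
  frontier (Kc d 1) \
    (Fc d 1 ∪ {p | p.1 ∈ ball 0 1 ∧ 0 < lastC p.1 ∧ p.2 = 0})
structure ObliqueData (d : ℕ) (lam Λ M C₀ : ℝ)
    (Q Q' : ℝ → Matrix (Fin (d + 1)) (Fin (d + 1)) ℝ)
    (v v' : ℝ → Eucl (d + 1)) : Prop where
  lam_pos : 0 < lam
  lam_le_one : lam ≤ 1
  Lam_ge_one : 1 ≤ Λ
  M_ge_one : 1 ≤ M
  C0_pos : 0 < C₀
  Qsymm : ∀ t ∈ Icc (-1 : ℝ) 0, (Q t).IsSymm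
  Qlower : ∀ t ∈ Icc (-1 : ℝ) 0,
    (Q t - (Λ * M ^ 2)⁻¹ • (1 : Matrix (Fin (d + 1)) (Fin (d + 1)) ℝ)).PosSemidef
  Qupper : ∀ t ∈ Icc (-1 : ℝ) 0,
    ((Λ * M ^ 2) • (1 : Matrix (Fin (d + 1)) (Fin (d + 1)) ℝ) - Q t).PosSemidef
  Qderiv : ∀ t ∈ Icc (-1 : ℝ) 0, ∀ i j,
    HasDerivWithinAt (fun s => Q s i j) (Q' t i j) (Icc (-1 : ℝ) 0) t
  Qderiv_bound : ∀ t ∈ Icc (-1 : ℝ) 0, matOpNorm (Q' t) ≤ C₀ / lam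
  vderiv : ∀ t ∈ Icc (-1 : ℝ) 0, HasDerivWithinAt v (v' t) (Icc (-1 : ℝ) 0) t
  vlast : ∀ t ∈ Icc (-1 : ℝ) 0, M⁻¹ ≤ lastC (v t)
  vbound : ∀ t ∈ Icc (-1 : ℝ) 0, ‖v t‖ ≤ M
  vderiv_bound : ∀ t ∈ Icc (-1 : ℝ) 0, ‖v' t‖ ≤ lam⁻¹
def ObliqueSub (d : ℕ) (lam : ℝ) (Q : ℝ → Matrix (Fin (d + 1)) (Fin (d + 1)) ℝ)
    (v : ℝ → Eucl (d + 1)) (η : SpaceTime (d + 1) → ℝ) : Prop :=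
  ContinuousOn η (KcP d 1) ∧
  ∀ (φ φt : SpaceTime (d + 1) → ℝ) (gφ : SpaceTime (d + 1) → Eucl (d + 1))
    (Hφ : SpaceTime (d + 1) → Matrix (Fin (d + 1)) (Fin (d + 1)) ℝ)
    (p₀ : SpaceTime (d + 1)) (ρ : ℝ),
    0 < ρ →
    ParabolicTest φ (cylE p₀.1 p₀.2 ρ ∩ closure (Kc d 1)) φt gφ Hφ →
    TouchesAbove φ η (cylE p₀.1 p₀.2 ρ ∩ closure (Kc d 1)) p₀ →
    (p₀ ∈ Kc d 1 → lam * φt p₀ ≤ (Q p₀.2 * Hφ p₀).trace) ∧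
    (p₀ ∈ Fc d 1 → φt p₀ ≤ ⟪v p₀.2, gφ p₀⟫)
def ObliqueSup (d : ℕ) (lam : ℝ) (Q : ℝ → Matrix (Fin (d + 1)) (Fin (d + 1)) ℝ)
    (v : ℝ → Eucl (d + 1)) (η : SpaceTime (d + 1) → ℝ) : Prop :=
  ContinuousOn η (KcP d 1) ∧
  ∀ (φ φt : SpaceTime (d + 1) → ℝ) (gφ : SpaceTime (d + 1) → Eucl (d + 1))
    (Hφ : SpaceTime (d + 1) → Matrix (Fin (d + 1)) (Fin (d + 1)) ℝ)
    (p₀ : SpaceTime (d + 1)) (ρ : ℝ),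
    0 < ρ →
    ParabolicTest φ (cylE p₀.1 p₀.2 ρ ∩ closure (Kc d 1)) φt gφ Hφ →
    TouchesBelow φ η (cylE p₀.1 p₀.2 ρ ∩ closure (Kc d 1)) p₀ →
    (p₀ ∈ Kc d 1 → (Q p₀.2 * Hφ p₀).trace ≤ lam * φt p₀) ∧
    (p₀ ∈ Fc d 1 → ⟪v p₀.2, gφ p₀⟫ ≤ φt p₀)
def ObliqueSolution (d : ℕ) (lam : ℝ) (Q : ℝ → Matrix (Fin (d + 1)) (Fin (d + 1)) ℝ)
    (v : ℝ → Eucl (d + 1)) (η : SpaceTime (d + 1) → ℝ) : Prop :=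
  ObliqueSub d lam Q v η ∧ ObliqueSup d lam Q v η
noncomputable def primeDist {d : ℕ} (x y : Eucl (d + 1)) : ℝ :=
  Real.sqrt (∑ i : Fin d, (x i.castSucc - y i.castSucc) ^ 2)
noncomputable def pdist {d : ℕ} (P₁ P₂ : SpaceTime (d + 1)) : ℝ :=
  primeDist P₁.1 P₂.1 +
    min (|lastC P₁.1| + |lastC P₂.1| + |P₁.2 - P₂.2|)
      (|lastC P₁.1 - lastC P₂.1| + Real.sqrt |P₁.2 - P₂.2|)
noncomputable def pdistL {d : ℕ} (lam : ℝ) (P₁ P₂ : SpaceTime (d + 1)) : ℝ :=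
  lam⁻¹ * pdist (lam • P₁.1, lam * P₁.2) (lam • P₂.1, lam * P₂.2)
open Filter Topology
noncomputable section
local notation "LN" => (by linarith)
local notation "PS" => (by positivity)
local notation "NN" => (by norm_num)
local notation "FP" => (by fun_prop)
alias mll := mul_le_mul_of_nonneg_left
alias mlr := mul_le_mul_of_nonneg_right
alias hgf := hasGradientAt_iff_hasFDerivAt
section
variable {n : ℕ} {a b lam C S ah ad am ax t az aa R ak s aq r L M : ℝ} {Q : ℝ → Matrix (Fin n) (Fin n) ℝ} {D D' : Set (SpaceTime n)} {u ut ao bd u' ut' G Gt : SpaceTime n → ℝ} {g g' gG : SpaceTime n → Eucl n} {H H' HG : SpaceTime n → Eucl n →L[ℝ] Eucl n} {p : SpaceTime n} {c x ai : Eucl n} {k : Eucl n → ℝ} {f : ℝ → ℝ}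
def qf {n : ℕ} (Q : Matrix (Fin n) (Fin n) ℝ) (x : Fin n → ℝ) : ℝ := ∑ i, ∑ j, Q i j * (x i * x j)
def op {n : ℕ} (Q : Matrix (Fin n) (Fin n) ℝ) (H : Eucl n →L[ℝ] Eucl n) : ℝ :=
  ∑ i, ∑ j, Q i j * (H (EuclideanSpace.single j 1)) i
structure Ell {n : ℕ} (a b : ℝ) (Q : Matrix (Fin n) (Fin n) ℝ) : Prop where
  symm : ∀ i j, Q i j = Q j i
  lo : ∀ x : Eucl n, a * ‖x‖ ^ 2 ≤ qf Q x
  up : ∀ x : Eucl n, qf Q x ≤ b * ‖x‖ ^ 2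
theorem qf_eq_dot (Q : Matrix (Fin n) (Fin n) ℝ) (x : Fin n → ℝ) :
    qf Q x = star x ⬝ᵥ Q.mulVec x := by
  simp only [qf, dotProduct, Matrix.mulVec, Finset.mul_sum, Pi.star_apply, star_trivial]
  exact Finset.sum_congr rfl fun i _ => Finset.sum_congr rfl fun j _ => by ring
theorem psd_iff {Q : Matrix (Fin n) (Fin n) ℝ} (hs : ∀ i j, Q i j = Q j i) :
    Q.PosSemidef ↔ ∀ x : Fin n → ℝ, 0 ≤ qf Q x := by
  rw [Matrix.posSemidef_iff_dotProduct_mulVec]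
  simp only [qf_eq_dot]
  exact ⟨fun h => h.2, fun h => ⟨by ext i j; simpa using hs j i, h⟩⟩
open scoped MatrixOrder in
theorem psd_sqrt {A : Matrix (Fin n) (Fin n) ℝ} (hA : A.PosSemidef) :
    ∃ B : Matrix (Fin n) (Fin n) ℝ, B.PosSemidef ∧ B * B = A :=
  ⟨CFC.sqrt A, Matrix.nonneg_iff_posSemidef.1 (CFC.sqrt_nonneg A),
    CFC.sqrt_mul_sqrt_self A hA.nonneg⟩
theorem H_expand (H : Eucl n →L[ℝ] Eucl n) (x y : Eucl n) :
    ⟪H x, y⟫ = ∑ i, ∑ j, (y i * x j) * (H (EuclideanSpace.single j 1)) i := by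
  have hx : x = ∑ j, x j • EuclideanSpace.single j (1 : ℝ) := by
    ext i
    simp [Finset.sum_apply, Pi.single_apply]
  conv_lhs => rw [hx]
  simp only [map_sum, map_smul, PiLp.inner_apply, RCLike.inner_apply, conj_trivial]
  refine Finset.sum_congr rfl fun i _ => ?_
  simp [Finset.mul_sum]
  exact Finset.sum_congr rfl fun j _ => by ring
theorem op_decomp {ju : Type*} [Fintype ju] {Q : Matrix (Fin n) (Fin n) ℝ} {m : ju → Eucl n}
    (h : ∀ i j, Q i j = ∑ k, m k i * m k j) (H : Eucl n →L[ℝ] Eucl n) :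
    op Q H = ∑ k, ⟪H (m k), m k⟫ := by
  simp only [op, H_expand, h, Finset.sum_mul]
  conv_rhs => rw [Finset.sum_comm]
  refine Finset.sum_congr rfl fun i _ => ?_
  conv_rhs => rw [Finset.sum_comm]
theorem op_add (Q : Matrix (Fin n) (Fin n) ℝ) (H K : Eucl n →L[ℝ] Eucl n) :
    op Q (H + K) = op Q H + op Q K := by
  simp [op, mul_add, Finset.sum_add_distrib]
theorem op_smul (Q : Matrix (Fin n) (Fin n) ℝ) (c : ℝ) (H : Eucl n →L[ℝ] Eucl n) :
    op Q (c • H) = c * op Q H := by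
  simp only [op, Finset.mul_sum]
  exact Finset.sum_congr rfl fun i _ => Finset.sum_congr rfl fun j _ => by simp; ring
theorem op_neg (Q : Matrix (Fin n) (Fin n) ℝ) (H : Eucl n →L[ℝ] Eucl n) :
    op Q (-H) = - op Q H := by
  simp [op]
theorem op_sub (Q : Matrix (Fin n) (Fin n) ℝ) (H K : Eucl n →L[ℝ] Eucl n) :
    op Q (H - K) = op Q H - op Q K := by
  rw [sub_eq_add_neg, op_add, op_neg]; rfl
theorem op_sub_left (P Q : Matrix (Fin n) (Fin n) ℝ) (H : Eucl n →L[ℝ] Eucl n) :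
    op (P - Q) H = op P H - op Q H := by
  simp [op, sub_mul, Finset.sum_sub_distrib]
theorem coord_le (x : Eucl n) (i : Fin n) : |x i| ≤ ‖x‖ := by
  simpa using PiLp.norm_apply_le x i
theorem normsq_sum (x : Eucl n) : ‖x‖ ^ 2 = ∑ i, x i * x i := by
  rw [EuclideanSpace.real_norm_sq_eq]
  exact Finset.sum_congr rfl fun i _ => by ring
theorem op_abs_le {Q : Matrix (Fin n) (Fin n) ℝ} (hQ : ∀ i j, |Q i j| ≤ az)
    (H : Eucl n →L[ℝ] Eucl n) : |op Q H| ≤ n * n * az * ‖H‖ := by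
  have : ∀ i j, |Q i j * (H (EuclideanSpace.single j 1)) i| ≤ az * ‖H‖ := by
    intro i j
    rw [abs_mul]
    have ab : |(H (EuclideanSpace.single j 1)) i| ≤ ‖H‖ := by
      refine (coord_le _ i).trans ((H.le_opNorm _).trans ?_)
      simp
    exact mul_le_mul (hQ i j) ab (abs_nonneg _) ((abs_nonneg _).trans (hQ i j))
  calc |op Q H| ≤ ∑ i, ∑ j, |Q i j * (H (EuclideanSpace.single j 1)) i| :=
        (Finset.abs_sum_le_sum_abs _ _).trans
          (Finset.sum_le_sum fun i _ => Finset.abs_sum_le_sum_abs _ _)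
    _ ≤ ∑ i : Fin n, ∑ j : Fin n, az * ‖H‖ :=
        Finset.sum_le_sum fun i _ => Finset.sum_le_sum fun j _ => this i j
    _ = n * n * az * ‖H‖ := by simp; ring
theorem psd_vecs {A : Matrix (Fin n) (Fin n) ℝ} (hA : A.PosSemidef) :
    ∃ m : Fin n → Eucl n, (∀ i j, A i j = ∑ k, m k i * m k j) ∧
      ∑ k, ‖m k‖ ^ 2 = ∑ i, A i i := by
  obtain ⟨B, hB, hBA⟩ := psd_sqrt hA
  have hs : ∀ i j, B i j = B j i := fun i j => by simpa using hB.1.apply j i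
  refine ⟨fun k => WithLp.toLp 2 (fun i => B k i), ?_, ?_⟩
  · intro i j
    rw [← hBA, Matrix.mul_apply]
    exact Finset.sum_congr rfl fun k _ => by simp [hs i k]
  · simp only [normsq_sum]
    rw [Finset.sum_comm]
    refine Finset.sum_congr rfl fun i _ => ?_
    rw [← hBA, Matrix.mul_apply]
    exact Finset.sum_congr rfl fun k _ => by simp [hs i k]
theorem qf_single (Q : Matrix (Fin n) (Fin n) ℝ) (i : Fin n) :
    qf Q (EuclideanSpace.single i (1 : ℝ)) = Q i i := by
  simp [qf]
theorem Ell.diag_le {Q : Matrix (Fin n) (Fin n) ℝ} (h : Ell a b Q) (i : Fin n) :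
    Q i i ≤ b := by
  have := h.up (EuclideanSpace.single i 1)
  rw [qf_single] at this; simpa using this
theorem Ell.le_diag {Q : Matrix (Fin n) (Fin n) ℝ} (h : Ell a b Q) (i : Fin n) :
    a ≤ Q i i := by
  have := h.lo (EuclideanSpace.single i 1)
  rw [qf_single] at this; simpa using this
theorem Ell.vecs (ha : 0 ≤ a) {Q : Matrix (Fin n) (Fin n) ℝ} (h : Ell a b Q) :
    ∃ m : Fin n → Eucl n, (∀ H, op Q H = ∑ k, ⟪H (m k), m k⟫) ∧ (∑ k, ‖m k‖ ^ 2 ≤ n * b) ∧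
      (∀ i, ∑ k, m k i * m k i = Q i i) := by
  have hp : Q.PosSemidef := (psd_iff h.symm).2 fun x =>
    le_trans PS (h.lo (WithLp.toLp 2 x))
  obtain ⟨m, ab, af⟩ := psd_vecs hp
  refine ⟨m, fun H => op_decomp ab H, ?_, fun i => (ab i i).symm⟩
  rw [af]
  calc ∑ i, Q i i ≤ ∑ i : Fin n, b := Finset.sum_le_sum fun i _ => h.diag_le i
    _ = n * b := by simp
theorem Ell.refl (ha : 0 ≤ a) {Q : Matrix (Fin n) (Fin n) ℝ} (h : Ell a b Q)
    (e : Eucl n) (he : ‖e‖ = 1) :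
    ∃ m : Fin n → Eucl n, (∀ H, op Q H = a * ⟪H e, e⟫ + ∑ k, ⟪H (m k), m k⟫) ∧
      ∑ k, ‖m k‖ ^ 2 ≤ n * b := by
  set A : Matrix (Fin n) (Fin n) ℝ := fun i j => Q i j - a * (e i * e j) with hA
  have hs : ∀ i j, A i j = A j i := fun i j => by simp only [hA]; rw [h.symm i j]; ring
  have hp : A.PosSemidef := (psd_iff hs).2 fun x => by
    have ab := h.lo (WithLp.toLp 2 x)
    have af : qf A x = qf Q x - a * (⟪WithLp.toLp 2 x, e⟫) ^ 2 := by
      have : (⟪WithLp.toLp 2 x, e⟫) ^ 2 = ∑ i, ∑ j, (x i * e i) * (x j * e j) := by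
        rw [sq, PiLp.inner_apply, Finset.sum_mul_sum]
        simp [mul_comm]
      rw [this, Finset.mul_sum, qf, qf, ← Finset.sum_sub_distrib]
      refine Finset.sum_congr rfl fun i _ => ?_
      rw [Finset.mul_sum, ← Finset.sum_sub_distrib]
      refine Finset.sum_congr rfl fun j _ => ?_
      simp only [hA]; ring
    have aj : (⟪WithLp.toLp 2 x, e⟫) ^ 2 ≤ ‖WithLp.toLp 2 x‖ ^ 2 := by
      have := abs_real_inner_le_norm (WithLp.toLp 2 x) e
      rw [he, mul_one] at this
      exact sq_le_sq.2 (by rwa [abs_of_nonneg (norm_nonneg _)])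
    rw [af]
    have := mll aj ha
    change a * _ ≤ qf Q x at ab
    linarith
  obtain ⟨m, ab, af⟩ := psd_vecs hp
  refine ⟨m, fun H => ?_, ?_⟩
  · rw [← op_decomp ab H, H_expand, op, op, Finset.mul_sum, ← Finset.sum_add_distrib]
    refine Finset.sum_congr rfl fun i _ => ?_
    rw [Finset.mul_sum, ← Finset.sum_add_distrib]
    refine Finset.sum_congr rfl fun j _ => ?_
    simp only [hA]; ring
  · rw [af]
    calc ∑ i, A i i ≤ ∑ i : Fin n, b := Finset.sum_le_sum fun i _ => by
          have := h.diag_le i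
          simp only [hA]
          linarith [mul_nonneg ha (mul_self_nonneg (e i))]
      _ = n * b := by simp
theorem sqrt_lower (hb : 0 < b) {P B : Matrix (Fin n) (Fin n) ℝ}
    (h : Ell a b P) (hB : B.PosSemidef) (hBP : B * B = P) (x : Fin n → ℝ) :
    a / √b * (x ⬝ᵥ x) ≤ x ⬝ᵥ B.mulVec x := by
  obtain ⟨C, hC, hCB⟩ := psd_sqrt hB
  have hBt : B.transpose = B := hB.1
  have hCt : C.transpose = C := hC.1
  have nrm : ∀ y : Fin n → ℝ, ‖(WithLp.toLp 2 y : Eucl n)‖ ^ 2 = y ⬝ᵥ y := fun y => by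
    rw [normsq_sum]; rfl
  have sym : ∀ (D : Matrix (Fin n) (Fin n) ℝ), D.transpose = D → ∀ y z : Fin n → ℝ,
      y ⬝ᵥ (D * D).mulVec z = D.mulVec y ⬝ᵥ D.mulVec z := by
    intro D hD y z
    rw [← Matrix.mulVec_mulVec, Matrix.dotProduct_mulVec, ← Matrix.mulVec_transpose, hD]
  have qP : ∀ y : Fin n → ℝ, qf P y = B.mulVec y ⬝ᵥ B.mulVec y := fun y => by
    rw [qf_eq_dot, ← sym B hBt, hBP]; rfl
  have up : ∀ y : Fin n → ℝ, y ⬝ᵥ B.mulVec y ≤ √b * (y ⬝ᵥ y) := by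
    intro y
    have ab := h.up (WithLp.toLp 2 y)
    rw [nrm] at ab
    change qf P y ≤ _ at ab
    rw [qP, ← nrm, ← nrm] at ab
    have af : y ⬝ᵥ B.mulVec y = ⟪(WithLp.toLp 2 y : Eucl n), WithLp.toLp 2 (B.mulVec y)⟫ := by
      simp [PiLp.inner_apply, dotProduct, mul_comm]
    rw [af, ← nrm]
    refine (real_inner_le_norm _ _).trans ?_
    have aj : ‖(WithLp.toLp 2 (B.mulVec y) : Eucl n)‖ ≤ √b * ‖(WithLp.toLp 2 y : Eucl n)‖ := by
      apply abs_le_of_sq_le_sq' _ PS |>.2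
      rw [mul_pow, Real.sq_sqrt hb.le]; exact ab
    nlinarith [norm_nonneg (WithLp.toLp 2 y : Eucl n)]
  have ab := h.lo (WithLp.toLp 2 x)
  rw [nrm] at ab
  change _ ≤ qf P x at ab
  have af : qf P x = C.mulVec x ⬝ᵥ B.mulVec (C.mulVec x) := by
    rw [qP, ← sym B hBt, ← hCB, Matrix.mulVec_mulVec, Matrix.dotProduct_mulVec,
      Matrix.dotProduct_mulVec, ← Matrix.mulVec_transpose, ← Matrix.mulVec_transpose,
      Matrix.mulVec_mulVec]
    simp [Matrix.transpose_mul, hCt, mul_assoc]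
  have aj := up (C.mulVec x)
  rw [← sym C hCt, hCB] at aj
  have : 0 < √b := Real.sqrt_pos.2 hb
  rw [div_mul_eq_mul_div, div_le_iff₀ this]
  linarith
theorem Ell.pair (ha : 0 < a) (hb : 0 < b) {P Q : Matrix (Fin n) (Fin n) ℝ}
    (hP : Ell a b P) (hQ : Ell a b Q) (bv : ∀ i j, |P i j - Q i j| ≤ az) :
    ∃ m m' : Fin n → Eucl n, (∀ H, op P H = ∑ k, ⟪H (m k), m k⟫) ∧
      (∀ H, op Q H = ∑ k, ⟪H (m' k), m' k⟫) ∧ (∑ k, ‖m k‖ ^ 2 ≤ n * b) ∧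
      (∑ k, ‖m' k‖ ^ 2 ≤ n * b) ∧ (∀ i, ∑ k, m k i * m k i = P i i) ∧
      (∀ i, ∑ k, m' k i * m' k i = Q i i) ∧
      ∑ k, ‖m k - m' k‖ ^ 2 ≤ (n * n * b / (4 * a ^ 2)) * az ^ 2 := by
  have key : ∀ A : Matrix (Fin n) (Fin n) ℝ, Ell a b A → ∃ B : Matrix (Fin n) (Fin n) ℝ,
      B.PosSemidef ∧ B * B = A := fun A h => psd_sqrt <| (psd_iff h.symm).2 fun x =>
    le_trans PS (h.lo (WithLp.toLp 2 x))
  obtain ⟨B, hB, hBP⟩ := key P hP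
  obtain ⟨B', hB', hBQ⟩ := key Q hQ
  have hs : ∀ i j, B i j = B j i := fun i j => by simpa using hB.1.apply j i
  have hs' : ∀ i j, B' i j = B' j i := fun i j => by simpa using hB'.1.apply j i
  have gen : ∀ (B A : Matrix (Fin n) (Fin n) ℝ), (∀ i j, B i j = B j i) → B * B = A → Ell a b A →
      (∀ i j, A i j = ∑ k, (WithLp.toLp 2 (fun i => B k i) : Eucl n) i *
        (WithLp.toLp 2 (fun i => B k i) : Eucl n) j) ∧
      ∑ k, ‖(WithLp.toLp 2 (fun i => B k i) : Eucl n)‖ ^ 2 ≤ n * b := by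
    intro B A hs hBA hA
    have ab : ∀ i j, A i j = ∑ k, (WithLp.toLp 2 (fun i => B k i) : Eucl n) i *
        (WithLp.toLp 2 (fun i => B k i) : Eucl n) j := by
      intro i j
      rw [← hBA, Matrix.mul_apply]
      exact Finset.sum_congr rfl fun k _ => by simp [hs i k]
    refine ⟨ab, ?_⟩
    simp only [normsq_sum]
    rw [Finset.sum_comm]
    calc _ = ∑ i, A i i := Finset.sum_congr rfl fun i _ => (ab i i).symm
      _ ≤ ∑ i : Fin n, b := Finset.sum_le_sum fun i _ => hA.diag_le i
      _ = n * b := by simp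
  obtain ⟨cf, cx⟩ := gen B P hs hBP hP
  obtain ⟨jv, lq⟩ := gen B' Q hs' hBQ hQ
  refine ⟨fun k => WithLp.toLp 2 (fun i => B k i), fun k => WithLp.toLp 2 (fun i => B' k i),
    fun H => op_decomp cf H, fun H => op_decomp jv H, cx, lq, fun i => (cf i i).symm,
    fun i => (jv i i).symm, ?_⟩
  set X := B - B' with hX
  have hXs : ∀ i j, X i j = X j i := fun i j => by simp [hX, hs i j, hs' i j]
  set c := a / √b with hc
  have hcp : 0 < c := PS
  set N := ∑ k, ∑ i, X k i * X k i with hN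
  have hNN : ∑ k, ‖(WithLp.toLp 2 (fun i => B k i) : Eucl n) -
      WithLp.toLp 2 (fun i => B' k i)‖ ^ 2 = N := by
    simp only [normsq_sum]; rfl
  rw [hNN]
  have am : ∀ D : Matrix (Fin n) (Fin n) ℝ, (X * (D * X)).trace =
      ∑ k, X k ⬝ᵥ D.mulVec (X k) := by
    intro D
    simp only [Matrix.trace, Matrix.diag, Matrix.mul_apply, dotProduct, Matrix.mulVec]
    refine Finset.sum_congr rfl fun k _ => Finset.sum_congr rfl fun i _ => ?_
    congr 1
    exact Finset.sum_congr rfl fun j _ => by rw [hXs j k]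
  have dj : (X * (P - Q)).trace = (X * (B * X)).trace + (X * (B' * X)).trace := by
    have : X * (P - Q) = X * (B * X) + X * (X * B') := by
      rw [← hBP, ← hBQ, hX]; noncomm_ring
    rw [this, Matrix.trace_add, ← mul_assoc X X B', Matrix.trace_mul_comm (X * X) B',
      ← mul_assoc B' X X, Matrix.trace_mul_comm (B' * X) X]
  have jw : ∀ D A : Matrix (Fin n) (Fin n) ℝ, Ell a b A → D.PosSemidef → D * D = A →
      c * N ≤ (X * (D * X)).trace := by
    intro D A hA hD hDA
    rw [am, hN, Finset.mul_sum]
    exact Finset.sum_le_sum fun k _ => sqrt_lower hb hA hD hDA (X k)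
  have ou := jw B P hP hB hBP
  have ov := jw B' Q hQ hB' hBQ
  have ow : (X * (P - Q)).trace ≤ c * N + n * n * (az ^ 2 / (4 * c)) := by
    simp only [Matrix.trace, Matrix.diag, Matrix.mul_apply]
    calc _ ≤ ∑ k : Fin n, ∑ i : Fin n, (c * (X k i * X k i) + az ^ 2 / (4 * c)) := by
          refine Finset.sum_le_sum fun k _ => Finset.sum_le_sum fun i _ => ?_
          have ab := bv i k
          have af : X k i * (P - Q) i k ≤ |X k i| * az := by
            refine (le_abs_self _).trans ?_
            rw [abs_mul]
            exact mll ab (abs_nonneg _)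
          have aj : c * (X k i * X k i) + az ^ 2 / (4 * c) - |X k i| * az =
              (2 * c * |X k i| - az) ^ 2 / (4 * c) := by
            rw [← abs_mul_abs_self (X k i)]
            field_simp
            ring
          have aw : 0 ≤ (2 * c * |X k i| - az) ^ 2 / (4 * c) := PS
          linarith
      _ = _ := by
          simp only [Finset.sum_add_distrib, ← Finset.mul_sum]
          simp [hN]; ring
  have ox : c * N ≤ n * n * (az ^ 2 / (4 * c)) := LN
  have lr : N ≤ n * n * (az ^ 2 / (4 * c)) / c := by rw [le_div_iff₀ hcp]; linarith
  refine lr.trans (le_of_eq ?_)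
  have : c ^ 2 = a ^ 2 / b := by rw [hc, div_pow, Real.sq_sqrt hb.le]
  rw [show n * n * (az ^ 2 / (4 * c)) / c = n * n * az ^ 2 / (4 * c ^ 2) by field_simp, this]
  field_simp
def SD (f : ℝ → ℝ) (c : ℝ) : Prop :=
  Tendsto (fun s : ℝ => (f s + f (-s) - 2 * f 0) / s ^ 2) (𝓝[>] 0) (𝓝 c)
theorem SD.of_deriv {f' : ℝ → ℝ} {c : ℝ} (h : ∀ᶠ s in 𝓝 (0:ℝ), HasDerivAt f (f' s) s)
    (h' : HasDerivAt f' c 0) : SD f c := by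
  have hneg : Tendsto (fun s : ℝ => -s) (𝓝[>] 0) (𝓝 0) := by
    have : Tendsto (fun s : ℝ => -s) (𝓝 0) (𝓝 (-0)) := tendsto_id.neg
    rw [neg_zero] at this
    exact this.mono_left nhdsWithin_le_nhds
  have fk : ContinuousAt f 0 := h.self_of_nhds.continuousAt
  refine HasDerivAt.lhopital_zero_nhdsGT (f' := fun s => f' s - f' (-s)) (g' := fun s => 2 * s)
    ?_ ?_ ?_ ?_ ?_ ?_
  · filter_upwards [h.filter_mono nhdsWithin_le_nhds, hneg.eventually h] with s ab af
    have aj : HasDerivAt (fun s => f (-s)) (-(f' (-s))) s := by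
      have := af.comp s (hasDerivAt_neg s); simpa [Function.comp_def] using this
    exact (ab.add aj).sub_const _
  · refine Eventually.of_forall fun s => ?_
    simpa using hasDerivAt_pow 2 s
  · filter_upwards [self_mem_nhdsWithin] with s hs
    have : (0:ℝ) < s := hs
    positivity
  · have ab : Tendsto f (𝓝[>] 0) (𝓝 (f 0)) := fk.tendsto.mono_left nhdsWithin_le_nhds
    have af : Tendsto (fun s => f (-s)) (𝓝[>] 0) (𝓝 (f 0)) := fk.tendsto.comp hneg
    have := (ab.add af).sub_const (2 * f 0)
    convert this using 2; ring
  · have : Tendsto (fun s : ℝ => s ^ 2) (𝓝 0) (𝓝 (0 ^ 2)) := tendsto_id.pow 2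
    rw [zero_pow two_ne_zero] at this
    exact this.mono_left nhdsWithin_le_nhds
  · have ab := h'.tendsto_slope_zero_right
    have af := h'.tendsto_slope_zero_left
    have jx : Tendsto (fun s : ℝ => (-s)⁻¹ • (f' (0 + -s) - f' 0)) (𝓝[>] 0) (𝓝 c) :=
      af.comp (by simpa using tendsto_neg_nhdsGT (a := (0:ℝ)))
    have := (ab.add jx).div_const 2
    refine (this.congr' ?_).trans (by simp)
    filter_upwards [self_mem_nhdsWithin] with s hs
    have : s ≠ 0 := ne_of_gt hs
    simp; field_simp; ring
theorem SD.add {g : ℝ → ℝ} {c d : ℝ} (hf : SD f c) (hg : SD g d) :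
    SD (fun s => f s + g s) (c + d) :=
  (Tendsto.add hf hg).congr fun s => by ring
theorem SD.sub {g : ℝ → ℝ} {c d : ℝ} (hf : SD f c) (hg : SD g d) :
    SD (fun s => f s - g s) (c - d) :=
  (Tendsto.sub hf hg).congr fun s => by ring
theorem SD.quad (ls ay bm : ℝ) : SD (fun s => ls + ay * s + bm * s ^ 2) (2 * bm) := by
  refine tendsto_const_nhds.congr' ?_
  filter_upwards [self_mem_nhdsWithin] with s hs
  have : s ≠ 0 := ne_of_gt hs
  field_simp; ring
theorem SD.le_of_eventually {g : ℝ → ℝ} {c d : ℝ} (hf : SD f c) (hg : SD g d)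
    (h : ∀ᶠ s in 𝓝 (0:ℝ), f s - f 0 ≤ g s - g 0) : c ≤ d := by
  have hneg : Tendsto (fun s : ℝ => -s) (𝓝[>] 0) (𝓝 0) := by
    have : Tendsto (fun s : ℝ => -s) (𝓝 0) (𝓝 (-0)) := tendsto_id.neg
    rw [neg_zero] at this
    exact this.mono_left nhdsWithin_le_nhds
  refine le_of_tendsto_of_tendsto hf hg ?_
  filter_upwards [h.filter_mono nhdsWithin_le_nhds, hneg.eventually h] with s ab af
  gcongr ?_ / _
  linarith
theorem SD.le_of_bound {c : ℝ} (hf : SD f c)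
    (h : ∀ᶠ s in 𝓝[>] (0:ℝ), f s + f (-s) - 2 * f 0 ≤ C * s ^ 2) : c ≤ C := by
  refine le_of_tendsto hf ?_
  filter_upwards [h, self_mem_nhdsWithin] with s ab af
  have : (0:ℝ) < s := af
  rw [div_le_iff₀ PS]; exact ab
theorem left_deriv_nonneg {f' : ℝ} (h : HasDerivWithinAt f f' (Iic 0) t) (ht : t ≤ 0)
    (hm : ∀ᶠ s in 𝓝[<] t, f s ≤ f t) : 0 ≤ f' := by
  have ab : HasDerivWithinAt f f' (Iio t) t := h.mono fun s hs => (le_of_lt hs).trans ht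
  rw [hasDerivWithinAt_iff_tendsto_slope' (by simp)] at ab
  refine ge_of_tendsto ab ?_
  filter_upwards [hm, self_mem_nhdsWithin] with s ab af
  have aj : s < t := af
  rw [slope_def_field]
  exact div_nonneg_of_nonpos LN LN
theorem left_deriv_le {ao : ℝ → ℝ} {f' fv : ℝ} (h : HasDerivWithinAt f f' (Iic 0) t) (ht : t ≤ 0)
    (bj : HasDerivAt ao fv t)
    (hm : ∀ᶠ s in 𝓝[<] t, f s - f t ≤ ao s - ao t) : fv ≤ f' := by
  have := left_deriv_nonneg (h.sub bj.hasDerivWithinAt) ht (by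
    filter_upwards [hm] with s hs
    simp only [Pi.sub_apply]; linarith)
  linarith
structure IC {n : ℕ} (lam : ℝ) (Q : ℝ → Matrix (Fin n) (Fin n) ℝ) (D : Set (SpaceTime n))
    (u ut : SpaceTime n → ℝ) (g : SpaceTime n → Eucl n)
    (H : SpaceTime n → Eucl n →L[ℝ] Eucl n) : Prop where
  cu : ContinuousOn u D
  ct : ContinuousOn ut D
  cg : ContinuousOn g D
  cH : ContinuousOn H D
  dt : ∀ p ∈ D, HasDerivWithinAt (fun s : ℝ => u (p.1, s)) (ut p) (Iic 0) p.2
  dg : ∀ p ∈ D, HasGradientAt (fun y => u (y, p.2)) (g p) p.1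
  dH : ∀ p ∈ D, HasFDerivAt (fun y => g (y, p.2)) (H p) p.1
  pde : ∀ p ∈ D, lam * ut p = op (Q p.2) (H p)
def POp {n : ℕ} (D : Set (SpaceTime n)) : Prop :=
  ∀ p ∈ D, p.2 ≤ 0 ∧ ∃ aa > 0, ∀ q : SpaceTime n, ‖q.1 - p.1‖ < aa → p.2 - aa < q.2 → q.2 ≤ p.2 → q ∈ D
theorem IC.mono (h : IC lam Q D u ut g H) (hD : D' ⊆ D) : IC lam Q D' u ut g H :=
  ⟨h.cu.mono hD, h.ct.mono hD, h.cg.mono hD, h.cH.mono hD, fun p hp => h.dt p (hD hp),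
    fun p hp => h.dg p (hD hp), fun p hp => h.dH p (hD hp), fun p hp => h.pde p (hD hp)⟩
theorem IC.smul (h : IC lam Q D u ut g H) (c : ℝ) :
    IC lam Q D (fun p => c * u p) (fun p => c * ut p) (fun p => c • g p) (fun p => c • H p) where
  cu := continuousOn_const.mul h.cu
  ct := continuousOn_const.mul h.ct
  cg := h.cg.const_smul c
  cH := h.cH.const_smul c
  dt p hp := (h.dt p hp).const_mul c
  dg p hp := by
    have := h.dg p hp
    rw [hgf] at this ⊢
    rw [map_smul]
    exact this.const_mul c
  dH p hp := (h.dH p hp).const_smul c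
  pde p hp := by rw [op_smul, ← h.pde p hp]; ring
theorem IC.add (h : IC lam Q D u ut g H) (h' : IC lam Q D u' ut' g' H') :
    IC lam Q D (fun p => u p + u' p) (fun p => ut p + ut' p) (fun p => g p + g' p)
      (fun p => H p + H' p) where
  cu := h.cu.add h'.cu
  ct := h.ct.add h'.ct
  cg := h.cg.add h'.cg
  cH := h.cH.add h'.cH
  dt p hp := (h.dt p hp).add (h'.dt p hp)
  dg p hp := by
    have ab := h.dg p hp
    have af := h'.dg p hp
    rw [hgf] at ab af ⊢
    rw [map_add]
    exact ab.add af
  dH p hp := (h.dH p hp).add (h'.dH p hp)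
  pde p hp := by rw [op_add, mul_add, h.pde p hp, h'.pde p hp]
theorem IC.neg (h : IC lam Q D u ut g H) :
    IC lam Q D (fun p => - u p) (fun p => - ut p) (fun p => - g p) (fun p => - H p) := by
  have e : (fun p => (-1 : ℝ) • H p) = fun p => - H p := funext fun p => neg_one_smul ℝ (H p)
  have af := h.smul (-1)
  rw [e] at af
  simpa using af
theorem IC.sub (h : IC lam Q D u ut g H) (h' : IC lam Q D u' ut' g' H') :
    IC lam Q D (fun p => u p - u' p) (fun p => ut p - ut' p) (fun p => g p - g' p)
      (fun p => H p - H' p) := by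
  simpa [sub_eq_add_neg] using h.add h'.neg
theorem IC.trans (h : IC lam Q D u ut g H) (k : Eucl n) (hD : ∀ p ∈ D', (p.1 + k, p.2) ∈ D) :
    IC lam Q D' (fun p => u (p.1 + k, p.2)) (fun p => ut (p.1 + k, p.2))
      (fun p => g (p.1 + k, p.2)) (fun p => H (p.1 + k, p.2)) where
  cu := h.cu.comp FP hD
  ct := h.ct.comp FP hD
  cg := h.cg.comp FP hD
  cH := h.cH.comp FP hD
  dt p hp := h.dt _ (hD p hp)
  dg p hp := by
    have ab := h.dg _ (hD p hp)
    rw [hgf] at ab ⊢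
    exact (hasFDerivAt_comp_add_right (f := fun y => u (y, p.2)) k).2 ab
  dH p hp := (hasFDerivAt_comp_add_right (f := fun y => g (y, p.2)) k).2 (h.dH _ (hD p hp))
  pde p hp := h.pde _ (hD p hp)
theorem POp.nhds (hD : POp D) (hp : p ∈ D) : ∀ᶠ y in 𝓝 p.1, (y, p.2) ∈ D := by
  obtain ⟨_, aa, ar, h⟩ := hD p hp
  filter_upwards [ball_mem_nhds p.1 ar] with y hy
  exact h (y, p.2) (by simpa [dist_eq_norm] using hy) (by simp [ar]) le_rfl
theorem IC.line (h : IC lam Q D u ut g H) (hp : p ∈ D) (ag : Eucl n) :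
    HasDerivAt (fun s : ℝ => u (p.1 + s • ag, p.2)) ⟪g p, ag⟫ 0 := by
  have ab := h.dg p hp
  rw [hgf] at ab
  have af : HasDerivAt (fun s : ℝ => p.1 + s • ag) ag 0 := by
    simpa using ((hasDerivAt_id (0:ℝ)).smul_const ag).const_add p.1
  have aj := HasFDerivAt.comp_hasDerivAt (x := (0:ℝ)) (f := fun s : ℝ => p.1 + s • ag)
    (l := fun y => u (y, p.2)) (l' := InnerProductSpace.toDual ℝ (Eucl n) (g p)) (f' := ag)
    (by simpa using ab) af
  simpa [Function.comp_def] using aj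
theorem IC.sd (h : IC lam Q D u ut g H) (hD : POp D) (hp : p ∈ D) (ag : Eucl n) :
    SD (fun s : ℝ => u (p.1 + s • ag, p.2)) ⟪H p ag, ag⟫ := by
  have hc : Tendsto (fun s : ℝ => p.1 + s • ag) (𝓝 0) (𝓝 p.1) := by
    have : Continuous (fun s : ℝ => p.1 + s • ag) := FP
    simpa using this.tendsto 0
  refine SD.of_deriv (f' := fun s => ⟪g (p.1 + s • ag, p.2), ag⟫) ?_ ?_
  · filter_upwards [hc.eventually (hD.nhds hp)] with s hs
    have ab := h.line hs ag
    have af : HasDerivAt (fun r : ℝ => r - s) 1 s := (hasDerivAt_id s).sub_const s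
    have aj : HasDerivAt ((fun r : ℝ => u (p.1 + s • ag + r • ag, p.2)) ∘ (fun r : ℝ => r - s))
        (⟪g (p.1 + s • ag, p.2), ag⟫ * 1) s := HasDerivAt.comp s (by simpa using ab) af
    rw [mul_one] at aj
    refine aj.congr_of_eventuallyEq (Eventually.of_forall fun r => ?_)
    simp only [Function.comp_def]
    congr 2
    rw [add_assoc, ← add_smul]; congr 2; ring
  · have af : HasDerivAt (fun s : ℝ => p.1 + s • ag) ag 0 := by
      simpa using ((hasDerivAt_id (0:ℝ)).smul_const ag).const_add p.1
    have aj := HasFDerivAt.comp_hasDerivAt (x := (0:ℝ)) (f := fun s : ℝ => p.1 + s • ag)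
      (l := fun y => g (y, p.2)) (l' := H p) (f' := ag) (by simpa using h.dH p hp) af
    simpa [Function.comp_def] using aj.inner ℝ (hasDerivAt_const (0:ℝ) ag)
def gh (aa : ℝ) : ℝ := aa - aa ^ 2 / 8
def UU {n : ℕ} (u : SpaceTime n → ℝ) (q : Eucl n × Eucl n × ℝ) : ℝ :=
  u (q.1 + (1/2:ℝ) • q.2.1, q.2.2) - u (q.1 - (1/2:ℝ) • q.2.1, q.2.2)
def TT {n : ℕ} (S A : ℝ) (au : SpaceTime n → ℝ) (q : Eucl n × Eucl n × ℝ) : ℝ :=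
  S * gh (A * ‖q.2.1‖ / au (q.1, q.2.2))
theorem gh_nonneg (bg : 0 ≤ aa) (aw : aa ≤ 4) : 0 ≤ gh aa := by unfold gh; nlinarith
theorem select {R : Set (Eucl n × Eucl n × ℝ)} (hR : IsCompact R) {au : SpaceTime n → ℝ}
    {A : ℝ} (hS : 0 < S) (hA : 0 < A)
    (hU : ContinuousOn (UU u) R) (dk : ContinuousOn (fun q : Eucl n × Eucl n × ℝ => au (q.1, q.2.2)) R)
    (gs : ∀ q ∈ R, A * ‖q.2.1‖ ≤ 4 * au (q.1, q.2.2)) (hb : ∀ q ∈ R, UU u q ≤ 2 * S)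
    {p : Eucl n × Eucl n × ℝ} (hp : p ∈ R) (hpU : TT S A au p < UU u p) :
    ∃ m ∈ R, m.2.1 ≠ 0 ∧ A * ‖m.2.1‖ < 4 * au (m.1, m.2.2) ∧ 0 < UU u m ∧ ∀ q ∈ R,
      UU u q - TT S A au q ≤ UU u m - TT S A au m := by
  have jy : ∀ q ∈ R, 0 ≤ au (q.1, q.2.2) := fun q hq => by
    have := gs q hq
    have : 0 ≤ A * ‖q.2.1‖ := PS
    linarith
  have ar : ∀ q ∈ R, A * ‖q.2.1‖ / au (q.1, q.2.2) ≤ 4 := fun q hq =>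
    div_le_of_le_mul₀ (jy q hq) NN (gs q hq)
  have ih : ∀ q ∈ R, 0 ≤ TT S A au q := fun q hq =>
    mul_nonneg hS.le (gh_nonneg (div_nonneg PS (jy q hq)) (ar q hq))
  set s := UU u p - TT S A au p with hs
  have ca : 0 < s := LN
  have hR' : IsCompact (R ∩ UU u ⁻¹' Ici s) := hR.of_isClosed_subset (hU.preimage_isClosed_of_isClosed hR.isClosed isClosed_Ici) inter_subset_left
  have hne : ∀ q ∈ R ∩ UU u ⁻¹' Ici s, q.2.1 ≠ 0 := by
    rintro q ⟨_, hq⟩ bg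
    have : s ≤ UU u q := hq
    simp [UU, bg] at this
    linarith
  have jz : ∀ q ∈ R ∩ UU u ⁻¹' Ici s, 0 < au (q.1, q.2.2) := by
    intro q hq
    have ab : 0 < A * ‖q.2.1‖ := mul_pos hA (norm_pos_iff.2 (hne q hq))
    have := gs q hq.1
    linarith
  have hTc : ContinuousOn (fun q => UU u q - TT S A au q) (R ∩ UU u ⁻¹' Ici s) := by
    refine (hU.mono inter_subset_left).sub ?_
    have ab : ContinuousOn (fun q : Eucl n × Eucl n × ℝ => A * ‖q.2.1‖ / au (q.1, q.2.2))
        (R ∩ UU u ⁻¹' Ici s) :=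
      ContinuousOn.div FP (dk.mono inter_subset_left) fun q hq => (jz q hq).ne'
    exact continuousOn_const.mul (ab.sub ((ab.pow 2).div_const 8))
  obtain ⟨m, hm, hmax⟩ := hR'.exists_isMaxOn
    ⟨p, hp, by change s ≤ UU u p; have := ih p hp; linarith⟩ hTc
  have hsm : s ≤ UU u m - TT S A au m :=
    hmax ⟨hp, by change s ≤ UU u p; have := ih p hp; linarith⟩
  refine ⟨m, hm.1, hne m hm, lt_of_le_of_ne (gs m hm.1) fun heq => ?_, ca.trans_le hm.2,
    fun q hq => ?_⟩
  · have ab : TT S A au m = S * 2 := by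
      simp only [TT]
      rw [heq, mul_div_assoc, div_self (jz m hm).ne']; simp [gh]; norm_num
    have := hb m hm.1
    linarith
  · by_cases hq' : s ≤ UU u q
    · exact hmax ⟨hq, hq'⟩
    · have := ih q hq
      linarith [not_le.1 hq']
set_option maxHeartbeats 1000000 in
theorem core {A G du ee W : ℝ} (hD : POp D) (hu : IC lam Q D u ut g H)
    (ha : 0 < a) (hb : 0 < b) (hlam : 0 < lam) (hS : 0 < S) (hA : 0 < A)
    {au : SpaceTime n → ℝ} {dv : ℝ} {z h : Eucl n}
    (hQ : Ell a b (Q t))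
    (hx : (z + (1/2:ℝ) • h, t) ∈ D) (hy : (z - (1/2:ℝ) • h, t) ∈ D) (hh : h ≠ 0)
    (aw : A * ‖h‖ < 4 * au (z, t)) (hW : au (z, t) ≤ W) (ka : 0 ≤ du)
    (hline : ∀ ag : Eucl n, ∃ bs k : ℝ, |bs| ≤ G * ‖ag‖ ∧ 0 ≤ k ∧ k ≤ du * ‖ag‖ ^ 2 ∧
      ∀ s : ℝ, au (z + s • ag, t) = au (z, t) + bs * s - k * s ^ 2)
    (lu : HasDerivAt (fun s => au (z, s)) dv t) (hωt0 : 0 ≤ dv) (hωt1 : lam * dv ≤ ee)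
    (dl : ∀ ag : Eucl n, ∀ᶠ s in 𝓝 (0:ℝ), UU u (z + s • ag, h, t) - TT S A au (z + s • ag, h, t) ≤
      UU u (z, h, t) - TT S A au (z, h, t))
    (cy : ∀ᶠ s in 𝓝 (0:ℝ), UU u (z, h + (2 * s / ‖h‖) • h, t) -
      TT S A au (z, h + (2 * s / ‖h‖) • h, t) ≤ UU u (z, h, t) - TT S A au (z, h, t))
    (dm : ∀ᶠ s in 𝓝[<] t, UU u (z, h, s) - TT S A au (z, h, s) ≤
      UU u (z, h, t) - TT S A au (z, h, t)) :
    a * A ^ 2 ≤ n * b * (2 * G ^ 2 + 2 * du * W) + ee * W := by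
  set w := au (z, t) with hw
  set r := ‖h‖ with hr
  have ii : 0 < r := norm_pos_iff.2 hh
  have gt : 0 < w := by
    have : 0 < A * r := PS
    linarith
  set c := A * r with hc
  have kb : 0 < c := PS
  set F : ℝ → ℝ := fun x => S * (c / x - (c / x) ^ 2 / 8) with hF
  set cl : ℝ → ℝ := fun x => S * (- c / x ^ 2 + c ^ 2 / (4 * x ^ 3)) with ij
  have dF : ∀ x : ℝ, 0 < x → HasDerivAt F (cl x) x := by
    intro x hx
    have ab : HasDerivAt (fun x : ℝ => c / x) (-c / x ^ 2) x := by
      have := (hasDerivAt_inv hx.ne').const_mul c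
      simpa [div_eq_mul_inv] using this
    have af := (ab.sub ((ab.pow 2).div_const 8)).const_mul S
    refine af.congr_deriv ?_
    have hx' := hx.ne'
    simp only [ij]; norm_num; field_simp; ring_nf; simp
  have lv : HasDerivAt cl (S * (2 * c / w ^ 3 - 3 * c ^ 2 / (4 * w ^ 4))) w := by
    have ab : HasDerivAt (fun x : ℝ => -c / x ^ 2) (2 * c / w ^ 3) w := by
      have := (hasDerivAt_const w (-c)).div (hasDerivAt_pow 2 w) PS
      refine this.congr_deriv ?_
      field_simp; norm_num; ring
    have af : HasDerivAt (fun x : ℝ => c ^ 2 / (4 * x ^ 3)) (- 3 * c ^ 2 / (4 * w ^ 4)) w := by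
      have := (hasDerivAt_const w (c ^ 2)).div ((hasDerivAt_pow 3 w).const_mul 4) PS
      refine this.congr_deriv ?_
      norm_num; field_simp
    have := (ab.add af).const_mul S
    refine this.congr_deriv ?_
    ring
  have hTF : ∀ z' s', TT S A au (z', h, s') = F (au (z', s')) := fun z' s' => rfl
  set aa := c / w with ar
  have ik : c = aa * w := by rw [ar]; field_simp
  have oy : 0 < aa := PS
  have oz : aa < 4 := by rw [ar, div_lt_iff₀ gt]; exact aw
  have F1a : cl w ≤ 0 := by
    have : cl w = - (S / w) * (aa * (1 - aa / 4)) := by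
      simp only [ij]; rw [ik]; field_simp; ring
    rw [this]
    have : 0 ≤ S / w * (aa * (1 - aa / 4)) := mul_nonneg PS (by nlinarith)
    linarith
  have F1b : -(S / w) ≤ cl w := by
    have : cl w = - (S / w) * (aa * (1 - aa / 4)) := by
      simp only [ij]; rw [ik]; field_simp; ring
    rw [this]
    have : S / w * (aa * (1 - aa / 4)) ≤ S / w * 1 :=
      mll (by linarith [sq_nonneg (aa - 2)]) PS
    linarith
  have lw : S * (2 * c / w ^ 3 - 3 * c ^ 2 / (4 * w ^ 4)) ≤ 2 * (S / w ^ 2) := by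
    have : S * (2 * c / w ^ 3 - 3 * c ^ 2 / (4 * w ^ 4)) =
        S / w ^ 2 * (2 * aa - 3 * aa ^ 2 / 4) := by rw [ik]; field_simp
    rw [this]
    calc _ ≤ S / w ^ 2 * 2 :=
          mll (by linarith [sq_nonneg (3 * aa - 4)]) PS
      _ = _ := by ring
  set Hd := H (z + (1/2:ℝ) • h, t) - H (z - (1/2:ℝ) • h, t) with hHd
  have fw : ∀ ag : Eucl n, ⟪Hd ag, ag⟫ ≤ S / w ^ 2 * (2 * G ^ 2 + 2 * du * W) * ‖ag‖ ^ 2 := by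
    intro ag
    obtain ⟨bs, k, lx, dz, hk, hlin⟩ := hline ag
    have ba := (hu.sd hD hx ag).sub (hu.sd hD hy ag)
    have bb : SD (fun s => F (w + bs * s - k * s ^ 2))
        (S * (2 * c / w ^ 3 - 3 * c ^ 2 / (4 * w ^ 4)) * bs * bs + cl w * (- (2 * k))) := by
      have hp : ∀ s : ℝ, HasDerivAt (fun s : ℝ => w + bs * s - k * s ^ 2) (bs - k * (2 * s)) s := by
        intro s
        have := (((hasDerivAt_id s).const_mul bs).const_add w).sub ((hasDerivAt_pow 2 s).const_mul k)
        refine this.congr_deriv ?_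
        norm_num
      have hpos : ∀ᶠ s in 𝓝 (0:ℝ), 0 < w + bs * s - k * s ^ 2 := by
        have : ContinuousAt (fun s : ℝ => w + bs * s - k * s ^ 2) 0 := FP
        exact this.eventually (lt_mem_nhds (by simpa using gt))
      refine SD.of_deriv (f' := fun s => cl (w + bs * s - k * s ^ 2) * (bs - k * (2 * s))) ?_ ?_
      · filter_upwards [hpos] with s hs
        exact HasDerivAt.comp (h₂ := F) (h := fun s : ℝ => w + bs * s - k * s ^ 2) s (dF _ hs) (hp s)
      · have ab : HasDerivAt (fun s : ℝ => cl (w + bs * s - k * s ^ 2))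
            (S * (2 * c / w ^ 3 - 3 * c ^ 2 / (4 * w ^ 4)) * (bs - k * (2 * 0))) 0 :=
          HasDerivAt.comp (h₂ := cl) (h := fun s : ℝ => w + bs * s - k * s ^ 2) (0:ℝ)
            (by simpa only [mul_zero, add_zero, zero_pow two_ne_zero, sub_zero] using lv) (hp 0)
        have af : HasDerivAt (fun s : ℝ => bs - k * (2 * s)) (- (2 * k)) 0 := by
          have := (((hasDerivAt_id (0:ℝ)).const_mul 2).const_mul k).const_sub bs
          refine this.congr_deriv ?_
          ring
        refine (ab.mul af).congr_deriv ?_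
        simp
    have bt := SD.le_of_eventually ba bb (by
      filter_upwards [dl ag] with s hs
      rw [hTF, hTF, hlin] at hs
      simp only [UU] at hs
      have e : z + s • ag + (1/2:ℝ) • h = z + (1/2:ℝ) • h + s • ag := by abel
      have e' : z + s • ag - (1/2:ℝ) • h = z - (1/2:ℝ) • h + s • ag := by abel
      rw [e, e'] at hs
      simp only [zero_smul, add_zero, mul_zero, sub_zero, ne_eq, OfNat.ofNat_ne_zero,
        not_false_eq_true, zero_pow]
      linarith)
    have ef : ⟪Hd ag, ag⟫ = ⟪H (z + (1/2:ℝ) • h, t) ag, ag⟫ - ⟪H (z - (1/2:ℝ) • h, t) ag, ag⟫ := by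
      rw [hHd]; simp [inner_sub_left]
    rw [ef]
    refine bt.trans ?_
    have fg : S * (2 * c / w ^ 3 - 3 * c ^ 2 / (4 * w ^ 4)) * bs * bs ≤
        2 * (S / w ^ 2) * (G ^ 2 * ‖ag‖ ^ 2) := by
      have : bs * bs ≤ G ^ 2 * ‖ag‖ ^ 2 := by
        rw [← abs_mul_abs_self, ← mul_pow, sq]
        exact mul_self_le_mul_self (abs_nonneg _) lx
      calc _ = S * (2 * c / w ^ 3 - 3 * c ^ 2 / (4 * w ^ 4)) * (bs * bs) := by ring
        _ ≤ 2 * (S / w ^ 2) * (bs * bs) := mlr lw (mul_self_nonneg _)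
        _ ≤ _ := mll this PS
    have il : cl w * (-(2 * k)) ≤ S / w ^ 2 * (2 * du * W) * ‖ag‖ ^ 2 := by
      calc cl w * (-(2 * k)) = (- cl w) * (2 * k) := by ring
        _ ≤ (S / w) * (2 * (du * ‖ag‖ ^ 2)) := by
          apply mul_le_mul LN LN PS PS
        _ = S / w ^ 2 * (2 * du * w) * ‖ag‖ ^ 2 := by field_simp
        _ ≤ _ := by gcongr
    linarith
  set e := (1 / r) • h with he
  have ly : ‖e‖ = 1 := by rw [he, norm_smul, ← hr, Real.norm_of_nonneg PS]; field_simp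
  have ip : ⟪Hd e, e⟫ ≤ - (S / w ^ 2 * A ^ 2) := by
    have ba := (hu.sd hD hx e).sub (hu.sd hD hy (-e))
    have bb := SD.quad (S * gh (c / w)) (S * (2 * A / w - c * A / (2 * w ^ 2)))
      (S * (- (A ^ 2) / (2 * w ^ 2)))
    have bt := SD.le_of_eventually ba bb (by
      have hpos : ∀ᶠ s in 𝓝 (0:ℝ), 0 < 1 + 2 * s / r := by
        have : ContinuousAt (fun s : ℝ => 1 + 2 * s / r) 0 := FP
        exact this.eventually (lt_mem_nhds (by simp))
      filter_upwards [cy, hpos] with s hs bz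
      have co : ‖h + (2 * s / r) • h‖ = r + 2 * s := by
        have : h + (2 * s / r) • h = (1 + 2 * s / r) • h := by rw [add_smul, one_smul]
        rw [this, norm_smul, Real.norm_of_nonneg bz.le, ← hr]; field_simp
      have dw : TT S A au (z, h + (2 * s / r) • h, t) = S * gh (c / w) +
          S * (2 * A / w - c * A / (2 * w ^ 2)) * s + S * (- (A ^ 2) / (2 * w ^ 2)) * s ^ 2 := by
        simp only [TT]; rw [co, ← hw, hc]; simp only [gh]; field_simp; ring
      have eg : z + (1/2:ℝ) • (h + (2 * s / r) • h) = z + (1/2:ℝ) • h + s • e := by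
        rw [he, smul_add, smul_smul, smul_smul, add_assoc]; congr 3; field_simp
      have em : z - (1/2:ℝ) • (h + (2 * s / r) • h) = z - (1/2:ℝ) • h + s • (-e) := by
        rw [he, smul_add, smul_smul, smul_neg, smul_smul, sub_add_eq_sub_sub, ← sub_eq_add_neg]
        congr 2; field_simp
      have kc : TT S A au (z, h, t) = S * gh (c / w) := rfl
      rw [dw, kc] at hs
      simp only [UU] at hs
      rw [eg, em] at hs
      simp only [zero_smul, add_zero, mul_zero, ne_eq, OfNat.ofNat_ne_zero,
        not_false_eq_true, zero_pow]
      linarith)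
    have ef : ⟪Hd e, e⟫ = ⟪H (z + (1/2:ℝ) • h, t) e, e⟫ -
        ⟪H (z - (1/2:ℝ) • h, t) (-e), -e⟫ := by
      rw [hHd]; simp [inner_sub_left]
    rw [ef]
    refine bt.trans (le_of_eq ?_)
    field_simp
  have lz : cl w * dv ≤ ut (z + (1/2:ℝ) • h, t) - ut (z - (1/2:ℝ) • h, t) := by
    refine left_deriv_le ((hu.dt _ hx).sub (hu.dt _ hy)) (hD _ hx).1
      (ao := fun s => F (au (z, s))) (HasDerivAt.comp (h₂ := F) (h := fun s => au (z, s)) t (dF w gt) lu) ?_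
    filter_upwards [dm] with s hs
    rw [hTF, hTF] at hs
    simp only [UU] at hs
    simp only [Pi.sub_apply]
    linarith
  obtain ⟨m, hm, hmn⟩ := hQ.refl ha.le e ly
  have eh := hu.pde _ hx
  have eo := hu.pde _ hy
  have kd : lam * (ut (z + (1/2:ℝ) • h, t) - ut (z - (1/2:ℝ) • h, t)) = op (Q t) Hd := by
    rw [hHd, op_sub]; simp only at eh eo; rw [mul_sub, eh, eo]
  rw [hm] at kd
  set B := S / w ^ 2 * (2 * G ^ 2 + 2 * du * W) with hB
  have iq : 0 < W := gt.trans_le hW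
  have ir : 0 ≤ B := PS
  have ma : ∑ k, ⟪Hd (m k), m k⟫ ≤ B * (n * b) := by
    calc _ ≤ ∑ k, B * ‖m k‖ ^ 2 := Finset.sum_le_sum fun k _ => fw (m k)
      _ = B * ∑ k, ‖m k‖ ^ 2 := by rw [Finset.mul_sum]
      _ ≤ _ := mll hmn ir
  have pa : - (S / w ^ 2 * (ee * W)) ≤ lam * (cl w * dv) := by
    have bw : -(S / w) * (lam * dv) ≤ cl w * (lam * dv) :=
      mlr F1b PS
    have ch : 0 ≤ lam * dv := PS
    have bn : S / w * (lam * dv) ≤ S / w ^ 2 * (ee * W) := by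
      calc S / w * (lam * dv) ≤ S / w * ee := by gcongr
        _ = S / w ^ 2 * (ee * w) := by field_simp
        _ ≤ _ := by
          have : 0 ≤ ee := ch.trans hωt1
          gcongr
    linarith
  have pb := mll lz hlam.le
  have mb := mll ip ha.le
  have mc : S / w ^ 2 * (a * A ^ 2) ≤
      S / w ^ 2 * (n * b * (2 * G ^ 2 + 2 * du * W) + ee * W) := by
    have md : B * (n * b) = S / w ^ 2 * (n * b * (2 * G ^ 2 + 2 * du * W)) := by rw [hB]; ring
    rw [md] at ma
    have me : a * -(S / w ^ 2 * A ^ 2) = - (S / w ^ 2 * (a * A ^ 2)) := by ring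
    rw [me] at mb
    rw [mul_add]
    linarith
  exact le_of_mul_le_mul_left mc PS
theorem INT (hD : POp D) (hu : IC lam Q D u ut g H)
    (ha : 0 < a) (hb : 0 < b) (hlam : 0 < lam) (hS : 0 < S) (hA : 8 ≤ ax)
    (cz : n * b * 40 + 1 < a * ax ^ 2) (bk : 0 < ah)
    (hQ : ∀ t ∈ Icc (ad - lam * ah ^ 2) ad, Ell a b (Q t))
    (hcyl : ∀ x t, ‖x - c‖ ≤ ah → t ∈ Icc (ad - lam * ah ^ 2) ad → (x, t) ∈ D ∧ |u (x, t)| ≤ S)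
    (h : Eucl n) (hh : ax * ‖h‖ ≤ 4 * ah) :
    u (c + (1/2:ℝ) • h, ad) - u (c - (1/2:ℝ) • h, ad) ≤ S * ax / ah * ‖h‖ := by
  set au : SpaceTime n → ℝ := fun p => ah ^ 2 - 4 * ‖p.1 - c‖ ^ 2 + (p.2 - ad) / lam with dk
  set A := ax * ah with hAd
  have da : 0 < A := PS
  set R : Set (Eucl n × Eucl n × ℝ) := {q | q.2.2 ≤ ad ∧ A * ‖q.2.1‖ ≤ 4 * au (q.1, q.2.2)} with hR
  have ej : Continuous au := by simp only [dk]; fun_prop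
  have ea : ∀ q ∈ R, ‖q.1 - c‖ ≤ ah / 2 ∧ ‖q.2.1‖ ≤ ah / 2 ∧ q.2.2 ∈ Icc (ad - lam * ah ^ 2) ad ∧
      au (q.1, q.2.2) ≤ ah ^ 2 := by
    rintro ⟨z, h, t⟩ ⟨ab, af⟩
    simp only [dk] at ab af ⊢
    have aj : (t - ad) / lam ≤ 0 := div_nonpos_of_nonpos_of_nonneg LN hlam.le
    have aw : 0 ≤ A * ‖h‖ := PS
    have bx : 0 ≤ ‖z - c‖ ^ 2 := PS
    refine ⟨abs_le_of_sq_le_sq' (by linarith) PS |>.2, ?_, ⟨?_, ab⟩, LN⟩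
    · have : ax * ah * ‖h‖ ≤ 4 * ah ^ 2 := by linarith
      have dn : 8 * ah * ‖h‖ ≤ ax * ah * ‖h‖ := by gcongr
      by_contra gu
      have : ah * (ah / 2) < ah * ‖h‖ := mul_lt_mul_of_pos_left (not_le.1 gu) bk
      linarith
    · have dn : - ah ^ 2 ≤ (t - ad) / lam := by linarith
      rw [le_div_iff₀ hlam] at dn
      linarith
  have hin : ∀ q ∈ R, ‖q.1 + (1/2:ℝ) • q.2.1 - c‖ ≤ ah ∧ ‖q.1 - (1/2:ℝ) • q.2.1 - c‖ ≤ ah := by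
    intro q hq
    obtain ⟨ab, af, _, _⟩ := ea q hq
    have aj : ‖(1/2:ℝ) • q.2.1‖ ≤ ah / 4 := by rw [norm_smul]; norm_num; linarith
    constructor
    · calc _ = ‖(q.1 - c) + (1/2:ℝ) • q.2.1‖ := by congr 1; abel
        _ ≤ _ := (norm_add_le _ _).trans LN
    · calc _ = ‖(q.1 - c) - (1/2:ℝ) • q.2.1‖ := by congr 1; abel
        _ ≤ _ := (norm_sub_le _ _).trans LN
  have hRc : IsCompact R := by
    refine IsCompact.of_isClosed_subset ((isCompact_closedBall c (ah/2)).prod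
      ((isCompact_closedBall (0 : Eucl n) (ah/2)).prod (isCompact_Icc (a := ad - lam * ah ^ 2) (b := ad)))) ?_ ?_
    · have bl : IsClosed {q : Eucl n × Eucl n × ℝ | q.2.2 ≤ ad} :=
        isClosed_le FP continuous_const
      have bq : IsClosed {q : Eucl n × Eucl n × ℝ | A * ‖q.2.1‖ ≤ 4 * au (q.1, q.2.2)} :=
        isClosed_le FP (continuous_const.mul (ej.comp FP))
      exact bl.inter bq
    · intro q hq
      obtain ⟨ab, af, aj, _⟩ := ea q hq
      exact ⟨by simpa [dist_eq_norm] using ab, by simpa using af, aj⟩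
  have hU : ContinuousOn (UU u) R := by
    refine (hu.cu.comp FP ?_).sub (hu.cu.comp FP ?_)
    · intro q hq; exact (hcyl _ _ (hin q hq).1 (ea q hq).2.2.1).1
    · intro q hq; exact (hcyl _ _ (hin q hq).2 (ea q hq).2.2.1).1
  have hUb : ∀ q ∈ R, UU u q ≤ 2 * S := by
    intro q hq
    have ab := abs_le.1 (hcyl _ _ (hin q hq).1 (ea q hq).2.2.1).2
    have af := abs_le.1 (hcyl _ _ (hin q hq).2 (ea q hq).2.2.1).2
    simp only [UU]; linarith
  have hp : (c, h, ad) ∈ R := by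
    refine ⟨le_rfl, ?_⟩
    simp only [dk, hAd]; simp; nlinarith
  by_contra hcon
  have hlt : TT S A au (c, h, ad) < UU u (c, h, ad) := by
    refine lt_of_le_of_lt ?_ (not_le.1 hcon)
    simp only [TT, dk, hAd, gh]; simp
    have : ax * ah * ‖h‖ / ah ^ 2 = ax / ah * ‖h‖ := by field_simp
    rw [this]
    have : S * ax / ah * ‖h‖ = S * (ax / ah * ‖h‖) := by ring
    rw [this]
    apply mll _ hS.le
    have : 0 ≤ (ax / ah * ‖h‖) ^ 2 := PS
    linarith
  obtain ⟨⟨z, k, t⟩, hm, dz, dp, hUm, hmax⟩ := select hRc hS da hU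
    (ej.comp FP).continuousOn (fun q hq => hq.2) hUb hp hlt
  simp only at dz dp
  obtain ⟨eb, fx, cb, fl⟩ := ea _ hm
  simp only at eb fx cb fl
  have key := core (G := 4 * ah) (du := 4) (ee := 1) (W := ah ^ 2) (dv := 1 / lam) (z := z) (h := k)
    (t := t) (au := au) hD hu ha hb hlam hS da (hQ t cb) (hcyl _ _ (hin _ hm).1 cb).1
    (hcyl _ _ (hin _ hm).2 cb).1 dz dp fl NN ?_ ?_ PS
    (by field_simp; exact le_rfl) ?_ ?_ ?_
  · have : a * A ^ 2 = ah ^ 2 * (a * ax ^ 2) := by rw [hAd]; ring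
    rw [this] at key
    have : ah ^ 2 * (n * b * 40 + 1) < ah ^ 2 * (a * ax ^ 2) := mul_lt_mul_of_pos_left cz PS
    linarith
  · intro ag
    refine ⟨- 8 * ⟪z - c, ag⟫, 4 * ‖ag‖ ^ 2, ?_, PS, le_rfl, fun s => ?_⟩
    · rw [abs_mul]
      have := abs_real_inner_le_norm (z - c) ag
      have ab : ‖z - c‖ * ‖ag‖ ≤ ah / 2 * ‖ag‖ := by gcongr
      norm_num; linarith
    · simp only [dk]
      have : z + s • ag - c = (z - c) + s • ag := by abel
      rw [this, norm_add_sq_real, inner_smul_right, norm_smul, mul_pow, Real.norm_eq_abs, sq_abs]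
      ring
  · have := ((hasDerivAt_id t).sub_const ad).div_const lam |>.const_add (ah ^ 2 - 4 * ‖z - c‖ ^ 2)
    simpa [dk] using this
  · intro ag
    have : ContinuousAt (fun s : ℝ => 4 * au (z + s • ag, t)) 0 :=
      (continuous_const.mul (ej.comp FP)).continuousAt
    filter_upwards [this.eventually (lt_mem_nhds (a := A * ‖k‖) (by simpa using dp))] with s hs
    exact hmax _ ⟨cb.2, hs.le⟩
  · have : ContinuousAt (fun s : ℝ => 4 * au (z, t) - A * ‖k + (2 * s / ‖k‖) • k‖) 0 := FP
    filter_upwards [this.eventually (lt_mem_nhds (a := 0) (by simpa using dp))] with s hs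
    exact hmax _ ⟨cb.2, by simp only; linarith⟩
  · have : ContinuousAt (fun s : ℝ => 4 * au (z, s)) t :=
      (continuous_const.mul (ej.comp FP)).continuousAt
    filter_upwards [(this.eventually (lt_mem_nhds (a := A * ‖k‖) dp)).filter_mono
      nhdsWithin_le_nhds, self_mem_nhdsWithin] with s hs hs'
    exact hmax _ ⟨(le_of_lt hs').trans cb.2, hs.le⟩
theorem grad_le (hu : IC lam Q D u ut g H) (hp : p ∈ D)
    (e : Eucl n)
    (h : ∀ᶠ s in 𝓝[>] (0:ℝ), u (p.1 + (1/2:ℝ) • s • e, p.2) - u (p.1 - (1/2:ℝ) • s • e, p.2) ≤ C * s) :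
    ⟪g p, e⟫ ≤ C := by
  have ab := hu.line hp ((1/2:ℝ) • e)
  have af := hu.line hp (-((1/2:ℝ) • e))
  have aj := (ab.sub af).tendsto_slope_zero_right
  have aw : ⟪g p, (1/2:ℝ) • e⟫ - ⟪g p, -((1/2:ℝ) • e)⟫ = ⟪g p, e⟫ := by
    rw [inner_neg_right, inner_smul_right]; ring
  rw [aw] at aj
  refine le_of_tendsto aj ?_
  filter_upwards [h, self_mem_nhdsWithin] with s hs ca
  have bz : (0:ℝ) < s := ca
  simp only [zero_add, Pi.sub_apply, zero_smul, add_zero, sub_self, sub_zero, smul_eq_mul, smul_neg,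
    ← sub_eq_add_neg]
  rw [smul_comm s, inv_mul_le_iff₀ bz]
  linarith
theorem norm_le_of_inner (hC : 0 ≤ C)
    (h : ∀ e : Eucl n, ‖e‖ = 1 → ⟪x, e⟫ ≤ C) : ‖x‖ ≤ C := by
  by_cases hx : x = 0
  · simpa [hx] using hC
  · have hx' : ‖x‖ ≠ 0 := norm_ne_zero_iff.2 hx
    have := h (‖x‖⁻¹ • x) (by rw [norm_smul, norm_inv, norm_norm, inv_mul_cancel₀ hx'])
    rw [inner_smul_right, real_inner_self_eq_norm_sq] at this
    have e : ‖x‖⁻¹ * ‖x‖ ^ 2 = ‖x‖ := by field_simp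
    rwa [e] at this
theorem INTg (hD : POp D) (hu : IC lam Q D u ut g H)
    (ha : 0 < a) (hb : 0 < b) (hlam : 0 < lam) (hS : 0 ≤ S) (hA : 8 ≤ ax)
    (cz : n * b * 40 + 1 < a * ax ^ 2) (bk : 0 < ah)
    (hQ : ∀ t ∈ Icc (ad - lam * ah ^ 2) ad, Ell a b (Q t))
    (hcyl : ∀ x t, ‖x - c‖ ≤ ah → t ∈ Icc (ad - lam * ah ^ 2) ad → (x, t) ∈ D ∧ |u (x, t)| ≤ S) :
    ‖g (c, ad)‖ ≤ S * ax / ah := by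
  have bg : (c, ad) ∈ D := (hcyl c ad (by simpa using bk.le) ⟨by nlinarith [sq_nonneg ah], le_rfl⟩).1
  refine le_of_forall_pos_le_add fun ak bi => ?_
  obtain ⟨S', hS', mf, mg⟩ : ∃ S' : ℝ, 0 < S' ∧ S ≤ S' ∧ S' * ax / ah = S * ax / ah + ak :=
    ⟨S + ak * ah / ax, PS, by simp; positivity, by field_simp⟩
  rw [← mg]
  refine norm_le_of_inner PS fun e he => grad_le hu bg e ?_
  have : ∀ᶠ s in 𝓝[>] (0:ℝ), ax * s < 4 * ah := by
    have : ContinuousAt (fun s : ℝ => ax * s) 0 := FP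
    exact (this.eventually (gt_mem_nhds (by simpa using bk))).filter_mono nhdsWithin_le_nhds
  filter_upwards [this, self_mem_nhdsWithin] with s hs ca
  have bz : (0:ℝ) < s := ca
  have hn : ‖s • e‖ = s := by rw [norm_smul, he, Real.norm_of_nonneg bz.le, mul_one]
  have := INT hD hu ha hb hlam hS' hA cz bk hQ (fun x t hx ht =>
    ⟨(hcyl x t hx ht).1, (hcyl x t hx ht).2.trans mf⟩) (s • e) (by rw [hn]; exact hs.le)
  rwa [hn] at this
theorem IC.mvt (hu : IC lam Q D u ut g H) {k : Eucl n}
    (h : ∀ s ∈ Icc (0:ℝ) 1, (x + s • k, t) ∈ D ∧ ‖g (x + s • k, t)‖ ≤ S) :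
    |u (x + k, t) - u (x, t)| ≤ S * ‖k‖ := by
  have hd : ∀ y ∈ segment ℝ x (x + k), HasFDerivWithinAt (fun y => u (y, t))
      (InnerProductSpace.toDual ℝ (Eucl n) (g (y, t))) (segment ℝ x (x + k)) y ∧ ‖g (y, t)‖ ≤ S := by
    intro y hy
    rw [segment_eq_image'] at hy
    obtain ⟨s, hs, rfl⟩ := hy
    simp only [add_sub_cancel_left]
    obtain ⟨ab, af⟩ := h s hs
    exact ⟨(hgf.1 (hu.dg _ ab)).hasFDerivWithinAt, af⟩
  have := (convex_segment x (x + k)).norm_image_sub_le_of_norm_hasFDerivWithin_le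
    (fun y hy => (hd y hy).1) (C := S) (fun y hy => by simpa using (hd y hy).2)
    (left_mem_segment ℝ x (x + k)) (right_mem_segment ℝ x (x + k))
  simpa using this
theorem INTH (hD : POp D) (hu : IC lam Q D u ut g H)
    (ha : 0 < a) (hb : 0 < b) (hlam : 0 < lam) (hS : 0 ≤ S) (hA : 8 ≤ ax)
    (cz : n * b * 40 + 1 < a * ax ^ 2) (bk : 0 < ah)
    (hQ : ∀ t ∈ Icc (ad - lam * ah ^ 2) ad, Ell a b (Q t))
    (hcyl : ∀ x t, ‖x - c‖ ≤ 2 * ah → t ∈ Icc (ad - lam * ah ^ 2) ad → (x, t) ∈ D ∧ ‖g (x, t)‖ ≤ S) :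
    ‖H (c, ad)‖ ≤ S * ax / ah := by
  have bg : (c, ad) ∈ D := (hcyl c ad (by simpa using bk.le) ⟨by nlinarith [sq_nonneg ah], le_rfl⟩).1
  refine ContinuousLinearMap.opNorm_le_of_unit_norm (𝕜 := ℝ) PS fun e he => ?_
  have hd : HasDerivAt (fun s : ℝ => g (c + s • e, ad)) (H (c, ad) e) 0 := by
    have af : HasDerivAt (fun s : ℝ => c + s • e) e 0 := by
      simpa using ((hasDerivAt_id (0:ℝ)).smul_const e).const_add c
    have aj := HasFDerivAt.comp_hasDerivAt (x := (0:ℝ)) (f := fun s : ℝ => c + s • e)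
      (l := fun y => g (y, ad)) (l' := H (c, ad)) (f' := e) (by simpa using hu.dH _ bg) af
    simpa [Function.comp_def] using aj
  refine le_of_tendsto hd.tendsto_slope_zero_right.norm ?_
  have : ∀ᶠ s in 𝓝[>] (0:ℝ), s < ah := (gt_mem_nhds bk).filter_mono nhdsWithin_le_nhds
  filter_upwards [this, self_mem_nhdsWithin] with s hs ca
  have bz : (0:ℝ) < s := ca
  set D' : Set (SpaceTime n) := D ∩ {p | (p.1 + s • e, p.2) ∈ D} with hD'
  have hPD : POp D' := by
    rintro p ⟨ab, af⟩
    obtain ⟨aj, aa, ar, aw⟩ := hD _ ab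
    obtain ⟨_, cp, it, bx⟩ := hD _ af
    refine ⟨aj, min aa cp, lt_min ar it, fun q bw bn ch => ⟨?_, ?_⟩⟩
    · exact aw q (bw.trans_le (min_le_left _ _)) (by linarith [min_le_left aa cp]) ch
    · refine bx _ ?_ (by simp only; linarith [min_le_right aa cp]) ch
      simp only [add_sub_add_right_eq_sub]
      exact bw.trans_le (min_le_right _ _)
  have hw := ((hu.trans (D' := D') (s • e) fun p hp => hp.2).sub (hu.mono inter_subset_left)).smul s⁻¹
  have := INTg hPD hw ha hb hlam hS hA cz bk hQ (c := c) (ad := ad) (by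
    intro x t hx ht
    have hn : ‖s • e‖ = s := by rw [norm_smul, he, Real.norm_of_nonneg bz.le, mul_one]
    have hseg : ∀ r ∈ Icc (0:ℝ) 1, ‖x + r • s • e - c‖ ≤ 2 * ah := by
      intro r hr
      calc _ = ‖(x - c) + r • s • e‖ := by congr 1; abel
        _ ≤ ‖x - c‖ + ‖r • s • e‖ := norm_add_le _ _
        _ ≤ _ := by
          rw [norm_smul, hn, Real.norm_of_nonneg hr.1]
          nlinarith [hr.2]
    refine ⟨⟨(hcyl x t LN ht).1, ?_⟩, ?_⟩
    · have := hseg 1 (by simp)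
      rw [one_smul] at this
      exact (hcyl _ t this ht).1
    · have := hu.mvt (x := x) (k := s • e) (t := t) fun r hr => hcyl _ t (hseg r hr) ht
      rw [hn] at this
      rw [abs_mul, abs_of_pos (inv_pos.2 bz), inv_mul_le_iff₀ bz]
      linarith)
  simpa using this
theorem INTgH (hD : POp D) (hu : IC lam Q D u ut g H)
    (ha : 0 < a) (hb : 0 < b) (hlam : 0 < lam) (hS : 0 ≤ S) (hA : 8 ≤ ax)
    (cz : n * b * 40 + 1 < a * ax ^ 2) (bk : 0 < ah)
    (hQ : ∀ t ∈ Icc (ad - 2 * lam * ah ^ 2) ad, Ell a b (Q t))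
    (hcyl : ∀ x t, ‖x - c‖ ≤ 3 * ah → t ∈ Icc (ad - 2 * lam * ah ^ 2) ad →
      (x, t) ∈ D ∧ |u (x, t)| ≤ S) :
    ‖g (c, ad)‖ ≤ S * ax / ah ∧ ‖H (c, ad)‖ ≤ S * ax / ah * ax / ah := by
  have hls : 0 < lam * ah ^ 2 := PS
  have key : ∀ x t, ‖x - c‖ ≤ 2 * ah → t ∈ Icc (ad - lam * ah ^ 2) ad →
      (x, t) ∈ D ∧ ‖g (x, t)‖ ≤ S * ax / ah := by
    intro x t hx ht
    refine ⟨(hcyl x t LN ⟨by linarith [ht.1], ht.2⟩).1, ?_⟩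
    refine INTg hD hu ha hb hlam hS hA cz bk (fun s hs => hQ s ⟨?_, hs.2.trans ht.2⟩)
      fun y s hy hs => hcyl y s ?_ ⟨?_, hs.2.trans ht.2⟩
    · linarith [hs.1, ht.1]
    · have : y - c = (y - x) + (x - c) := by abel
      rw [this]; exact (norm_add_le _ _).trans LN
    · linarith [hs.1, ht.1]
  refine ⟨(key c ad (by simpa using bk.le) ⟨LN, le_rfl⟩).2, ?_⟩
  exact INTH hD hu ha hb hlam PS hA cz bk
    (fun s hs => hQ s ⟨by linarith [hs.1], hs.2⟩) key
def cosm {n : ℕ} (ag : Eucl n) (c : ℝ) : Eucl n → ℝ := fun x => Real.cos (⟪ag, x⟫ + c)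
def TS (n : ℕ) : Submodule ℝ (Eucl n → ℝ) := Submodule.span ℝ {f | ∃ ag c, f = cosm ag c}
theorem cosm_mem (ag : Eucl n) (c : ℝ) : cosm ag c ∈ TS n := Submodule.subset_span ⟨ag, c, rfl⟩
theorem TS_mul {f g : Eucl n → ℝ} (hf : f ∈ TS n) (hg : g ∈ TS n) : f * g ∈ TS n := by
  refine Submodule.span_induction₂ (p := fun f g _ _ => f * g ∈ TS n) ?_ ?_ ?_ ?_ ?_ ?_ ?_ hf hg
  · rintro _ _ ⟨ag, c, rfl⟩ ⟨cc, d, rfl⟩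
    have : cosm ag c * cosm cc d = (1/2:ℝ) • cosm (ag + cc) (c + d) + (1/2:ℝ) • cosm (ag - cc) (c - d) := by
      ext x
      simp only [cosm, Pi.mul_apply, Pi.add_apply, Pi.smul_apply, smul_eq_mul, inner_add_left,
        inner_sub_left]
      have ba : ⟪ag, x⟫ + ⟪cc, x⟫ + (c + d) = (⟪ag, x⟫ + c) + (⟪cc, x⟫ + d) := by ring
      have bb : ⟪ag, x⟫ - ⟪cc, x⟫ + (c - d) = (⟪ag, x⟫ + c) - (⟪cc, x⟫ + d) := by ring
      rw [ba, bb, Real.cos_add (⟪ag, x⟫ + c) (⟪cc, x⟫ + d), Real.cos_sub (⟪ag, x⟫ + c) (⟪cc, x⟫ + d)]; ring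
    rw [this]
    exact add_mem (Submodule.smul_mem _ _ (cosm_mem _ _)) (Submodule.smul_mem _ _ (cosm_mem _ _))
  · intro y hy; simp
  · intro y hy; simp
  · intro x y z _ _ _ ab af; rw [add_mul]; exact add_mem ab af
  · intro x y z _ _ _ ab af; rw [mul_add]; exact add_mem ab af
  · intro r x y _ _ h; rw [smul_mul_assoc]; exact Submodule.smul_mem _ _ h
  · intro r x y _ _ h; rw [mul_smul_comm]; exact Submodule.smul_mem _ _ h
theorem TS_alg {K : Type*} [TopologicalSpace K] [CompactSpace K] (bf : Eucl n → K) :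
    ∃ A : Subalgebra ℝ C(K, ℝ), ∀ f : C(K, ℝ), f ∈ A ↔ (fun x => f (bf x)) ∈ TS n :=
  ⟨{ carrier := {f | (fun x => f (bf x)) ∈ TS n}
     mul_mem' := fun {f g} hf hg => by
        simp only [mem_setOf_eq] at hf hg ⊢
        exact TS_mul hf hg
     add_mem' := fun {f g} hf hg => by
        simp only [mem_setOf_eq] at hf hg ⊢
        exact (TS n).add_mem hf hg
     algebraMap_mem' := fun r => by
        have : (fun x : Eucl n => (algebraMap ℝ C(K, ℝ) r) (bf x)) = r • cosm 0 0 := by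
          ext x; simp [cosm]
        simp only [mem_setOf_eq]
        rw [this]; exact Submodule.smul_mem _ _ (cosm_mem _ _) }, fun f => Iff.rfl⟩
theorem tri_approx {u : Eucl n → ℝ} (hL : 0 < L) (bi : 0 < ak)
    (pc : ak ≤ 1) (hu : ContinuousOn u {x | ∀ i, |x i - ai i| ≤ L * (Real.pi / 2)})
    (ep : ∀ x, (∀ i, |x i - ai i| ≤ L * (Real.pi / 2)) → |u x| ≤ 1) :
    ∃ g ∈ TS n, (∀ x, |g x| ≤ 2) ∧ ∀ x, (∀ i, |x i - ai i| ≤ L * (Real.pi / 2)) → |g x - u x| ≤ ak := by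
  obtain ⟨K, hKc, hKm⟩ : ∃ K : Set (Fin n → ℝ), IsCompact K ∧
      ∀ y : Fin n → ℝ, (∀ i, y i ∈ Icc (-1:ℝ) 1) → y ∈ K :=
    ⟨Set.pi univ fun _ => Icc (-1:ℝ) 1, isCompact_univ_pi fun _ => isCompact_Icc, fun y hy i _ => hy i⟩
  haveI : CompactSpace K := isCompact_iff_compactSpace.1 hKc
  obtain ⟨bf, fy⟩ : ∃ bf : Eucl n → K, ∀ x i, (bf x).1 i = Real.sin ((x i - ai i) / L) :=
    ⟨fun x => ⟨fun i => Real.sin ((x i - ai i) / L), hKm _ fun i =>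
    ⟨Real.neg_one_le_sin _, Real.sin_le_one _⟩⟩, fun x i => rfl⟩
  obtain ⟨A, hA⟩ := TS_alg bf
  have hsep : A.SeparatesPoints := by
    intro y z hyz
    obtain ⟨i, hi⟩ : ∃ i, y.1 i ≠ z.1 i := by
      by_contra h; push Not at h; exact hyz (Subtype.ext (funext h))
    refine ⟨fun y : K => y.1 i, ⟨⟨fun y : K => y.1 i, (continuous_apply i).comp continuous_subtype_val⟩, (hA _).2 ?_, rfl⟩, hi⟩
    simp only [ContinuousMap.coe_mk, fy]
    have : (fun x : Eucl n => Real.sin ((x i - ai i) / L)) =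
        cosm (EuclideanSpace.single i (1/L)) (- ai i / L - Real.pi / 2) := by
      ext x
      simp only [cosm]
      rw [EuclideanSpace.inner_single_left]
      have : (starRingEnd ℝ) (1 / L) * x i + (-ai i / L - Real.pi / 2) =
        (x i - ai i) / L - Real.pi / 2 := by simp; ring
      rw [this, Real.cos_sub_pi_div_two]
    rw [this]; exact cosm_mem _ _
  obtain ⟨F, hF⟩ : ∃ F : K → Eucl n, F = fun y => WithLp.toLp 2 fun i => ai i + L * Real.arcsin (y.1 i) := ⟨_, rfl⟩
  have hFm : ∀ y i, |F y i - ai i| ≤ L * (Real.pi / 2) := by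
    intro y i
    simp only [hF, add_sub_cancel_left]
    rw [abs_mul, abs_of_pos hL]
    apply mll _ hL.le
    rw [abs_le]; exact ⟨Real.neg_pi_div_two_le_arcsin _, Real.arcsin_le_pi_div_two _⟩
  have hFc : Continuous F := by
    rw [hF]
    refine (PiLp.continuous_toLp 2 _).comp (continuous_pi fun i => ?_)
    exact continuous_const.add (continuous_const.mul (Real.continuous_arcsin.comp ((continuous_apply i).comp continuous_subtype_val)))
  obtain ⟨U, hU⟩ : ∃ U : C(K, ℝ), ∀ y, U y = u (F y) :=
    ⟨⟨fun y => u (F y), hu.comp_continuous hFc hFm⟩, fun y => rfl⟩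
  obtain ⟨g, hg⟩ := ContinuousMap.exists_mem_subalgebra_near_continuousMap_of_separatesPoints A hsep
    U ak bi
  have hg' : ∀ y : K, |g.1 y - u (F y)| ≤ ak := fun y => by
    have := (ContinuousMap.norm_coe_le_norm (g.1 - U) y).trans hg.le
    rw [ContinuousMap.sub_apply, Real.norm_eq_abs, hU] at this
    exact this
  refine ⟨fun x => g.1 (bf x), (hA _).1 g.2, fun x => ?_, fun x hx => ?_⟩
  · have ab := abs_le.1 (hg' (bf x))
    have af := abs_le.1 (ep (F (bf x)) (hFm _))
    rw [abs_le]; constructor <;> linarith [ab.1, ab.2, af.1, af.2]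
  · have : F (bf x) = x := by
      ext i
      simp only [hF, fy]
      have := abs_le.1 (hx i)
      rw [Real.arcsin_sin]
      · field_simp; ring
      · rw [le_div_iff₀ hL]; linarith
      · rw [div_le_iff₀ hL]; linarith
    have h := hg' (bf x)
    rwa [this] at h
structure bh {n : ℕ} (ao bd : SpaceTime n → ℝ) (g : SpaceTime n → Eucl n)
    (H : SpaceTime n → Eucl n →L[ℝ] Eucl n) : Prop where
  cu : Continuous ao
  ct : Continuous bd
  cg : Continuous g
  cH : Continuous H
  dt : ∀ p : SpaceTime n, HasDerivAt (fun s : ℝ => ao (p.1, s)) (bd p) p.2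
  dg : ∀ p : SpaceTime n, HasGradientAt (fun y => ao (y, p.2)) (g p) p.1
  dH : ∀ p : SpaceTime n, HasFDerivAt (fun y => g (y, p.2)) (H p) p.1
theorem bh.smul (h : bh ao bd g H) (c : ℝ) :
    bh (fun p => c * ao p) (fun p => c * bd p) (fun p => c • g p) (fun p => c • H p) where
  cu := continuous_const.mul h.cu
  ct := continuous_const.mul h.ct
  cg := h.cg.const_smul c
  cH := h.cH.const_smul c
  dt p := (h.dt p).const_mul c
  dg p := by
    have := h.dg p
    rw [hgf] at this ⊢
    rw [map_smul]
    exact this.const_mul c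
  dH p := (h.dH p).const_smul c
theorem bh.add {fv ke : SpaceTime n → ℝ} (h : bh ao bd g H) (h' : bh fv ke g' H') :
    bh (fun p => ao p + fv p) (fun p => bd p + ke p) (fun p => g p + g' p) (fun p => H p + H' p) where
  cu := h.cu.add h'.cu
  ct := h.ct.add h'.ct
  cg := h.cg.add h'.cg
  cH := h.cH.add h'.cH
  dt p := (h.dt p).add (h'.dt p)
  dg p := by
    have ab := h.dg p
    have af := h'.dg p
    rw [hgf] at ab af ⊢
    rw [map_add]
    exact ab.add af
  dH p := (h.dH p).add (h'.dH p)
def pd {n : ℕ} (i : Fin n) (k : Eucl n → ℝ) : Eucl n → ℝ :=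
  fun x => fderiv ℝ k x (EuclideanSpace.single i 1)
structure Ker {n : ℕ} (k : Eucl n → ℝ) : Prop where
  sm : ContDiff ℝ (⊤ : ℕ∞) k
  cs : HasCompactSupport k
theorem Ker.pd (hk : Ker k) (i : Fin n) : Ker (pd i k) where
  sm := (hk.sm.fderiv_right (m := ((⊤ : ℕ∞) : WithTop ℕ∞)) (by simp)).clm_apply contDiff_const
  cs := hk.cs.fderiv_apply ℝ _
theorem Ker.int {G : Eucl n → ℝ} (hk : Ker k) (hG : Continuous G) (x : Eucl n) :
    Integrable (fun y => k (x - y) * G y) := by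
  have hc : Continuous (fun y => k (x - y)) := hk.sm.continuous.comp FP
  refine (hc.mul hG).integrable_of_hasCompactSupport ?_
  refine HasCompactSupport.mul_right ?_
  exact hk.cs.comp_homeomorph (Homeomorph.subLeft x)
theorem Ker.parts (hk : Ker k) (ag x : Eucl n) (c : ℝ) (i : Fin n) :
    ∫ y, _root_.pd i k (x - y) * cosm ag c y = - ag i * ∫ y, k (x - y) * cosm ag (c - Real.pi / 2) y := by
  have ba : ∀ (k : Eucl n → ℝ) (c : ℝ), ∫ y, k (x - y) * cosm ag c y = ∫ y, k y * cosm ag c (x - y) := by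
    intro k c
    have := integral_sub_left_eq_self (fun y => k y * cosm ag c (x - y)) volume x
    rw [← this]; simp
  rw [ba, ba]
  have hd : ∀ y, HasFDerivAt (fun y => cosm ag c (x - y))
      (Real.sin (⟪ag, x - y⟫ + c) • innerSL ℝ ag) y := by
    intro y
    have ab : HasFDerivAt (fun y : Eucl n => ⟪ag, x - y⟫ + c) (-(innerSL ℝ ag)) y := by
      have := (((innerSL ℝ ag).hasFDerivAt (x := y)).const_sub (⟪ag, x⟫ + c))
      refine this.congr_of_eventuallyEq (Eventually.of_forall fun z => ?_)
      simp [inner_sub_right]; ring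
    have := ab.cos
    simpa [cosm] using this
  have dz := hk.sm.continuous
  have hcm : ∀ c, Continuous (fun y => cosm ag c (x - y)) := fun c => by unfold cosm; fun_prop
  have hfd : ∀ y, fderiv ℝ (fun y => cosm ag c (x - y)) y (EuclideanSpace.single i 1) =
      ag i * cosm ag (c - Real.pi / 2) (x - y) := by
    intro y
    rw [(hd y).fderiv]
    simp only [smul_apply, innerSL_apply_apply, EuclideanSpace.inner_single_right,
      smul_eq_mul, cosm]
    rw [← add_sub_assoc, Real.cos_sub_pi_div_two]; simp; ring
  have := integral_mul_fderiv_eq_neg_fderiv_mul_of_integrable (μ := volume) (f := k)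
    (g := fun y => cosm ag c (x - y)) (v := EuclideanSpace.single i (1:ℝ))
    (((hk.pd i).sm.continuous.mul (hcm c)).integrable_of_hasCompactSupport (hk.pd i).cs.mul_right)
    (by
      simp only [hfd]
      exact (dz.mul (continuous_const.mul (hcm _))).integrable_of_hasCompactSupport hk.cs.mul_right)
    ((dz.mul (hcm c)).integrable_of_hasCompactSupport hk.cs.mul_right)
    (fun y _ => hk.sm.differentiable (by simp) y) (fun y _ => (hd y).differentiableAt)
  simp only [hfd] at this
  have bb : ∫ y, k y * (ag i * cosm ag (c - Real.pi / 2) (x - y)) =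
      ag i * ∫ y, k y * cosm ag (c - Real.pi / 2) (x - y) := by
    rw [← integral_const_mul]; congr 1; ext y; ring
  rw [bb] at this
  simp only [_root_.pd]
  linarith
theorem Ker.mh (hk : Ker k) (ag x : Eucl n) (c : ℝ) (i j : Fin n) :
    ∫ y, _root_.pd j (_root_.pd i k) (x - y) * cosm ag c y =
      - (ag i * ag j) * ∫ y, k (x - y) * cosm ag c y := by
  rw [(hk.pd i).parts, hk.parts]
  have : cosm ag (c - Real.pi / 2 - Real.pi / 2) = fun y => - cosm ag c y := by
    ext y; simp only [cosm]
    have : ⟪ag, y⟫ + (c - Real.pi / 2 - Real.pi / 2) = ⟪ag, y⟫ + c - Real.pi := by ring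
    rw [this, Real.cos_sub_pi]
  rw [this]
  simp only [mul_neg, integral_neg]; ring
structure Evo {n : ℕ} (lam : ℝ) (Q : ℝ → Matrix (Fin n) (Fin n) ℝ) (ad : ℝ) (g : Eucl n → ℝ)
    (G Gt : SpaceTime n → ℝ) (gG : SpaceTime n → Eucl n)
    (HG : SpaceTime n → Eucl n →L[ℝ] Eucl n) : Prop where
  ek : bh G Gt gG HG
  pde : ∀ p, lam * Gt p = op (Q p.2) (HG p)
  init : ∀ x, G (x, ad) = g x
  bdd : ∃ B, ∀ x s, ad ≤ s → |G (x, s)| ≤ B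
  id : ∀ k, Ker k → ∀ x s, HasDerivAt (fun s => ∫ y, k (x - y) * G (y, s))
    (lam⁻¹ * ∑ i, ∑ j, Q s i j * ∫ y, pd j (pd i k) (x - y) * G (y, s)) s
theorem op_rank1 (Q : Matrix (Fin n) (Fin n) ℝ) (ag : Eucl n) :
    op Q ((innerSL ℝ ag).smulRight ag) = qf Q ag := by
  simp only [op, qf]
  refine Finset.sum_congr rfl fun i _ => Finset.sum_congr rfl fun j _ => ?_
  simp only [ContinuousLinearMap.smulRight_apply, innerSL_apply_apply, EuclideanSpace.inner_single_right, PiLp.smul_apply, smul_eq_mul]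
  simp only [one_mul, conj_trivial]
  ring
theorem evo_mode (hlam : 0 < lam)
    (hQc : ∀ i j, Continuous fun t => Q t i j) (gv : ∀ t (x : Eucl n), 0 ≤ qf (Q t) x)
    (ad : ℝ) (ag : Eucl n) (c : ℝ) : ∃ G Gt gG HG, Evo lam Q ad (cosm ag c) G Gt gG HG := by
  set q : ℝ → ℝ := fun s => qf (Q s) ag with hq
  have hqc : Continuous q := by simp only [hq, qf]; fun_prop
  set μ : ℝ → ℝ := fun s => lam⁻¹ * ∫ r in ad..s, q r with kf
  have kg : ∀ s, HasDerivAt μ (lam⁻¹ * q s) s := fun s =>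
    (intervalIntegral.integral_hasDerivAt_right (hqc.intervalIntegrable _ _)
      (hqc.stronglyMeasurableAtFilter _ _) hqc.continuousAt).const_mul _
  have pe : Continuous μ := continuous_iff_continuousAt.2 fun s => (kg s).continuousAt
  set E : ℝ → ℝ := fun s => Real.exp (-μ s) with hE
  have hEc : Continuous E := by simp only [hE]; fun_prop
  have hEd : ∀ s, HasDerivAt E (-(lam⁻¹ * q s) * E s) s := fun s => by
    have := (kg s).neg.exp
    exact this.congr_deriv (by simp only [hE, Pi.neg_apply]; ring)
  have mi : E ad = 1 := by simp [hE, kf]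
  have mj : ∀ s, ad ≤ s → E s ≤ 1 := by
    intro s hs
    simp only [hE, kf, Real.exp_le_one_iff, neg_nonpos]
    exact mul_nonneg PS (intervalIntegral.integral_nonneg hs fun r _ => gv r ag)
  have hcd : ∀ y : Eucl n, HasFDerivAt (fun y : Eucl n => ⟪ag, y⟫ + c) (innerSL ℝ ag) y := fun y =>
    ((innerSL ℝ ag).hasFDerivAt (x := y)).add_const c
  have hcm : Continuous (cosm ag c) := by unfold cosm; fun_prop
  refine ⟨fun p => E p.2 * cosm ag c p.1, fun p => -(lam⁻¹ * q p.2) * E p.2 * cosm ag c p.1,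
    fun p => (-(E p.2 * Real.sin (⟪ag, p.1⟫ + c))) • ag,
    fun p => (-(E p.2 * cosm ag c p.1)) • (innerSL ℝ ag).smulRight ag, ⟨?_, ?_, ?_, ?_, ?_, ?_, ?_⟩,
    ?_, ?_, ?_, ?_⟩
  · fun_prop
  · fun_prop
  · fun_prop
  · exact (by fun_prop : Continuous fun p : SpaceTime n => -(E p.2 * cosm ag c p.1)).smul continuous_const
  · intro p; exact (hEd p.2).mul_const (cosm ag c p.1)
  · intro p
    rw [hgf]
    have := (hcd p.1).cos.const_mul (E p.2)
    refine this.congr_fderiv ?_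
    ext v; simp; ring
  · intro p
    have := (((hcd p.1).sin.const_mul (E p.2)).neg).smul_const ag
    refine this.congr_fderiv ?_
    ext v; simp [cosm]; ring
  · intro p
    rw [op_smul, op_rank1]
    simp only [hq]; field_simp
  · intro x; simp [mi]
  · refine ⟨1, fun x s hs => ?_⟩
    rw [abs_mul, abs_of_pos (Real.exp_pos _)]
    exact mul_le_one₀ (mj s hs) (abs_nonneg _) (Real.abs_cos_le_one _)
  · intro k hk x s
    have e : ∀ (k : Eucl n → ℝ) (s : ℝ), ∫ y, k (x - y) * (E s * cosm ag c y) =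
        E s * ∫ y, k (x - y) * cosm ag c y := by
      intro k s; rw [← integral_const_mul]; congr 1; ext y; ring
    simp only [e, hk.mh]
    refine ((hEd s).mul_const _).congr_deriv ?_
    simp only [hq, qf]
    simp only [Finset.mul_sum, Finset.sum_mul, neg_mul, mul_neg, ← Finset.sum_neg_distrib]
    exact Finset.sum_congr rfl fun i _ => Finset.sum_congr rfl fun j _ => by ring
theorem evo_exists (hlam : 0 < lam)
    (hQc : ∀ i j, Continuous fun t => Q t i j) (gv : ∀ t (x : Eucl n), 0 ≤ qf (Q t) x)
    (ad : ℝ) {g : Eucl n → ℝ} (hg : g ∈ TS n) : ∃ G Gt gG HG, Evo lam Q ad g G Gt gG HG := by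
  refine Submodule.span_induction (p := fun g _ => ∃ G Gt gG HG, Evo lam Q ad g G Gt gG HG)
    ?_ ?_ ?_ ?_ hg
  · rintro _ ⟨ag, c, rfl⟩; exact evo_mode hlam hQc gv ad ag c
  · obtain ⟨G, Gt, gG, HG, h⟩ := evo_mode hlam hQc gv ad 0 0
    refine ⟨_, _, _, _, h.ek.smul 0, fun p => ?_, fun x => by simp, ⟨0, by simp⟩, fun k hk x s => ?_⟩
    · rw [op_smul]; ring
    · simpa using hasDerivAt_const s (0:ℝ)
  · rintro f g _ _ ⟨G, Gt, gG, HG, h⟩ ⟨G', Gt', gG', HG', h'⟩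
    refine ⟨_, _, _, _, h.ek.add h'.ek, fun p => ?_, fun x => by simp [h.init, h'.init], ?_,
      fun k hk x s => ?_⟩
    · rw [op_add, mul_add, h.pde, h'.pde]
    · obtain ⟨B, hB⟩ := h.bdd
      obtain ⟨B', hB'⟩ := h'.bdd
      exact ⟨B + B', fun x s hs => (abs_add_le _ _).trans (add_le_add (hB x s hs) (hB' x s hs))⟩
    · have e : ∀ (k : Eucl n → ℝ) (s : ℝ), Ker k → ∫ y, k (x - y) * (G (y, s) + G' (y, s)) =
          (∫ y, k (x - y) * G (y, s)) + ∫ y, k (x - y) * G' (y, s) := by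
        intro k s hk
        rw [← integral_add (hk.int (G := fun y => G (y, s)) (h.ek.cu.comp (by fun_prop : Continuous fun y : Eucl n => (y, s))) x)
          (hk.int (G := fun y => G' (y, s)) (h'.ek.cu.comp (by fun_prop : Continuous fun y : Eucl n => (y, s))) x)]
        congr 1; ext y; ring
      have ba : (fun s => ∫ y, k (x - y) * (G (y, s) + G' (y, s))) = fun s =>
        (∫ y, k (x - y) * G (y, s)) + ∫ y, k (x - y) * G' (y, s) := funext fun s => e k s hk
      rw [ba]
      refine ((h.id k hk x s).add (h'.id k hk x s)).congr_deriv ?_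
      rw [← mul_add, ← Finset.sum_add_distrib]
      congr 1
      refine Finset.sum_congr rfl fun i _ => ?_
      rw [← Finset.sum_add_distrib]
      refine Finset.sum_congr rfl fun j _ => ?_
      rw [e _ s ((hk.pd i).pd j)]; ring
  · rintro r f _ ⟨G, Gt, gG, HG, h⟩
    refine ⟨_, _, _, _, h.ek.smul r, fun p => ?_, fun x => by simp [h.init], ?_,
      fun k hk x s => ?_⟩
    · rw [op_smul, ← h.pde]; ring
    · obtain ⟨B, hB⟩ := h.bdd
      refine ⟨|r| * B, fun x s hs => ?_⟩
      rw [abs_mul]; exact mll (hB x s hs) (abs_nonneg _)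
    · have e : ∀ (k : Eucl n → ℝ) (s : ℝ), ∫ y, k (x - y) * (r * G (y, s)) =
          r * ∫ y, k (x - y) * G (y, s) := by
        intro k s; rw [← integral_const_mul]; congr 1; ext y; ring
      simp only [e]
      refine ((h.id k hk x s).const_mul r).congr_deriv ?_
      simp only [Finset.mul_sum]
      exact Finset.sum_congr rfl fun i _ => Finset.sum_congr rfl fun j _ => by ring
theorem bh.ev (h : bh ao bd g H) :
    IC 0 (fun _ => 0) {p : SpaceTime n | p.2 ≤ 0} ao bd g H where
  cu := h.cu.continuousOn
  ct := h.ct.continuousOn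
  cg := h.cg.continuousOn
  cH := h.cH.continuousOn
  dt p _ := (h.dt p).hasDerivWithinAt
  dg p _ := h.dg p
  dH p _ := h.dH p
  pde p _ := by simp [op]
theorem POp_past : POp {p : SpaceTime n | p.2 ≤ 0} := fun p hp =>
  ⟨hp, 1, one_pos, fun q _ _ h => h.trans hp⟩
theorem bh.sd (h : bh ao bd g H) (hp : p.2 ≤ 0) (ag : Eucl n) :
    SD (fun s : ℝ => ao (p.1 + s • ag, p.2)) ⟪H p ag, ag⟫ := h.ev.sd POp_past hp ag
theorem bh.const (n : ℕ) (c : ℝ) : bh (n := n) (fun _ => c) (fun _ => 0) (fun _ => 0) (fun _ => 0) where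
  cu := continuous_const
  ct := continuous_const
  cg := continuous_const
  cH := continuous_const
  dt p := hasDerivAt_const _ _
  dg p := hasGradientAt_const _ _
  dH p := hasFDerivAt_const _ _
theorem hasGradientAt_normsq (c x : Eucl n) :
    HasGradientAt (fun y : Eucl n => ‖y - c‖ ^ 2) ((2:ℝ) • (x - c)) x := by
  rw [hgf]
  have := ((hasFDerivAt_id (𝕜 := ℝ) x).sub_const c).norm_sq
  refine this.congr_fderiv ?_
  ext v; simp [inner_smul_left]
theorem bh.poly (c : Eucl n) (C ad : ℝ) : bh (fun p : SpaceTime n => ‖p.1 - c‖ ^ 2 + C * (p.2 - ad))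
    (fun _ => C) (fun p => (2:ℝ) • (p.1 - c)) (fun _ => (2:ℝ) • ContinuousLinearMap.id ℝ (Eucl n)) where
  cu := FP
  ct := continuous_const
  cg := FP
  cH := continuous_const
  dt p := by
    have := ((((hasDerivAt_id p.2).sub_const ad).const_mul C).const_add (‖p.1 - c‖ ^ 2))
    simpa using this
  dg p := by
    have := hasGradientAt_normsq c p.1
    rw [hgf] at this ⊢
    exact this.add_const (C * (p.2 - ad))
  dH p := ((hasFDerivAt_id (𝕜 := ℝ) p.1).sub_const c).const_smul (2:ℝ)
theorem bh.lin (b : Eucl n) : bh (fun p : SpaceTime n => ⟪b, p.1⟫)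
    (fun _ => 0) (fun _ => b) (fun _ => 0) where
  cu := FP
  ct := continuous_const
  cg := FP
  cH := continuous_const
  dt p := hasDerivAt_const p.2 ⟪b, p.1⟫
  dg p := by
    rw [hgf]
    refine ((innerSL ℝ b).hasFDerivAt (x := p.1)).congr_fderiv ?_
    ext v; simp
  dH p := hasFDerivAt_const _ _
theorem bh.sq (h : bh ao bd g H) : bh (fun p => ao p ^ 2) (fun p => 2 * ao p * bd p)
    (fun p => (2 * ao p) • g p)
    (fun p => (2 * ao p) • H p + (2:ℝ) • (innerSL ℝ (g p)).smulRight (g p)) where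
  cu := h.cu.pow 2
  ct := by have := h.cu; have := h.ct; fun_prop
  cg := by have := h.cu; have := h.cg; fun_prop
  cH := by
    have ab := h.cu; have af := h.cg; have aj := h.cH
    have aw : Continuous fun p => (innerSL ℝ (g p)).smulRight (g p) := by
      have : Continuous fun p => ((ContinuousLinearMap.smulRightL ℝ (Eucl n) (Eucl n)) (innerSL ℝ (g p))) (g p) := by
        have bx : Continuous fun p => innerSL ℝ (g p) := (innerSL ℝ).continuous.comp af
        have dn : Continuous fun p => (ContinuousLinearMap.smulRightL ℝ (Eucl n) (Eucl n)) (innerSL ℝ (g p)) :=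
          (ContinuousLinearMap.continuous _).comp bx
        exact dn.clm_apply af
      exact this
    exact ((continuous_const.mul ab).smul aj).add (aw.const_smul (2:ℝ))
  dt p := by
    exact ((h.dt p).pow 2).congr_deriv (by simp)
  dg p := by
    have := h.dg p
    rw [hgf] at this ⊢
    refine (this.pow 2).congr_fderiv ?_
    ext v; simp [inner_smul_left]
  dH p := by
    have ab := h.dg p
    rw [hgf] at ab
    refine ((ab.const_mul 2).smul (h.dH p)).congr_fderiv ?_
    ext v; simp [mul_assoc]
theorem Ell.op_id {Q : Matrix (Fin n) (Fin n) ℝ} (h : Ell a b Q) :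
    op Q (ContinuousLinearMap.id ℝ (Eucl n)) ≤ n * b := by
  have : op Q (ContinuousLinearMap.id ℝ (Eucl n)) = ∑ i, Q i i := by
    simp only [op, ContinuousLinearMap.id_apply]
    refine Finset.sum_congr rfl fun i _ => ?_
    rw [Finset.sum_eq_single i]
    · simp
    · intro j _ hj; simp [hj.symm]
    · simp
  rw [this]
  calc ∑ i, Q i i ≤ ∑ i : Fin n, b := Finset.sum_le_sum fun i _ => h.diag_le i
    _ = n * b := by simp
def IVs {n : ℕ} (lam : ℝ) (Q : ℝ → Matrix (Fin n) (Fin n) ℝ) (u : SpaceTime n → ℝ)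
    (D : Set (SpaceTime n)) : Prop :=
  ∀ ao bd g H, bh ao bd g H → ∀ p ∈ D, ∀ aa > 0, (∀ q : SpaceTime n, ‖q.1 - p.1‖ < aa → p.2 - aa < q.2 →
    q.2 ≤ p.2 → u q - u p ≤ ao q - ao p) → lam * bd p ≤ op (Q p.2) (H p)
theorem IC.ivs (hlam : 0 < lam) (ha : 0 ≤ a) (hQ : ∀ p ∈ D, Ell a b (Q p.2))
    (h : IC lam Q D u ut g H) (hD : POp D) : IVs lam Q u D := by
  intro ao bd pf ml bj p hp aa ar hm
  have ht := (hD p hp).1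
  have ab : bd p ≤ ut p := by
    refine left_deriv_le (h.dt p hp) ht (bj.dt p) ?_
    filter_upwards [Ioo_mem_nhdsLT (by linarith : p.2 - aa < p.2)] with s hs
    exact hm (p.1, s) (by simpa using ar) hs.1 hs.2.le
  obtain ⟨m, fm, -, -⟩ := (hQ p hp).vecs ha
  have af : op (Q p.2) (H p) ≤ op (Q p.2) (ml p) := by
    rw [fm, fm]
    refine Finset.sum_le_sum fun k _ => ?_
    refine SD.le_of_eventually (h.sd hD hp (m k)) (bj.sd ht (m k)) ?_
    have : Tendsto (fun s : ℝ => ‖s • m k‖) (𝓝 0) (𝓝 0) := by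
      have : Continuous (fun s : ℝ => ‖s • m k‖) := FP
      simpa using this.tendsto 0
    filter_upwards [this.eventually (gt_mem_nhds ar)] with s hs
    have := hm (p.1 + s • m k, p.2) (by simpa using hs) (by simpa using ar) le_rfl
    simpa using this
  have aj := h.pde p hp
  nlinarith
theorem cmp_gen
    (hu : IVs lam Q u (ball c R ×ˢ Ioc ad am)) (huc : ContinuousOn u (closedBall c R ×ˢ Icc ad am))
    (bj : bh ao bd g H)
    (hs : ∀ p : SpaceTime n, ‖p.1 - c‖ < R → ad < p.2 → p.2 ≤ am → op (Q p.2) (H p) < lam * bd p)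
    (hb : ∀ p : SpaceTime n, ‖p.1 - c‖ = R → p.2 ∈ Icc ad am → u p ≤ ao p)
    (hi : ∀ x : Eucl n, ‖x - c‖ ≤ R → u (x, ad) ≤ ao (x, ad)) :
    ∀ p ∈ closedBall c R ×ˢ Icc ad am, u p ≤ ao p := by
  intro ap er
  by_contra hlt
  push Not at hlt
  obtain ⟨p, hp, hmax⟩ := ((isCompact_closedBall c R).prod isCompact_Icc).exists_isMaxOn ⟨ap, er⟩
    (huc.sub bj.cu.continuousOn)
  have hpos : 0 < u p - ao p := by
    have : u ap - ao ap ≤ u p - ao p := hmax er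
    linarith
  obtain ⟨fz, ga⟩ := hp
  rw [mem_closedBall, dist_eq_norm] at fz
  have ab : ‖p.1 - c‖ < R := lt_of_le_of_ne fz fun h => by linarith [hb p h ga]
  have af : ad < p.2 := lt_of_le_of_ne ga.1 fun h => by
    have := hi p.1 fz
    rw [h] at this
    linarith
  have aj := hu ao bd g H bj p ⟨by simpa [dist_eq_norm] using ab, af, ga.2⟩
    (min (R - ‖p.1 - c‖) (p.2 - ad)) (lt_min LN LN) (fun q gw pg mm => by
      have aw : q ∈ closedBall c R ×ˢ Icc ad am := by
        refine ⟨?_, ?_, mm.trans ga.2⟩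
        · rw [mem_closedBall, dist_eq_norm]
          have : q.1 - c = (q.1 - p.1) + (p.1 - c) := by abel
          rw [this]
          have := norm_add_le (q.1 - p.1) (p.1 - c)
          have := gw.trans_le (min_le_left _ _)
          linarith
        · have := min_le_right (R - ‖p.1 - c‖) (p.2 - ad)
          linarith
      have : u q - ao q ≤ u p - ao p := hmax aw
      linarith)
  linarith [hs p ab af ga.2]
theorem G_le (hlam : 0 < lam) (ha : 0 ≤ a)
    (hb : 0 < b) (hQ : ∀ t, Ell a b (Q t)) (h : bh G Gt gG HG)
    (hpde : ∀ p, lam * Gt p = op (Q p.2) (HG p)) {B m : ℝ}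
    (hB : ∀ x s, ad ≤ s → G (x, s) ≤ B) (hm : ∀ x, G (x, ad) ≤ m) (hs : ad ≤ s)
    (ca : s ≤ 0) : G (x, s) ≤ m := by
  have hiv : IVs lam Q G {p : SpaceTime n | p.2 ≤ 0} := by
    exact IC.ivs (ut := Gt) (g := gG) (H := HG) hlam ha (fun p _ => hQ p.2) (by
      exact ⟨h.ev.cu, h.ev.ct, h.ev.cg, h.ev.cH, h.ev.dt, h.ev.dg, h.ev.dH, fun p _ => hpde p⟩) POp_past
  set C : ℝ := (2 * n * b + 1) / lam with hC
  have fh : 0 < C := PS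
  have key : ∀ ak > 0, G (x, s) ≤ m + ak * (C * (s - ad)) := by
    intro ak bi
    set R : ℝ := Real.sqrt ((|B| + |m|) / ak) with hR
    have ph : ak * R ^ 2 = |B| + |m| := by
      rw [hR, Real.sq_sqrt PS]; field_simp
    have bj := ((bh.poly x C ad).smul ak).add (bh.const n m)
    have := cmp_gen (ad := ad) (am := 0) (c := x) (R := R)
      (u := G) (lam := lam) (Q := Q) (fun ao bd g H bj p hp => hiv ao bd g H bj p hp.2.2) h.cu.continuousOn bj
      ?_ ?_ ?_ (x, s) ⟨by simp [hR], hs, ca⟩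
    · simp at this; linarith
    · intro p _ _ _
      simp only [add_zero]
      rw [op_smul, op_smul]
      have ab := (hQ p.2).op_id
      have af : lam * (ak * C) = ak * (2 * n * b + 1) := by rw [hC]; field_simp
      rw [af]
      have : 2 * op (Q p.2) (ContinuousLinearMap.id ℝ (Eucl n)) < 2 * n * b + 1 := LN
      exact mul_lt_mul_of_pos_left this bi
    · intro p hp ht
      have ab := hB p.1 p.2 ht.1
      have aj : 0 ≤ ak * (C * (p.2 - ad)) := mul_nonneg bi.le (mul_nonneg fh.le (by linarith [ht.1]))
      simp only [hp]
      have := le_abs_self B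
      have := neg_abs_le m
      have : G p ≤ B := ab
      linarith
    · intro y _
      have := hm y
      simp only [sub_self, mul_zero, add_zero]
      have : 0 ≤ ak * ‖y - x‖ ^ 2 := PS
      linarith
  refine le_of_forall_pos_le_add fun ak bi => ?_
  have := key (ak / (C * (s - ad) + 1)) (by have := mul_nonneg fh.le (by linarith : 0 ≤ s - ad); positivity)
  refine this.trans ?_
  have bg := mul_nonneg fh.le (by linarith : 0 ≤ s - ad)
  gcongr
  rw [div_mul_eq_mul_div, div_le_iff₀ PS]
  linarith
theorem cmp_G (hlam : 0 < lam)
    (hb : 0 < b) (hQ : ∀ t, Ell a b (Q t)) (h : bh G Gt gG HG)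
    (hpde : ∀ p, lam * Gt p = op (Q p.2) (HG p)) (ar : 0 < aa) (cq : 0 < aq)
    (hu : IVs lam Q u (ball x aa ×ˢ Ioc ad 0)) (huc : ContinuousOn u (closedBall x aa ×ˢ Icc ad 0))
    (ep : ∀ p ∈ closedBall x aa ×ˢ Icc ad 0, |u p| ≤ 1) (hG : ∀ y s, ad ≤ s → s ≤ 0 → -2 ≤ G (y, s))
    (hi : ∀ y ∈ closedBall x aa, u (y, ad) ≤ G (y, ad) + aq) (hs : ad ≤ s) (ca : s ≤ 0) :
    u (x, s) ≤ G (x, s) + aq + 4 * ((2 * n + 4) * b / lam) ^ 2 / aa ^ 4 * (s - ad) ^ 2 := by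
  set C : ℝ := (2 * n + 4) * b / lam with hC
  have fh : 0 < C := PS
  have key : ∀ ak > 0, u (x, s) ≤ G (x, s) + aq + 4 * C ^ 2 / aa ^ 4 * (s - ad) ^ 2 + ak * (1 * (s - ad)) := by
    intro ak bi
    have hlin : bh (fun p : SpaceTime n => ak * (p.2 - ad)) (fun _ => ak) (fun _ => 0) (fun _ => 0) :=
      { cu := FP
        ct := continuous_const
        cg := continuous_const
        cH := continuous_const
        dt := fun p => by simpa using ((hasDerivAt_id p.2).sub_const ad).const_mul ak
        dg := fun p => hasGradientAt_const p.1 (ak * (p.2 - ad))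
        dH := fun p => hasFDerivAt_const _ _ }
    have bj := ((h.add (bh.const n aq)).add ((bh.poly x C ad).sq.smul (4 / aa ^ 4))).add hlin
    have := cmp_gen (ad := ad) (am := 0) (c := x) (R := aa) hu huc bj ?_ ?_ ?_ (x, s) ⟨by simp [ar.le], hs, ca⟩
    · refine this.trans (le_of_eq ?_)
      simp; ring
    · intro p _ ht _
      simp only [add_zero]
      rw [op_add, op_smul, op_add, op_smul, op_smul, op_smul, op_rank1, ← hpde]
      have ab := (hQ p.2).op_id
      have af := (hQ p.2).up ((2:ℝ) • (p.1 - x))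
      rw [norm_smul, mul_pow] at af
      norm_num at af
      set I := op (Q p.2) (ContinuousLinearMap.id ℝ (Eucl n))
      set q := qf (Q p.2) (((2:ℝ) • (p.1 - x) : Eucl n) : Fin n → ℝ)
      set bf := ‖p.1 - x‖ ^ 2 + C * (p.2 - ad) with fy
      have hT : 0 ≤ C * (p.2 - ad) := mul_nonneg fh.le LN
      have mn : 0 ≤ bf := PS
      have aj : lam * C = (2 * n + 4) * b := by rw [hC]; field_simp
      have jx : q ≤ b * (4 * ‖p.1 - x‖ ^ 2) := by simpa [q] using af
      have aw : 2 * bf * (2 * I) + 2 * q ≤ 2 * bf * ((2 * n + 4) * b) := by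
        have : bf * I ≤ bf * (n * b) := mll ab mn
        have : b * ‖p.1 - x‖ ^ 2 ≤ b * bf := mll LN hb.le
        linarith
      have bx : lam * (4 / aa ^ 4 * (2 * bf * C)) = 4 / aa ^ 4 * (2 * bf * ((2 * n + 4) * b)) := by
        rw [← aj]; ring
      have dn : 4 / aa ^ 4 * (2 * bf * (2 * I) + 2 * q) ≤ 4 / aa ^ 4 * (2 * bf * ((2 * n + 4) * b)) := by gcongr
      have gu : 0 < lam * ak := PS
      have iu : lam * (Gt p + 4 / aa ^ 4 * (2 * bf * C) + ak) = lam * Gt p + lam * (4 / aa ^ 4 * (2 * bf * C)) + lam * ak := by ring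
      rw [iu]
      linarith
    · intro p hp ht
      have ab := (abs_le.1 (ep p ⟨by rw [mem_closedBall, dist_eq_norm]; exact hp.le, ht⟩)).2
      have af : -2 ≤ G p := hG p.1 p.2 ht.1 ht.2
      have aj : 0 ≤ ak * (p.2 - ad) := mul_nonneg bi.le (by linarith [ht.1])
      have hT : 0 ≤ C * (p.2 - ad) := mul_nonneg fh.le (by linarith [ht.1])
      have aw : 4 ≤ 4 / aa ^ 4 * (‖p.1 - x‖ ^ 2 + C * (p.2 - ad)) ^ 2 := by
        rw [hp, div_mul_eq_mul_div, le_div_iff₀ PS]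
        have : (aa ^ 2) ^ 2 ≤ (aa ^ 2 + C * (p.2 - ad)) ^ 2 := by gcongr; linarith
        linarith
      linarith
    · intro y hy
      have ab := hi y (by rw [mem_closedBall, dist_eq_norm]; exact hy)
      have : 0 ≤ 4 / aa ^ 4 * (‖y - x‖ ^ 2 + C * (ad - ad)) ^ 2 := PS
      simp only [sub_self, mul_zero, add_zero] at this ⊢
      linarith
  refine le_of_forall_pos_le_add fun ak bi => ?_
  have bg : 0 ≤ s - ad := LN
  have := key (ak / ((s - ad) + 1)) PS
  refine this.trans ?_
  gcongr
  rw [div_mul_eq_mul_div, div_le_iff₀ PS]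
  linarith
theorem norm_le_coord (hr : 0 ≤ r) (h : ∀ i, |x i| ≤ r) : ‖x‖ ≤ n * r := by
  have ab : ‖x‖ ^ 2 ≤ n * r ^ 2 := by
    rw [normsq_sum]
    calc ∑ i, x i * x i ≤ ∑ _i : Fin n, r ^ 2 := Finset.sum_le_sum fun i _ => by
          have := sq_le_sq' (neg_le_of_abs_le (h i)) (le_of_abs_le (h i)); linarith
      _ = n * r ^ 2 := by simp
  refine le_of_sq_le_sq (ab.trans ?_) PS
  rw [mul_pow]
  gcongr
  rcases Nat.eq_zero_or_pos n with bg | bg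
  · simp [bg]
  · have : (1:ℝ) ≤ n := by exact_mod_cast bg
    nlinarith
theorem approx (hn : 1 ≤ n) (hlam : 0 < lam)
    (ha : 0 ≤ a) (hb : 0 < b) (hQ : ∀ t, Ell a b (Q t)) (hQc : ∀ i j, Continuous fun t => Q t i j) (hu : Continuous u) (hr : 0 < r)
    (ep : ∀ p ∈ closedBall ai (n * r) ×ˢ Icc am 0, |u p| ≤ 1)
    (hs : IVs lam Q u (ball ai (n * r) ×ˢ Ioc am 0))
    (hs' : IVs lam Q (fun p => - u p) (ball ai (n * r) ×ˢ Ioc am 0)) (ht : t ∈ Icc am 0)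
    (cq : 0 < aq) (iv : aq ≤ 1) :
    ∃ g G Gt gG HG, Evo lam Q t g G Gt gG HG ∧ ∀ x ∈ closedBall ai (r / 2), ∀ s ∈ Icc t 0,
      |u (x, s) - G (x, s)| ≤ aq + 4 * ((2 * n + 4) * b / lam) ^ 2 / (r / 2) ^ 4 * (s - t) ^ 2 := by
  have hn' : (1:ℝ) ≤ n := by exact_mod_cast hn
  set L := r / (Real.pi / 2) with hL
  have hpi : 0 < Real.pi / 2 := PS
  have hLr : L * (Real.pi / 2) = r := by rw [hL]; field_simp
  have hcube : ∀ x : Eucl n, (∀ i, |x i - ai i| ≤ L * (Real.pi / 2)) → x ∈ closedBall ai (n * r) := by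
    intro x hx
    simp only [hLr] at hx
    rw [mem_closedBall, dist_eq_norm]
    exact norm_le_coord hr.le hx
  obtain ⟨g, hg, kh, hgu⟩ := tri_approx (u := fun x => u (x, t)) (ai := ai) (L := L) PS cq iv
    FP (fun x hx => ep (x, t) ⟨hcube x hx, ht⟩)
  obtain ⟨G, Gt, gG, HG, hE⟩ := evo_exists hlam hQc (fun t x => (by positivity : 0 ≤ a * ‖x‖ ^ 2).trans ((hQ t).lo x)) t hg
  refine ⟨g, G, Gt, gG, HG, hE, ?_⟩
  obtain ⟨B, hB⟩ := hE.bdd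
  have hN := hE.ek.smul (-1)
  have hNp : ∀ p, lam * (-1 * Gt p) = op (Q p.2) ((-1:ℝ) • HG p) := fun p => by
    rw [op_smul, ← hE.pde]; ring
  have mo : ∀ y s, t ≤ s → s ≤ 0 → G (y, s) ≤ 2 := fun y s ab af =>
    G_le hlam ha hb hQ hE.ek hE.pde (fun x s hs => (abs_le.1 (hB x s hs)).2)
      (fun x => by rw [hE.init]; exact (abs_le.1 (kh x)).2) ab af
  have ka : ∀ y s, t ≤ s → s ≤ 0 → -1 * G (y, s) ≤ 2 := fun y s ab af =>
    G_le (B := B) hlam ha hb hQ hN hNp (fun x s hs => by linarith [(abs_le.1 (hB x s hs)).1])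
      (fun x => by rw [hE.init]; linarith [(abs_le.1 (kh x)).1]) ab af
  intro x hx s bz
  rw [mem_closedBall, dist_eq_norm] at hx
  have hin : ∀ y ∈ closedBall x (r / 2), ‖y - ai‖ ≤ r := by
    intro y hy
    rw [mem_closedBall, dist_eq_norm] at hy
    have : y - ai = (y - x) + (x - ai) := by abel
    rw [this]; exact (norm_add_le _ _).trans LN
  have hrn : r ≤ n * r := by nlinarith
  have ki : ball x (r / 2) ×ˢ Ioc t 0 ⊆ ball ai (n * r) ×ˢ Ioc am 0 := by
    rintro p ⟨ab, af⟩
    refine ⟨?_, lt_of_le_of_lt ht.1 af.1, af.2⟩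
    rw [mem_ball, dist_eq_norm] at ab ⊢
    have : p.1 - ai = (p.1 - x) + (x - ai) := by abel
    rw [this]; exact (norm_add_le _ _).trans_lt LN
  have kj : closedBall x (r / 2) ×ˢ Icc t 0 ⊆ closedBall ai (n * r) ×ˢ Icc am 0 := by
    rintro p ⟨ab, af⟩
    refine ⟨?_, ht.1.trans af.1, af.2⟩
    rw [mem_closedBall, dist_eq_norm]
    exact (hin p.1 ab).trans hrn
  have hgu' : ∀ y ∈ closedBall x (r / 2), |g y - u (y, t)| ≤ aq := fun y hy => hgu y fun i => by
    rw [hLr]; exact (coord_le (y - ai) i).trans (hin y hy)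
  have ax := cmp_G hlam hb hQ hE.ek hE.pde (aa := r / 2) (x := x) PS cq
    (fun ao bd g H bj p hp => hs ao bd g H bj p (ki hp)) hu.continuousOn (fun p hp => ep p (kj hp))
    (fun y s ab af => by linarith [ka y s ab af])
    (fun y hy => by rw [hE.init]; linarith [(abs_le.1 (hgu' y hy)).1]) bz.1 bz.2
  have pk := cmp_G hlam hb hQ hN hNp (aa := r / 2) (x := x) PS cq
    (fun ao bd g H bj p hp => hs' ao bd g H bj p (ki hp)) hu.neg.continuousOn (fun p hp => by
      simpa using ep p (kj hp))
    (fun y s ab af => by linarith [mo y s ab af])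
    (fun y hy => by rw [hE.init]; linarith [(abs_le.1 (hgu' y hy)).2]) bz.1 bz.2
  rw [abs_le]
  constructor <;> linarith
def Wm {n : ℕ} (u : SpaceTime n → ℝ) (k : Eucl n → ℝ) (p : SpaceTime n) : ℝ :=
  ∫ y, k (p.1 - y) * u (y, p.2)
theorem Wm_swap (u : SpaceTime n → ℝ) (k : Eucl n → ℝ) (p : SpaceTime n) :
    Wm u k p = ∫ y, k y * u (p.1 - y, p.2) := by
  have := integral_sub_left_eq_self (fun y => k y * u (p.1 - y, p.2)) volume p.1
  rw [← this, Wm]; simp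
theorem Wm_cont (hu : Continuous u) (hk : Ker k) :
    Continuous (Wm u k) := by
  have e : Wm u k = fun p => ∫ y, k y * u (p.1 - y, p.2) := funext fun p => Wm_swap u k p
  rw [e, ← continuousOn_univ]
  have dz := hk.sm.continuous
  refine continuousOn_integral_of_compact_support (f := fun (p : SpaceTime n) y => k y * u (p.1 - y, p.2))
    hk.cs (by simp only [Function.uncurry_def]; fun_prop) ?_
  intro p x _ hx
  rw [image_eq_zero_of_notMem_tsupport hx, zero_mul]
theorem Wm_fd (hu : Continuous u) (hk : Ker k)
    (p : SpaceTime n) : ∃ A : Eucl n →L[ℝ] ℝ, HasFDerivAt (fun y => Wm u k (y, p.2)) A p.1 ∧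
      ∀ i, A (EuclideanSpace.single i 1) = Wm u (pd i k) p := by
  have hc : Continuous fun y => u (y, p.2) := FP
  have h := hk.cs.hasFDerivAt_convolution_right (ContinuousLinearMap.mul ℝ ℝ) (μ := volume)
    (f := fun y => u (y, p.2)) hc.locallyIntegrable (hk.sm.of_le (by exact_mod_cast le_top)) p.1
  refine ⟨_, h.congr_of_eventuallyEq (Eventually.of_forall fun x => ?_), fun i => ?_⟩
  · simp only [Wm, convolution_def, ContinuousLinearMap.mul_apply']
    congr 1; ext y; ring
  · rw [convolution_precompR_apply (ContinuousLinearMap.mul ℝ ℝ) hc.locallyIntegrable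
      (hk.cs.fderiv ℝ) (hk.sm.continuous_fderiv (by simp))]
    simp only [Wm, convolution_def, ContinuousLinearMap.mul_apply', pd]
    congr 1; ext y; ring
def Wg {n : ℕ} (u : SpaceTime n → ℝ) (k : Eucl n → ℝ) (p : SpaceTime n) : Eucl n :=
  WithLp.toLp 2 fun i => Wm u (pd i k) p
theorem toLp_ext_clm {A B : Eucl n →L[ℝ] ℝ}
    (h : ∀ i, A (EuclideanSpace.single i 1) = B (EuclideanSpace.single i 1)) : A = B := by
  ext x
  have hx : x = ∑ j, x j • EuclideanSpace.single j (1 : ℝ) := by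
    ext i
    simp [Finset.sum_apply, Pi.single_apply]
  rw [hx, map_sum, map_sum]
  simp [h]
theorem Wm_grad (hu : Continuous u) (hk : Ker k)
    (p : SpaceTime n) : HasGradientAt (fun y => Wm u k (y, p.2)) (Wg u k p) p.1 := by
  obtain ⟨A, hA, h⟩ := Wm_fd hu hk p
  rw [hgf]
  refine hA.congr_fderiv (toLp_ext_clm fun i => ?_)
  rw [h i]
  simp [Wg, EuclideanSpace.inner_single_right]
def WH {n : ℕ} (u : SpaceTime n → ℝ) (k : Eucl n → ℝ) (p : SpaceTime n) : Eucl n →L[ℝ] Eucl n :=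
  ∑ i, (innerSL ℝ (Wg u (pd i k) p)).smulRight (EuclideanSpace.single i (1:ℝ))
theorem WH_apply (u : SpaceTime n → ℝ) (k : Eucl n → ℝ) (p : SpaceTime n) (x : Eucl n) (i : Fin n) :
    WH u k p x i = ⟪Wg u (pd i k) p, x⟫ := by
  simp only [WH, ContinuousLinearMap.sum_apply, ContinuousLinearMap.smulRight_apply, innerSL_apply_apply]
  simp [Pi.single_apply]
theorem Wm_hess (hu : Continuous u) (hk : Ker k)
    (p : SpaceTime n) : HasFDerivAt (fun y => Wg u k (y, p.2)) (WH u k p) p.1 := by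
  rw [← hasFDerivWithinAt_univ, hasFDerivWithinAt_euclidean]
  intro i
  rw [hasFDerivWithinAt_univ]
  have := Wm_grad hu (hk.pd i) p
  rw [hgf] at this
  refine this.congr_fderiv ?_
  ext x
  simp only [InnerProductSpace.toDual_apply_apply, ContinuousLinearMap.comp_apply]
  exact (WH_apply u k p x i).symm
theorem Wg_cont (hu : Continuous u) (hk : Ker k) :
    Continuous (Wg u k) :=
  (PiLp.continuous_toLp 2 _).comp (continuous_pi fun i => Wm_cont hu (hk.pd i))
theorem WH_cont (hu : Continuous u) (hk : Ker k) :
    Continuous (WH u k) := by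
  unfold WH
  refine continuous_finsetSum _ fun i _ => ?_
  have bx : Continuous fun p => innerSL ℝ (Wg u (pd i k) p) := (innerSL ℝ).continuous.comp (Wg_cont hu (hk.pd i))
  have dn : Continuous fun p => (ContinuousLinearMap.smulRightL ℝ (Eucl n) (Eucl n)) (innerSL ℝ (Wg u (pd i k) p)) :=
    (ContinuousLinearMap.continuous _).comp bx
  exact dn.clm_apply continuous_const
theorem op_WH (P : Matrix (Fin n) (Fin n) ℝ) (u : SpaceTime n → ℝ) (k : Eucl n → ℝ) (p : SpaceTime n) :
    op P (WH u k p) = ∑ i, ∑ j, P i j * Wm u (pd j (pd i k)) p := by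
  simp only [op]
  refine Finset.sum_congr rfl fun i _ => Finset.sum_congr rfl fun j _ => ?_
  rw [WH_apply]
  simp [Wg, EuclideanSpace.inner_single_right]
theorem Wm_diff (hu : Continuous u) (hG : Continuous G)
    (hk : Ker k) (bv : tsupport k ⊆ closedBall 0 az)
    (hp : ‖p.1 - ai‖ ≤ r - az) (h : ∀ y, ‖y - ai‖ ≤ r → |u (y, p.2) - G (y, p.2)| ≤ ak) :
    |Wm u k p - Wm G k p| ≤ ak * ∫ y, |k y| := by
  rw [Wm, Wm, ← integral_sub (hk.int (G := fun y => u (y, p.2)) FP p.1)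
    (hk.int (G := fun y => G (y, p.2)) FP p.1)]
  have e : ∫ y, |k y| = ∫ y, |k (p.1 - y)| := (integral_sub_left_eq_self (fun y => |k y|) volume p.1).symm
  rw [e, ← integral_const_mul]
  refine norm_integral_le_of_norm_le (f := fun y => k (p.1 - y) * u (y, p.2) - k (p.1 - y) * G (y, p.2)) ?_ (Eventually.of_forall fun y => ?_)
  · have := (hk.int (G := fun _ => 1) continuous_const p.1).abs.const_mul ak
    simpa using this
  · rw [← mul_sub, Real.norm_eq_abs, abs_mul, mul_comm]
    by_cases hy : k (p.1 - y) = 0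
    · simp [hy]
    · have ab : p.1 - y ∈ closedBall (0 : Eucl n) az := bv (subset_tsupport k hy)
      rw [mem_closedBall, dist_zero_right] at ab
      refine mlr (h y ?_) (abs_nonneg _)
      have : y - ai = -(p.1 - y) + (p.1 - ai) := by abel
      rw [this]
      refine (norm_add_le _ _).trans ?_
      rw [norm_neg]; linarith
theorem const_of_quad (hf : Continuous f)
    (h : ∀ t ∈ Icc a b, ∀ s ∈ Icc t b, s ≤ t + 1 → |f s - f t| ≤ C * (s - t) ^ 2) : ∀ x ∈ Icc a b, f x = f a := by
  refine constant_of_has_deriv_right_zero hf.continuousOn fun t ht => ?_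
  rw [hasDerivWithinAt_iff_isLittleO]
  have ab : (fun s => f s - f t - (s - t) • (0:ℝ)) =O[𝓝[Ici t] t] fun s => (s - t) ^ 2 := by
    refine Asymptotics.IsBigO.of_bound C ?_
    filter_upwards [Icc_mem_nhdsGE ht.2, Icc_mem_nhdsGE (by linarith : t < t + 1)] with s hs hs'
    simp only [smul_zero, sub_zero, Real.norm_eq_abs, abs_pow, sq_abs]
    exact h t ⟨ht.1, ht.2.le⟩ s hs hs'.2
  refine ab.trans_isLittleO ?_
  have af : (fun s : ℝ => s - t) =o[𝓝[Ici t] t] fun _ => (1:ℝ) := by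
    rw [Asymptotics.isLittleO_one_iff]
    have : Continuous fun s : ℝ => s - t := FP
    simpa using (this.tendsto t).mono_left nhdsWithin_le_nhds
  have := af.mul_isBigO (Asymptotics.isBigO_refl (fun s : ℝ => s - t) (𝓝[Ici t] t))
  simpa [sq] using this
theorem Wm_time (hQc : ∀ i j, Continuous fun t => Q t i j) (hu : Continuous u)
    (hap : ∀ t ∈ Icc am 0, ∀ aq, 0 < aq → aq ≤ 1 → ∃ g G Gt gG HG, Evo lam Q t g G Gt gG HG ∧
      ∀ x ∈ closedBall ai r, ∀ s ∈ Icc t 0, |u (x, s) - G (x, s)| ≤ aq + C * (s - t) ^ 2) (hC : 0 ≤ C) (hk : Ker k) (bv : tsupport k ⊆ closedBall 0 az)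
    (hx : ‖x - ai‖ ≤ r - az) (hs : s ∈ Ioc am 0) :
    HasDerivWithinAt (fun s => Wm u k (x, s)) (lam⁻¹ * op (Q s) (WH u k (x, s))) (Iic 0) s := by
  set D : ℝ → ℝ := fun s => lam⁻¹ * op (Q s) (WH u k (x, s)) with hD
  have hDc : ∀ v : SpaceTime n → ℝ, Continuous v → Continuous fun s => lam⁻¹ * ∑ i, ∑ j, Q s i j * Wm v (pd j (pd i k)) (x, s) := by
    intro v hv
    have := fun i j => (Wm_cont hv ((hk.pd i).pd j)).comp (by fun_prop : Continuous fun s : ℝ => (x, s))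
    simp only [Function.comp_def] at this
    fun_prop
  have hDc' : Continuous D := by
    have := hDc u hu
    simpa only [hD, op_WH] using this
  have hfc : Continuous fun s => Wm u k (x, s) := (Wm_cont hu hk).comp FP
  set db : ℝ → ℝ := fun s => Wm u k (x, s) - ∫ r in am..s, D r with mp
  have hId : ∀ s, HasDerivAt (fun s => ∫ r in am..s, D r) (D s) s := fun s =>
    intervalIntegral.integral_hasDerivAt_right (hDc'.intervalIntegrable _ _)
      (hDc'.stronglyMeasurableAtFilter _ _) hDc'.continuousAt
  have hIc : Continuous fun s => ∫ r in am..s, D r := continuous_iff_continuousAt.2 fun s => (hId s).continuousAt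
  obtain ⟨N, pm, hN⟩ : ∃ N : ℝ, 0 ≤ N ∧ N = |lam⁻¹| * ∑ i, ∑ j, ∫ y, |pd j (pd i k) y| * 1 := ⟨_, PS, rfl⟩
  obtain ⟨q, mq, hq⟩ : ∃ q : ℝ, 0 ≤ q ∧ ∀ s ∈ Icc am 0, ∀ i j, |Q s i j| ≤ q := by
    have : ∀ i j, ∃ q : ℝ, ∀ s ∈ Icc am 0, |Q s i j| ≤ q := fun i j => by
      obtain ⟨q, hq⟩ := isCompact_Icc.exists_bound_of_continuousOn (hQc i j).continuousOn (s := Icc am 0)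
      exact ⟨q, hq⟩
    choose q hq using this
    refine ⟨∑ i, ∑ j, |q i j|, PS, fun s hs i j => ?_⟩
    calc |Q s i j| ≤ |q i j| := (hq i j s hs).trans (le_abs_self _)
      _ ≤ ∑ j, |q i j| := Finset.single_le_sum (f := fun j => |q i j|) (fun _ _ => abs_nonneg _) (Finset.mem_univ j)
      _ ≤ _ := Finset.single_le_sum (f := fun i => ∑ j, |q i j|) (fun _ _ => by positivity) (Finset.mem_univ i)
  set I := ∫ y, |k y| with hI
  have pn : 0 ≤ I := PS
  have hquad : ∀ t ∈ Icc am 0, ∀ s ∈ Icc t 0, s ≤ t + 1 → |db s - db t| ≤ (C * (I + q * N)) * (s - t) ^ 2 := by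
    intro t ht s hs hst
    have key : ∀ aq, 0 < aq → aq ≤ 1 → |db s - db t| ≤ aq * (2 * I + q * N) + (C * (I + q * N)) * (s - t) ^ 2 := by
      intro aq cq iv
      obtain ⟨g, G, Gt, gG, HG, hE, hap'⟩ := hap t ht aq cq iv
      have hGc := hE.ek.cu
      have eb : ∀ (k : Eucl n → ℝ), Ker k → tsupport k ⊆ closedBall 0 az → ∀ ah ∈ Icc t 0,
          |Wm u k (x, ah) - Wm G k (x, ah)| ≤ (aq + C * (ah - t) ^ 2) * ∫ y, |k y| := fun k hk bv ah bk =>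
        Wm_diff hu hGc hk bv (p := (x, ah)) hx fun y hy => hap' y (by simpa [dist_eq_norm] using hy) ah bk
      set DG : ℝ → ℝ := fun s => lam⁻¹ * ∑ i, ∑ j, Q s i j * Wm G (pd j (pd i k)) (x, s) with hDG
      have hF : ∫ ah in t..s, DG ah = Wm G k (x, s) - Wm G k (x, t) :=
        intervalIntegral.integral_eq_sub_of_hasDerivAt (fun ah _ => hE.id k hk x ah)
          ((hDc G hGc).intervalIntegrable _ _)
      have fx : ∀ ah ∈ Icc t s, |D ah - DG ah| ≤ (aq + C * (s - t) ^ 2) * (q * N) := by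
        intro ah bk
        have gc : ah ∈ Icc t 0 := ⟨bk.1, bk.2.trans hs.2⟩
        have e : D ah - DG ah = lam⁻¹ * ∑ i, ∑ j, Q ah i j * (Wm u (pd j (pd i k)) (x, ah) - Wm G (pd j (pd i k)) (x, ah)) := by
          simp only [hD, hDG, op_WH, mul_sub, Finset.sum_sub_distrib]
        have hm : aq + C * (ah - t) ^ 2 ≤ aq + C * (s - t) ^ 2 := by
          have := bk.1; have := bk.2
          have : (ah - t) ^ 2 ≤ (s - t) ^ 2 := by gcongr <;> linarith
          gcongr
        rw [e, abs_mul, hN]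
        have : |∑ i, ∑ j, Q ah i j * (Wm u (pd j (pd i k)) (x, ah) - Wm G (pd j (pd i k)) (x, ah))| ≤
            ∑ i, ∑ j, (aq + C * (s - t) ^ 2) * q * (∫ y, |pd j (pd i k) y| * 1) := by
          refine (Finset.abs_sum_le_sum_abs _ _).trans (Finset.sum_le_sum fun i _ => ?_)
          refine (Finset.abs_sum_le_sum_abs _ _).trans (Finset.sum_le_sum fun j _ => ?_)
          rw [abs_mul]
          have ab := eb _ ((hk.pd i).pd j) ((tsupport_fderiv_apply_subset ℝ _).trans
            ((tsupport_fderiv_apply_subset ℝ _).trans bv)) ah gc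
          have af := hq ah ⟨ht.1.trans bk.1, gc.2⟩ i j
          simp only [mul_one]
          have aj : 0 ≤ ∫ y, |pd j (pd i k) y| := PS
          calc _ ≤ q * ((aq + C * (s - t) ^ 2) * ∫ y, |pd j (pd i k) y|) :=
                mul_le_mul af (ab.trans (mlr hm aj)) (abs_nonneg _) mq
            _ = _ := by ring
        refine (mll this (abs_nonneg _)).trans (le_of_eq ?_)
        simp only [← Finset.mul_sum]; ring
      have cb : |∫ ah in t..s, (D ah - DG ah)| ≤ (aq + C * (s - t) ^ 2) * (q * N) * |s - t| := by
        refine intervalIntegral.norm_integral_le_of_norm_le_const (f := fun ah => D ah - DG ah) fun ah bk => ?_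
        rw [uIoc_of_le hs.1] at bk
        exact fx ah ⟨bk.1.le, bk.2⟩
      rw [intervalIntegral.integral_sub (hDc'.intervalIntegrable _ _) ((hDc G hGc).intervalIntegrable _ _), hF] at cb
      have ba : db s - db t = Wm u k (x, s) - Wm u k (x, t) - ∫ ah in t..s, D ah := by
        have := intervalIntegral.integral_add_adjacent_intervals (hDc'.intervalIntegrable (μ := volume) am t) (hDc'.intervalIntegrable t s)
        simp only [mp]; linarith
      have bl := eb k hk bv s hs
      have bq := eb k hk bv t ⟨le_rfl, ht.2⟩
      rw [sub_self] at bq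
      have mr : |s - t| ≤ 1 := by rw [abs_of_nonneg (by linarith [hs.1])]; linarith
      have cr : (aq + C * (s - t) ^ 2) * (q * N) * |s - t| ≤ (aq + C * (s - t) ^ 2) * (q * N) := by
        refine mul_le_of_le_one_right PS mr
      rw [ba]
      rw [abs_le] at bl bq cb ⊢
      constructor <;> linarith [bl.1, bl.2, bq.1, bq.2, cb.1, cb.2]
    refine le_of_forall_pos_le_add fun ak bi => ?_
    have hP : 0 < 2 * I + q * N + 1 := PS
    have := key (min 1 (ak / (2 * I + q * N + 1))) (lt_min one_pos PS) (min_le_left _ _)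
    have af : min 1 (ak / (2 * I + q * N + 1)) * (2 * I + q * N) ≤ ak := by
      calc _ ≤ (ak / (2 * I + q * N + 1)) * (2 * I + q * N + 1) :=
            mul_le_mul (min_le_right _ _) LN PS PS
        _ = ak := by field_simp
    linarith
  have hconst : ∀ x ∈ Icc am 0, db x = db am := const_of_quad (f := db) (hfc.sub hIc) hquad
  have ab : HasDerivWithinAt (fun s => db am + ∫ r in am..s, D r) (D s) (Iic 0) s := ((hId s).const_add _).hasDerivWithinAt
  refine ab.congr_of_eventuallyEq ?_ ?_
  · filter_upwards [self_mem_nhdsWithin, mem_nhdsWithin_of_mem_nhds (Ioi_mem_nhds hs.1)] with ah ab af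
    have e : Wm u k (x, ah) - ∫ r in am..ah, D r = db am := hconst ah ⟨le_of_lt af, ab⟩
    show Wm u k (x, ah) = db am + ∫ r in am..ah, D r
    linarith
  · have e : Wm u k (x, s) - ∫ r in am..s, D r = db am := hconst s ⟨hs.1.le, hs.2⟩
    show Wm u k (x, s) = db am + ∫ r in am..s, D r
    linarith
theorem Wm_IC (hlam : 0 < lam) (hQc : ∀ i j, Continuous fun t => Q t i j) (hu : Continuous u)
    (hap : ∀ t ∈ Icc am 0, ∀ aq, 0 < aq → aq ≤ 1 → ∃ g G Gt gG HG, Evo lam Q t g G Gt gG HG ∧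
      ∀ x ∈ closedBall ai r, ∀ s ∈ Icc t 0, |u (x, s) - G (x, s)| ≤ aq + C * (s - t) ^ 2) (hC : 0 ≤ C) (hk : Ker k) (bv : tsupport k ⊆ closedBall 0 az) :
    IC lam Q (closedBall ai (r - az) ×ˢ Ioc am 0) (Wm u k) (fun p => lam⁻¹ * op (Q p.2) (WH u k p)) (Wg u k) (WH u k) where
  cu := (Wm_cont hu hk).continuousOn
  ct := by
    have := fun i j => Wm_cont hu ((hk.pd i).pd j)
    have af : Continuous fun p : SpaceTime n => lam⁻¹ * ∑ i, ∑ j, Q p.2 i j * Wm u (pd j (pd i k)) p := FP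
    simp only [op_WH]
    exact af.continuousOn
  cg := (Wg_cont hu hk).continuousOn
  cH := (WH_cont hu hk).continuousOn
  dt p hp := Wm_time hQc hu hap hC hk bv (by simpa [dist_eq_norm] using hp.1) hp.2
  dg p _ := Wm_grad hu hk p
  dH p _ := Wm_hess hu hk p
  pde p _ := by field_simp
theorem Ell.op_le (ha : 0 ≤ a) {Q : Matrix (Fin n) (Fin n) ℝ} (h : Ell a b Q) (H : Eucl n →L[ℝ] Eucl n) :
    |op Q H| ≤ n * b * ‖H‖ := by
  obtain ⟨m, ab, af, -⟩ := h.vecs ha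
  rw [ab]
  refine (Finset.abs_sum_le_sum_abs _ _).trans ?_
  have : ∀ k, |⟪H (m k), m k⟫| ≤ ‖H‖ * ‖m k‖ ^ 2 := fun k =>
    (abs_real_inner_le_norm _ _).trans (by nlinarith [H.le_opNorm (m k), norm_nonneg (m k)])
  refine (Finset.sum_le_sum fun k _ => this k).trans ?_
  rw [← Finset.mul_sum]; nlinarith [norm_nonneg H]
theorem time_lim {f f' : ℕ → ℝ → ℝ} {F F' : ℝ → ℝ} (ht : t ∈ Ioc am 0)
    (hd : ∀ m, ∀ s ∈ Ioc am 0, HasDerivWithinAt (f m) (f' m s) (Iic 0) s)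
    (hf : ∀ s ∈ Ioc am 0, Tendsto (fun m => f m s) atTop (𝓝 (F s)))
    (hf' : TendstoUniformlyOn f' F' atTop (Ioc am 0)) (hc : ContinuousWithinAt F' (Ioc am 0) t) :
    HasDerivWithinAt F (F' t) (Iic 0) t := by
  rw [hasDerivWithinAt_iff_isLittleO, Asymptotics.isLittleO_iff]
  intro ak bi
  have ab := Metric.continuousWithinAt_iff.1 hc (ak / 2) PS
  obtain ⟨az, bv, ab⟩ := ab
  have hnear : ∀ᶠ s in 𝓝[Iic 0] t, s ∈ Ioc am 0 ∧ |s - t| < az := by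
    filter_upwards [self_mem_nhdsWithin, mem_nhdsWithin_of_mem_nhds (Ioi_mem_nhds ht.1),
      mem_nhdsWithin_of_mem_nhds (ball_mem_nhds t bv)] with s dc dd ew
    exact ⟨⟨dd, dc⟩, by simpa [Real.dist_eq] using ew⟩
  filter_upwards [hnear] with s hs
  have hsub : uIcc t s ⊆ Ioc am 0 := fun r hr => ⟨lt_of_lt_of_le (lt_min ht.1 hs.1.1) hr.1, hr.2.trans (max_le ht.2 hs.1.2)⟩
  have key : ∀ᶠ m in atTop, |f m s - s * F' t - (f m t - t * F' t)| ≤ ak * |s - t| := by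
    filter_upwards [Metric.tendstoUniformlyOn_iff.1 hf' (ak / 2) PS] with m hm
    have := Convex.norm_image_sub_le_of_norm_hasDerivWithin_le (f := fun r => f m r - r * F' t) (f' := fun r => f' m r - 1 * F' t)
      (s := uIcc t s) (C := ak) (x := t) (y := s) (fun r hr => ?_) (fun r hr => ?_) (convex_uIcc t s) left_mem_uIcc right_mem_uIcc
    · simpa [Real.norm_eq_abs] using this
    · exact ((hd m r (hsub hr)).mono (fun z hz => (hsub hz).2)).sub ((hasDerivWithinAt_id _ _).mul_const _)
    · have dc := hm r (hsub hr)
      have dd := ab (hsub hr) (by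
        rw [Real.dist_eq]; exact (abs_sub_left_of_mem_uIcc hr).trans_lt (by simpa [abs_sub_comm] using hs.2))
      rw [Real.dist_eq] at dc dd
      rw [Real.norm_eq_abs]
      rw [abs_lt] at dc dd
      rw [abs_le]
      constructor <;> linarith [dc.1, dc.2, dd.1, dd.2]
  have cd := ((((hf s hs.1).sub_const (s * F' t)).sub ((hf t ht).sub_const (t * F' t))).abs)
  have de := le_of_tendsto cd key
  rw [Real.norm_eq_abs, Real.norm_eq_abs]
  have e : F s - F t - (s - t) • F' t = F s - s * F' t - (F t - t * F' t) := by rw [smul_eq_mul]; ring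
  rw [e]; exact de
theorem cauchy_lim {X Y : Type*} [TopologicalSpace X] [NormedAddCommGroup Y] [CompleteSpace Y] {f : ℕ → X → Y} {D : Set X}
    (hc : ∀ m, ContinuousOn (f m) D)
    (h : ∀ ak > 0, ∃ N, ∀ m ≥ N, ∀ k ≥ N, ∀ p ∈ D, ‖f m p - f k p‖ ≤ ak) :
    ∃ F, TendstoUniformlyOn f F atTop D ∧ ContinuousOn F D := by
  have hU : UniformCauchySeqOn f atTop D := by
    rw [Metric.uniformCauchySeqOn_iff]
    intro ak bi
    obtain ⟨N, hN⟩ := h (ak / 2) PS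
    exact ⟨N, fun m hm k hk p hp => by rw [dist_eq_norm]; linarith [hN m hm k hk p hp]⟩
  have hl : ∀ p, ∃ y, p ∈ D → Tendsto (fun m => f m p) atTop (𝓝 y) := by
    intro p
    by_cases hp : p ∈ D
    · obtain ⟨y, hy⟩ := cauchySeq_tendsto_of_complete (hU.cauchySeq hp)
      exact ⟨y, fun _ => hy⟩
    · exact ⟨0, fun h => absurd h hp⟩
  choose F hF using hl
  have := hU.tendstoUniformlyOn_of_tendsto hF
  exact ⟨F, this, this.continuousOn (Frequently.of_forall hc)⟩
theorem POp_cyl (c : Eucl n) (R am : ℝ) : POp (ball c R ×ˢ Ioc am 0) := by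
  intro p hp
  refine ⟨hp.2.2, min (R - dist p.1 c) (p.2 - am), lt_min (by linarith [mem_ball.1 hp.1]) (by linarith [hp.2.1]), fun q ab af aj => ?_⟩
  refine ⟨?_, ?_, aj.trans hp.2.2⟩
  · rw [mem_ball]
    have := dist_triangle q.1 p.1 c
    rw [← dist_eq_norm] at ab
    linarith [ab.trans_le (min_le_left _ _)]
  · linarith [min_le_right (R - dist p.1 c) (p.2 - am)]
theorem IC_lim (hlam : 0 < lam) (ha : 0 < a) (hb : 0 < b)
    (hQ : ∀ t, Ell a b (Q t)) (hQc : ∀ i j, Continuous fun t => Q t i j) {R' ex : ℝ} (hR : R' < R) (iw : am < ex)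
    {w wt : ℕ → SpaceTime n → ℝ} {g : ℕ → SpaceTime n → Eucl n} {H : ℕ → SpaceTime n → Eucl n →L[ℝ] Eucl n}
    (hw : ∀ m, IC lam Q (ball c R ×ˢ Ioc am 0) (w m) (wt m) (g m) (H m))
    (hu : TendstoUniformlyOn w u atTop (ball c R ×ˢ Ioc am 0)) :
    ∃ ut g H, IC lam Q (ball c R' ×ˢ Ioc ex 0) u ut g H := by
  set D := ball c R ×ˢ Ioc am 0 with hDdef
  set D' := ball c R' ×ˢ Ioc ex 0 with hD'def
  have hDD : D' ⊆ D := prod_mono (ball_subset_ball hR.le) (Ioc_subset_Ioc_left iw.le)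
  have hDP : POp D := POp_cyl _ _ _
  obtain ⟨ah, bk, bz, gx⟩ : ∃ ah > 0, 3 * ah < R - R' ∧ 2 * lam * ah ^ 2 < ex - am := by
    set m := min (min 1 ((R - R') / 4)) ((ex - am) / (4 * lam)) with hm
    have ab : m ≤ 1 := (min_le_left _ _).trans (min_le_left _ _)
    have af : m ≤ (R - R') / 4 := (min_le_left _ _).trans (min_le_right _ _)
    have aj : m ≤ (ex - am) / (4 * lam) := min_le_right _ _
    have bg : 0 < m := lt_min (lt_min one_pos LN) (div_pos LN LN)
    refine ⟨m, bg, LN, ?_⟩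
    rw [le_div_iff₀ PS] at aj
    linarith [mul_pos hlam bg, mul_nonneg (mul_pos hlam bg).le (sub_nonneg.2 ab)]
  obtain ⟨ax, hA, cz⟩ : ∃ ax : ℝ, 8 ≤ ax ∧ n * b * 40 + 1 < a * ax ^ 2 := by
    refine ⟨8 + (n * b * 40 + 1) / a, le_add_of_nonneg_right PS, ?_⟩
    have : a * ((n * b * 40 + 1) / a) = n * b * 40 + 1 := by field_simp
    have bg : 0 ≤ (n * b * 40 + 1) / a := PS
    nlinarith [mul_nonneg ha.le (sq_nonneg ((n * b * 40 + 1) / a))]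
  have hCau : ∀ ak > 0, ∃ N, ∀ m ≥ N, ∀ k ≥ N, ∀ p ∈ D', ‖g m p - g k p‖ ≤ ak ∧ ‖H m p - H k p‖ ≤ ak := by
    intro ak bi
    set S := min (ak * ah / ax) (ak * ah * ah / (ax * ax)) with hS
    have da : 0 < ax := LN
    have kk : 0 < S := lt_min PS PS
    obtain ⟨N, hN⟩ := Metric.uniformCauchySeqOn_iff.1 hu.uniformCauchySeqOn S kk
    refine ⟨N, fun m hm k hk p hp => ?_⟩
    have := INTgH (u := fun p => w m p - w k p) hDP ((hw m).sub (hw k)) ha hb hlam kk.le hA cz bk (c := p.1) (ad := p.2) (fun t _ => hQ t) ?_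
    · have ba : S * ax / ah ≤ ak := by
        rw [div_le_iff₀ bk, ← le_div_iff₀ da]; exact min_le_left _ _
      have bb : S * ax / ah * ax / ah ≤ ak := by
        have : S * ax / ah * ax / ah = S * (ax * ax) / (ah * ah) := by field_simp
        rw [this, div_le_iff₀ PS, ← le_div_iff₀ PS, ← mul_assoc]; exact min_le_right _ _
      exact ⟨this.1.trans ba, this.2.trans bb⟩
    · intro x t hx ht
      have hin : (x, t) ∈ D := by
        refine ⟨?_, ?_, ht.2.trans hp.2.2⟩
        · rw [mem_ball]
          have := dist_triangle x p.1 c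
          rw [← dist_eq_norm] at hx
          linarith [mem_ball.1 hp.1]
        · have := hp.2.1; have := ht.1; simp only; linarith
      refine ⟨hin, ?_⟩
      have := hN m hm k hk _ hin
      rw [Real.dist_eq] at this
      exact this.le
  obtain ⟨G, hG, hGc⟩ := cauchy_lim (fun m => ((hw m).mono hDD).cg) (fun ak bi => by
    obtain ⟨N, h⟩ := hCau ak bi
    exact ⟨N, fun m hm k hk p hp => (h m hm k hk p hp).1⟩)
  obtain ⟨K, hK, hKc⟩ := cauchy_lim (fun m => ((hw m).mono hDD).cH) (fun ak bi => by
    obtain ⟨N, h⟩ := hCau ak bi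
    exact ⟨N, fun m hm k hk p hp => (h m hm k hk p hp).2⟩)
  obtain ⟨T, hT, hTc⟩ := cauchy_lim (fun m => ((hw m).mono hDD).ct) (fun ak bi => by
    have hnb : 0 < (n:ℝ) * b + 1 := PS
    obtain ⟨N, h⟩ := hCau (lam * ak / (n * b + 1)) PS
    refine ⟨N, fun m hm k hk p hp => ?_⟩
    have e := ((hw m).sub (hw k)).pde p (hDD hp)
    have bb := (hQ p.2).op_le ha.le (H m p - H k p)
    rw [← e, abs_mul, abs_of_pos hlam] at bb
    rw [Real.norm_eq_abs]
    have bt : ‖H m p - H k p‖ * (n * b + 1) ≤ lam * ak := (le_div_iff₀ hnb).1 (h m hm k hk p hp).2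
    exact (mul_le_mul_iff_right₀ hlam).1 (by linarith [norm_nonneg (H m p - H k p)]))
  have hslice : ∀ {Y : Type} [NormedAddCommGroup Y] {f : ℕ → SpaceTime n → Y} {F : SpaceTime n → Y} {t : ℝ}, t ∈ Ioc ex 0 → TendstoUniformlyOn f F atTop D' →
      TendstoUniformlyOn (fun m y => f m (y, t)) (fun y => F (y, t)) atTop (ball c R') := by
    intro Y _ f F t ht h
    rw [Metric.tendstoUniformlyOn_iff] at h ⊢
    intro ak bi
    filter_upwards [h ak bi] with m hm x hx
    exact hm (x, t) ⟨hx, ht⟩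
  have hu' := hu.mono hDD
  refine ⟨T, G, K, ⟨hu'.continuousOn (Frequently.of_forall fun m => ((hw m).mono hDD).cu), hTc, hGc, hKc, ?_, ?_, ?_, ?_⟩⟩
  · intro p hp
    refine time_lim (f := fun m s => w m (p.1, s)) (f' := fun m s => wt m (p.1, s)) (F' := fun s => T (p.1, s)) hp.2
      (fun m s hs => (hw m).dt (p.1, s) (hDD ⟨hp.1, hs⟩)) (fun s hs => hu'.tendsto_at ⟨hp.1, hs⟩) ?_ ?_
    · rw [Metric.tendstoUniformlyOn_iff] at hT ⊢
      intro ak bi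
      filter_upwards [hT ak bi] with m hm x hx
      exact hm (p.1, x) ⟨hp.1, hx⟩
    · exact ContinuousWithinAt.comp (t := D') (hTc p hp) FP (fun s hs => ⟨hp.1, hs⟩)
  · intro p hp
    rw [hgf]
    refine hasFDerivAt_of_tendstoUniformlyOn (𝕜 := ℝ) (l := atTop) (s := ball c R') (f := fun m y => w m (y, p.2)) (f' := fun m y => InnerProductSpace.toDual ℝ (Eucl n) (g m (y, p.2)))
      (g' := fun y => InnerProductSpace.toDual ℝ (Eucl n) (G (y, p.2))) (g := fun y => u (y, p.2)) isOpen_ball ?_ ?_ ?_ (x := p.1) hp.1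
    · have := hslice hp.2 hG
      rw [Metric.tendstoUniformlyOn_iff] at this ⊢
      intro ak bi
      filter_upwards [this ak bi] with m hm x hx
      rw [LinearIsometryEquiv.dist_map]; exact hm x hx
    · intro m x hx
      exact hgf.1 ((hw m).dg (x, p.2) (hDD ⟨hx, hp.2⟩))
    · intro x hx
      exact hu'.tendsto_at ⟨hx, hp.2⟩
  · intro p hp
    exact hasFDerivAt_of_tendstoUniformlyOn (𝕜 := ℝ) (l := atTop) (s := ball c R') (f := fun m y => g m (y, p.2)) (f' := fun m y => H m (y, p.2))
      (g' := fun y => K (y, p.2)) (g := fun y => G (y, p.2)) isOpen_ball (hslice hp.2 hK) (fun m x hx => (hw m).dH (x, p.2) (hDD ⟨hx, hp.2⟩))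
      (fun x hx => hG.tendsto_at ⟨hx, hp.2⟩) (x := p.1) hp.1
  · intro p hp
    have cd : Tendsto (fun m => lam * wt m p) atTop (𝓝 (lam * T p)) := (hT.tendsto_at hp).const_mul lam
    have hcont : Continuous fun A : Eucl n →L[ℝ] Eucl n => op (Q p.2) A := by
      unfold op; fun_prop
    have de := (hcont.tendsto (K p)).comp (hK.tendsto_at hp)
    refine tendsto_nhds_unique cd (de.congr fun m => ?_)
    exact ((hw m).pde p (hDD hp)).symm
theorem IC_glue
    (h : ∀ p ∈ D, ∃ D' ut g H, D' ∈ 𝓝[D] p ∧ p ∈ D' ∧ POp D' ∧ IC lam Q D' u ut g H) :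
    ∃ ut g H, IC lam Q D u ut g H := by
  set T : SpaceTime n → ℝ := fun p => derivWithin (fun s => u (p.1, s)) (Iic 0) p.2
  set G : SpaceTime n → Eucl n := fun p => gradient (fun y => u (y, p.2)) p.1
  set K : SpaceTime n → Eucl n →L[ℝ] Eucl n := fun p => fderiv ℝ (fun y => G (y, p.2)) p.1
  have key : ∀ p ∈ D, ∃ D', D' ∈ 𝓝[D] p ∧ p ∈ D' ∧ IC lam Q D' u T G K := by
    intro p hp
    obtain ⟨D', ut, g, H, hn, hpD, hP, hI⟩ := h p hp
    have eT : EqOn T ut D' := fun q hq => (hI.dt q hq).derivWithin (uniqueDiffOn_Iic 0 _ (hP q hq).1)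
    have eG : EqOn G g D' := fun q hq => (hI.dg q hq).gradient
    have hd : ∀ q ∈ D', HasFDerivAt (fun y => G (y, q.2)) (H q) q.1 := fun q hq => by
      refine (hI.dH q hq).congr_of_eventuallyEq ?_
      filter_upwards [hP.nhds hq] with y hy
      exact eG hy
    have eK : EqOn K H D' := fun q hq => (hd q hq).fderiv
    refine ⟨D', hn, hpD, hI.cu, hI.ct.congr eT, hI.cg.congr eG, hI.cH.congr eK, fun q hq => ?_, fun q hq => ?_, fun q hq => ?_, fun q hq => ?_⟩
    · rw [eT hq]; exact hI.dt q hq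
    · rw [eG hq]; exact hI.dg q hq
    · rw [eK hq]; exact hd q hq
    · rw [eT hq, eK hq]; exact hI.pde q hq
  have cont : ∀ {Y : Type} [TopologicalSpace Y] (f : SpaceTime n → Y), (∀ D', IC lam Q D' u T G K → ContinuousOn f D') → ContinuousOn f D := by
    intro Y _ f hf p hp
    obtain ⟨D', hn, hpD, hI⟩ := key p hp
    exact (hf D' hI p hpD).mono_of_mem_nhdsWithin hn
  refine ⟨T, G, K, cont _ fun _ h => h.cu, cont _ fun _ h => h.ct, cont _ fun _ h => h.cg, cont _ fun _ h => h.cH, fun p hp => ?_, fun p hp => ?_, fun p hp => ?_, fun p hp => ?_⟩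
  all_goals obtain ⟨D', hn, hpD, hI⟩ := key p hp
  · exact hI.dt p hpD
  · exact hI.dg p hpD
  · exact hI.dH p hpD
  · exact hI.pde p hpD
theorem IVs.congr {w : SpaceTime n → ℝ}
    (h : IVs lam Q u D) (hD : POp D) (e : EqOn w u D) : IVs lam Q w D := by
  intro ao bd g H bj p hp aa ar hm
  obtain ⟨_, cp, it, hs⟩ := hD p hp
  refine h ao bd g H bj p hp (min aa cp) (lt_min ar it) fun q ab af aj => ?_
  have hq := hs q (ab.trans_le (min_le_right _ _)) (by linarith [min_le_right aa cp]) aj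
  rw [← e hq, ← e hp]
  exact hm q (ab.trans_le (min_le_left _ _)) (by linarith [min_le_left aa cp]) aj
theorem IVs.mono
    (h : IVs lam Q u D) (hD : D' ⊆ D) : IVs lam Q u D' :=
  fun ao bd g H bj p hp aa ar hm => h ao bd g H bj p (hD hp) aa ar hm
theorem moll (hu : Continuous u) (bi : 0 < ak) (hR : 0 < R) :
    ∃ k : Eucl n → ℝ, Ker k ∧ (tsupport k ⊆ closedBall 0 R) ∧ ∀ p ∈ ball c R ×ˢ Ioc am 0, |Wm u k p - u p| ≤ ak := by
  have hK : IsCompact (closedBall c (2 * R) ×ˢ Icc am 0) := (isCompact_closedBall _ _).prod isCompact_Icc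
  have hUC := hK.uniformContinuousOn_of_continuous hu.continuousOn
  obtain ⟨az, bv, hd⟩ := Metric.uniformContinuousOn_iff.1 hUC ak bi
  set r := min az R with hr
  have ii : 0 < r := lt_min bv hR
  let f : ContDiffBump (0 : Eucl n) := ⟨r / 4, r / 2, PS, LN⟩
  have hts : tsupport (f.normed volume) ⊆ closedBall 0 R := by
    rw [f.tsupport_normed_eq]
    exact closedBall_subset_closedBall (by show r / 2 ≤ R; linarith [min_le_right az R])
  refine ⟨f.normed volume, ⟨f.contDiff_normed, f.hasCompactSupport_normed⟩, hts, fun p hp => ?_⟩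
  have hint : Integrable (fun y => f.normed volume y * u (p.1 - y, p.2)) :=
    ((f.continuous_normed).mul FP).integrable_of_hasCompactSupport f.hasCompactSupport_normed.mul_right
  have e : Wm u (f.normed volume) p - u p = ∫ y, f.normed volume y * (u (p.1 - y, p.2) - u p) := by
    rw [Wm_swap]
    simp only [mul_sub]
    rw [integral_sub hint (f.integrable_normed.mul_const _), integral_mul_const, f.integral_normed, one_mul]
  rw [e]
  have hb : ∀ y, ‖f.normed volume y * (u (p.1 - y, p.2) - u p)‖ ≤ ak * f.normed volume y := by
    intro y
    by_cases hy : y ∈ ball (0 : Eucl n) f.rOut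
    · rw [norm_mul, Real.norm_of_nonneg (f.nonneg_normed y), mul_comm]
      refine mlr ?_ (f.nonneg_normed y)
      have hy' : ‖y‖ < r / 2 := by simpa using hy
      have := hd (p.1 - y, p.2) ⟨?_, hp.2.1.le, hp.2.2⟩ p ⟨?_, hp.2.1.le, hp.2.2⟩ ?_
      · rw [← dist_eq_norm]; exact this.le
      · rw [mem_closedBall, dist_eq_norm]
        have ab := norm_sub_le (p.1 - c) y
        have af := mem_ball.1 hp.1; rw [dist_eq_norm] at af
        have : p.1 - y - c = p.1 - c - y := by abel
        rw [this]; linarith [min_le_right az R]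
      · exact closedBall_subset_closedBall LN (ball_subset_closedBall hp.1)
      · rw [Prod.dist_eq]; simp
        linarith [min_le_left az R]
    · have : f.normed volume y = 0 := by
        by_contra h
        exact hy (f.support_normed_eq (μ := volume) ▸ (Function.mem_support.2 h))
      rw [this]; simp
  refine (norm_integral_le_of_norm_le (f.integrable_normed.const_mul ak) (Eventually.of_forall hb)).trans ?_
  rw [integral_const_mul, f.integral_normed, mul_one]
theorem interior_reg (hn : 1 ≤ n) (hlam : 0 < lam) (ha : 0 < a) (hb : 0 < b)
    (hQ : ∀ t, Ell a b (Q t)) (hQc : ∀ i j, Continuous fun t => Q t i j) (hD : ∀ p ∈ D, p.2 ≤ 0 ∧ ∃ R > 0, ∃ am < p.2, closedBall p.1 R ×ˢ Icc am 0 ⊆ D)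
    (hu : ContinuousOn u D) (ep : ∀ p ∈ D, |u p| ≤ 1) (ab : IVs lam Q u D) (af : IVs lam Q (fun p => - u p) D) :
    ∃ ut g H, IC lam Q D u ut g H := by
  have hn' : (1:ℝ) ≤ n := by exact_mod_cast hn
  refine IC_glue fun p hp => ?_
  obtain ⟨er, R, hR, am, iw, hsub⟩ := hD p hp
  set X := closedBall p.1 R ×ˢ Icc am 0 with hX
  have hXc : IsClosed X := isClosed_closedBall.prod isClosed_Icc
  obtain ⟨w', hw'⟩ := ContinuousMap.exists_restrict_eq (Y := ℝ) hXc ⟨X.domRestrict u, (hu.mono hsub).domRestrict⟩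
  have hwu : EqOn (fun p => w' p) u X := fun q hq => by
    have := congrArg (fun f : C(X, ℝ) => f ⟨q, hq⟩) hw'
    exact this
  set w : SpaceTime n → ℝ := fun p => w' p with hw
  have hwc : Continuous w := w'.continuous
  set r := R / n with hr
  have ii : 0 < r := PS
  have hnr : n * r = R := by rw [hr]; field_simp
  have hBX : ball p.1 (n * r) ×ˢ Ioc am 0 ⊆ X := by
    rw [hnr]; exact prod_mono ball_subset_closedBall Ioc_subset_Icc_self
  have hP := POp_cyl p.1 (n * r) am
  have hap := fun t (ht : t ∈ Icc am 0) aq (bg : 0 < aq) ms => approx hn hlam ha.le hb hQ hQc hwc (ai := p.1) (r := r) (am := am) ii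
    (fun q hq => by rw [hnr] at hq; rw [hwu hq]; exact ep q (hsub hq))
    ((ab.mono (hBX.trans hsub)).congr hP (fun q hq => hwu (hBX hq)))
    ((af.mono (hBX.trans hsub)).congr hP (fun q hq => by simp only; rw [hwu (hBX hq)])) ht bg ms
  have hm : ∀ m : ℕ, ∃ k : Eucl n → ℝ, Ker k ∧ (tsupport k ⊆ closedBall 0 (r / 4)) ∧ ∀ q ∈ ball p.1 (r / 4) ×ˢ Ioc am 0, |Wm w k q - w q| ≤ 1 / ((m:ℝ) + 1) :=
    fun m => moll hwc PS PS
  choose k mt km mu using hm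
  obtain ⟨ut, g, H, hI⟩ := IC_lim (u := w) hlam ha hb hQ hQc (c := p.1) (R := r / 4) (R' := r / 8) (am := am) (ex := (am + p.2) / 2) LN LN
    (fun m => (Wm_IC hlam hQc hwc hap PS (mt m) (km m)).mono (prod_mono (ball_subset_closedBall.trans (closedBall_subset_closedBall LN)) subset_rfl)) (by
      rw [Metric.tendstoUniformlyOn_iff]
      intro ak bi
      obtain ⟨N, hN⟩ := exists_nat_one_div_lt bi
      filter_upwards [eventually_ge_atTop N] with m hm q hq
      rw [dist_comm, Real.dist_eq]
      refine (mu m q hq).trans_lt (lt_of_le_of_lt ?_ hN)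
      exact one_div_le_one_div_of_le PS (by exact_mod_cast Nat.succ_le_succ hm))
  have mv : r / 8 ≤ R := by rw [← hnr]; nlinarith
  have hD'X : ball p.1 (r / 8) ×ˢ Ioc ((am + p.2) / 2) 0 ⊆ X :=
    prod_mono (ball_subset_closedBall.trans (closedBall_subset_closedBall mv)) (fun s hs => ⟨by linarith [hs.1], hs.2⟩)
  have hPP := POp_cyl p.1 (r / 8) ((am + p.2) / 2)
  have hnb : ∀ q ∈ ball p.1 (r / 8) ×ˢ Ioc ((am + p.2) / 2) 0, ∀ᶠ y in 𝓝 q.1, w (y, q.2) = u (y, q.2) := fun q hq => by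
    filter_upwards [hPP.nhds hq] with y hy using hwu (hD'X hy)
  refine ⟨ball p.1 (r / 8) ×ˢ Ioc ((am + p.2) / 2) 0, ut, g, H, ?_, ⟨mem_ball_self PS, LN, er⟩, hPP, ⟨hI.cu.congr fun q hq => (hwu (hD'X hq)).symm, hI.ct, hI.cg, hI.cH, fun q hq => ?_, fun q hq => ?_, hI.dH, hI.pde⟩⟩
  · have : ball p.1 (r / 8) ×ˢ Ioi ((am + p.2) / 2) ∈ 𝓝 p := prod_mem_nhds (ball_mem_nhds _ PS) (Ioi_mem_nhds LN)
    filter_upwards [mem_nhdsWithin_of_mem_nhds this, self_mem_nhdsWithin] with q hq hqD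
    exact ⟨hq.1, hq.2, (hD q hqD).1⟩
  · refine (hI.dt q hq).congr_of_eventuallyEq ?_ (hwu (hD'X hq)).symm
    filter_upwards [self_mem_nhdsWithin, mem_nhdsWithin_of_mem_nhds (Ioi_mem_nhds hq.2.1)] with s dc dd
    exact (hwu (hD'X (mk_mem_prod hq.1 ⟨dd, dc⟩))).symm
  · have := hI.dg q hq
    rw [hgf] at this ⊢
    refine this.congr_of_eventuallyEq ?_
    filter_upwards [hnb q hq] with y hy using hy.symm
theorem IC.tmv (h : IC lam Q D u ut g H) {dj : ℝ} (ix : am ≤ dj) (af : dj ≤ 0)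
    (hb : ∀ s ∈ Icc am dj, (x, s) ∈ D ∧ ut (x, s) ≤ C) : u (x, dj) - u (x, am) ≤ C * (dj - am) := by
  have hd : ∀ s ∈ interior (Icc am dj), HasDerivAt (fun s => u (x, s)) (ut (x, s)) s := fun s hs => by
    rw [interior_Icc] at hs
    exact (h.dt _ (hb s ⟨hs.1.le, hs.2.le⟩).1).hasDerivAt (Iic_mem_nhds (hs.2.trans_le af))
  refine Convex.image_sub_le_mul_sub_of_deriv_le (convex_Icc am dj) (f := fun s => u (x, s)) (h.cu.comp FP fun s hs => (hb s hs).1)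
    (fun s hs => (hd s hs).differentiableAt.differentiableWithinAt) (fun s hs => ?_) am ⟨le_rfl, ix⟩ dj ⟨ix, le_rfl⟩ ix
  rw [(hd s hs).deriv]; exact (hb s (interior_subset hs)).2
theorem IC.tim (h : IC lam Q D u ut g H) (hD : POp D) (hp : p ∈ D) (bi : 0 < ak) : ∃ aa > 0, ∀ q : SpaceTime n,
    ‖q.1 - p.1‖ < aa → p.2 - aa < q.2 → q.2 ≤ p.2 → (ut p + ak) * (q.2 - p.2) ≤ u q - u (q.1, p.2) := by
  obtain ⟨ap, aa, iy, ar⟩ := hD p hp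
  obtain ⟨az, fn, bv⟩ := Metric.continuousWithinAt_iff.1 (h.ct p hp) ak bi
  refine ⟨min aa az, lt_min iy fn, fun q ab af aj => ?_⟩
  have := h.tmv (x := q.1) (C := ut p + ak) aj ap fun s hs => by
    have hm := ar (q.1, s) (ab.trans_le (min_le_left _ _)) (by linarith [hs.1, min_le_left aa az]) hs.2
    refine ⟨hm, ?_⟩
    have := bv hm (by
      rw [Prod.dist_eq, dist_eq_norm, Real.dist_eq, max_lt_iff, abs_of_nonpos (by linarith [hs.2])]
      exact ⟨ab.trans_le (min_le_right _ _), by linarith [hs.1, min_le_right aa az]⟩)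
    rw [Real.dist_eq] at this
    linarith [(abs_lt.1 this).2]
  have e : u q = u (q.1, q.2) := rfl
  rw [e]; linarith
theorem IC.tay (h : IC lam Q D u ut g H) (hD : POp D) (hp : p ∈ D) : ∃ C, ∃ aa > 0, ∀ k, ‖k‖ < aa →
    ⟪g p, k⟫ - C * ‖k‖ ^ 2 ≤ u (p.1 + k, p.2) - u p := by
  obtain ⟨C, hC⟩ := ((h.dH p hp).isBigO_sub).bound
  obtain ⟨aa, iy, ar⟩ := Metric.eventually_nhds_iff.1 (hC.and (hD.nhds hp))
  refine ⟨|C|, aa, iy, fun k hk => ?_⟩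
  have hball : ∀ y ∈ closedBall p.1 ‖k‖, dist y p.1 < aa := fun y hy => lt_of_le_of_lt hy hk
  have := Convex.norm_image_sub_le_of_norm_hasFDerivWithin_le (f := fun y => u (y, p.2) - ⟪g p, y⟫) (C := |C| * ‖k‖)
    (f' := fun y => InnerProductSpace.toDual ℝ (Eucl n) (g (y, p.2)) - InnerProductSpace.toDual ℝ (Eucl n) (g p)) (s := closedBall p.1 ‖k‖)
    (fun y hy => by
      have ab := h.dg (y, p.2) (ar (hball y hy)).2
      rw [hgf] at ab
      exact (ab.sub (InnerProductSpace.toDual ℝ (Eucl n) (g p)).hasFDerivAt).hasFDerivWithinAt)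
    (fun y hy => by
      rw [← map_sub, LinearIsometryEquiv.norm_map]
      refine (ar (hball y hy)).1.trans ?_
      rw [mem_closedBall, dist_eq_norm] at hy
      exact mul_le_mul (le_abs_self C) hy (norm_nonneg _) (abs_nonneg _)) (convex_closedBall _ _) (x := p.1) (y := p.1 + k)
    (by simp) (by simp)
  rw [add_sub_cancel_left, Real.norm_eq_abs, inner_add_right] at this
  have e : u p = u (p.1, p.2) := rfl
  rw [e]
  have := (abs_le.1 this).1
  linarith
end
section
variable {n d : ℕ} {lam a b M bc r t aa ak al C B ad aq ay r' S ci s K dh CT br Λ C₀ A : ℝ} {Q Q' : ℝ → Matrix (Fin (d + 1)) (Fin (d + 1)) ℝ} {v v' : ℝ → Eucl (d + 1)} {u ut w wt η ao bd : SpaceTime (d + 1) → ℝ} {g g' : SpaceTime (d + 1) → Eucl (d + 1)} {H H' : SpaceTime (d + 1) → Eucl (d + 1) →L[ℝ] Eucl (d + 1)} {p q ap : SpaceTime (d + 1)} {c x ai be V : Eucl (d + 1)}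
structure Dat (d : ℕ) (lam a b M bc : ℝ) (Q : ℝ → Matrix (Fin (d + 1)) (Fin (d + 1)) ℝ) (v : ℝ → Eucl (d + 1)) : Prop where
  bo : 0 < lam
  cd : lam ≤ 1
  ec : 0 < a
  dy : 0 < b
  fo : 1 ≤ M
  fk : 0 ≤ bc
  ell : ∀ t, Ell a b (Q t)
  lip : ∀ t s i j, |Q t i j - Q s i j| ≤ bc / lam * |t - s|
  vl : ∀ t, M⁻¹ ≤ lastC (v t)
  vb : ∀ t, ‖v t‖ ≤ M
  vlip : ∀ t s, ‖v t - v s‖ ≤ lam⁻¹ * |t - s|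
def clp (t : ℝ) : ℝ := max (-1) (min 0 t)
theorem clp_mem (t : ℝ) : clp t ∈ Icc (-1 : ℝ) 0 := ⟨le_max_left _ _, max_le NN (min_le_left _ _)⟩
theorem clp_eq (h : t ∈ Icc (-1 : ℝ) 0) : clp t = t := by
  rw [clp, min_eq_right h.2, max_eq_right h.1]
theorem clp_lip (t s : ℝ) : |clp t - clp s| ≤ |t - s| :=
  (abs_max_sub_max_le_max _ _ _ _).trans (max_le (by simp) ((abs_min_sub_min_le_max _ _ _ _).trans (by simp)))
def matH {n : ℕ} (H : Eucl n →L[ℝ] Eucl n) : Matrix (Fin n) (Fin n) ℝ := fun i j => H (EuclideanSpace.single j 1) i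
theorem matH_lin (H : Eucl n →L[ℝ] Eucl n) :
    LinearMap.toContinuousLinearMap (Matrix.toEuclideanLin (matH H)) = H := by
  ext x i
  have hx : x = ∑ j, x j • EuclideanSpace.single j (1 : ℝ) := by
    ext i
    simp [Finset.sum_apply, Pi.single_apply]
  conv_rhs => rw [hx, map_sum]
  simp [Matrix.toLpLin_apply, Matrix.mulVec, dotProduct, matH, mul_comm]
theorem mat_entry (A : Matrix (Fin n) (Fin n) ℝ) (i j : Fin n) : |A i j| ≤ matOpNorm A := by
  have h := (LinearMap.toContinuousLinearMap (Matrix.toEuclideanLin A)).le_opNorm (EuclideanSpace.single j 1)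
  have af := (coord_le ((LinearMap.toContinuousLinearMap (Matrix.toEuclideanLin A)) (EuclideanSpace.single j 1)) i).trans h
  simpa [Matrix.toLpLin_apply, matOpNorm] using af
theorem Dat.of
    (h : ObliqueData d lam Λ M C₀ Q Q' v v') :
    Dat d lam (Λ * M ^ 2)⁻¹ (Λ * M ^ 2) M C₀ (fun t => Q (clp t)) (fun t => v (clp t)) := by
  have hΛ := h.Lam_ge_one
  have hM := h.M_ge_one
  have hB : 0 < Λ * M ^ 2 := PS
  refine ⟨h.lam_pos, h.lam_le_one, inv_pos.2 hB, hB, hM, h.C0_pos.le, fun t => ?_, fun t s i j => ?_, fun t => h.vlast _ (clp_mem t), fun t => h.vbound _ (clp_mem t), fun t s => ?_⟩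
  · have ht := clp_mem t
    have hs : ∀ i j, Q (clp t) i j = Q (clp t) j i := fun i j => (h.Qsymm _ ht).apply j i
    have hone : ∀ x : Eucl (d + 1), ∀ c : ℝ, ∑ i, ∑ j, (c • (1 : Matrix (Fin (d + 1)) (Fin (d + 1)) ℝ)) i j * (x i * x j) = c * ‖x‖ ^ 2 := by
      intro x c
      rw [normsq_sum, Finset.mul_sum]
      refine Finset.sum_congr rfl fun i _ => ?_
      simp [Matrix.one_apply, mul_ite]
    refine ⟨hs, fun x => ?_, fun x => ?_⟩
    · have := (psd_iff (fun i j => by simp [hs i j, Matrix.one_apply, eq_comm])).1 (h.Qlower _ ht) x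
      simp only [qf, Matrix.sub_apply, sub_mul, Finset.sum_sub_distrib] at this
      rw [hone] at this
      simp only [qf]; linarith
    · have := (psd_iff (fun i j => by simp [hs i j, Matrix.one_apply, eq_comm])).1 (h.Qupper _ ht) x
      simp only [qf, Matrix.sub_apply, sub_mul, Finset.sum_sub_distrib] at this
      rw [hone] at this
      simp only [qf]; linarith
  · have := Convex.norm_image_sub_le_of_norm_hasDerivWithin_le (f := fun s => Q s i j) (C := C₀ / lam) (fun r hr => h.Qderiv r hr i j)
      (fun r hr => (mat_entry _ i j).trans (h.Qderiv_bound r hr)) (convex_Icc _ _) (clp_mem s) (clp_mem t)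
    exact this.trans (mll (clp_lip _ _) (div_nonneg h.C0_pos.le h.lam_pos.le))
  · have := Convex.norm_image_sub_le_of_norm_hasDerivWithin_le (C := lam⁻¹) (fun r hr => h.vderiv r hr)
      (fun r hr => h.vderiv_bound r hr) (convex_Icc _ _) (clp_mem s) (clp_mem t)
    exact this.trans (mll (clp_lip _ _) (inv_nonneg.2 h.lam_pos.le))
theorem grad_symm {f : Eucl n → ℝ} {g : Eucl n → Eucl n} {H : Eucl n →L[ℝ] Eucl n} {x : Eucl n}
    (ab : ∀ᶠ y in 𝓝 x, HasGradientAt f (g y) y) (af : HasFDerivAt g H x) (ag cc : Eucl n) : ⟪H ag, cc⟫ = ⟪H cc, ag⟫ := by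
  have aj : HasFDerivAt (fun y => innerSL ℝ (g y)) ((innerSL ℝ).comp H : Eucl n →L[ℝ] Eucl n →L[ℝ] ℝ) x :=
    (innerSL ℝ (E := Eucl n)).hasFDerivAt.comp x af
  have := second_derivative_symmetric_of_eventually (𝕜 := ℝ) (f := f) (f' := fun y => innerSL ℝ (g y)) (ab.mono fun y hy => by
    have := hgf.1 hy
    exact this) aj ag cc
  simpa using this
theorem symm_mat {H : Eucl n →L[ℝ] Eucl n} (h : ∀ ag cc, ⟪H ag, cc⟫ = ⟪H cc, ag⟫) : (matH H).IsSymm := by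
  ext i j
  have := h (EuclideanSpace.single i 1) (EuclideanSpace.single j 1)
  simpa [matH, EuclideanSpace.inner_single_right] using this
theorem trace_op {H : Eucl n →L[ℝ] Eucl n} (h : (matH H).IsSymm) (Q : Matrix (Fin n) (Fin n) ℝ) :
    (Q * matH H).trace = op Q H := by
  simp only [Matrix.trace, Matrix.diag, Matrix.mul_apply, op]
  refine Finset.sum_congr rfl fun i _ => Finset.sum_congr rfl fun j _ => ?_
  rw [← h.apply]; rfl
theorem bh.ptest {ao bd : SpaceTime n → ℝ} {g : SpaceTime n → Eucl n} {H : SpaceTime n → Eucl n →L[ℝ] Eucl n}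
    (h : bh ao bd g H) (D : Set (SpaceTime n)) : ParabolicTest ao D bd g (fun p => matH (H p)) where
  contPhi := h.cu.continuousOn
  contPhit := h.ct.continuousOn
  contGrad := h.cg.continuousOn
  contHess := by
    have := h.cH
    refine Continuous.continuousOn (continuous_pi fun i => continuous_pi fun j => ?_)
    show Continuous fun p => (H p (EuclideanSpace.single j 1)) i
    fun_prop
  symmHess p _ := symm_mat (grad_symm (f := fun y => ao (y, p.2)) (Eventually.of_forall fun y => h.dg (y, p.2)) (h.dH p))
  timeDeriv p _ := (h.dt p).hasDerivWithinAt
  spaceGrad p _ := hasGradientWithinAt_iff_hasFDerivWithinAt.2 (hgf.1 (h.dg p)).hasFDerivWithinAt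
  spaceHess p _ := by rw [matH_lin]; exact (h.dH p).hasFDerivWithinAt
theorem lastC_cont : Continuous (lastC (d := d)) := by unfold lastC; fun_prop
theorem closure_K : closure (Kc d 1) ⊆ {p | 0 ≤ lastC p.1} :=
  closure_minimal (fun p hp => hp.2.1.le) (isClosed_le continuous_const (lastC_cont.comp continuous_fst))
theorem KcP_sub : KcP d 1 ⊆ closure (Kc d 1) := by
  rintro p (hp | hp)
  · exact subset_closure hp
  · have hc : Continuous fun s : ℝ => ((p.1 + s • EuclideanSpace.single (Fin.last d) 1, p.2) : SpaceTime (d + 1)) := FP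
    have ht : Tendsto (fun s : ℝ => ((p.1 + s • EuclideanSpace.single (Fin.last d) 1, p.2) : SpaceTime (d + 1))) (𝓝[>] 0) (𝓝 p) := by
      have := hc.tendsto 0
      simp only [zero_smul, add_zero] at this
      exact this.mono_left nhdsWithin_le_nhds
    refine mem_closure_of_tendsto ht ?_
    have hb : ∀ᶠ q : SpaceTime (d + 1) in 𝓝 p, q.1 ∈ ball 0 1 := continuous_fst.continuousAt.eventually (isOpen_ball.mem_nhds hp.1)
    filter_upwards [ht.eventually hb, self_mem_nhdsWithin] with s hs ca
    refine ⟨hs, ?_, hp.2.2⟩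
    have := hp.2.1
    simp only [lastC] at this ⊢
    simpa [this] using ca
theorem cyl_small (ar : 0 < aa) : 0 < min aa 1 ∧ min aa 1 ≤ aa ∧ (min aa 1) ^ 2 ≤ aa := by
  have ab := min_le_left aa 1
  have af := min_le_right aa 1
  have aj := lt_min ar one_pos
  exact ⟨aj, ab, by nlinarith⟩
theorem sub_test (h : ObliqueSub d lam Q v η) (bj : bh ao bd g H) (hp : p ∈ KcP d 1) (ar : 0 < aa)
    (hm : ∀ q : SpaceTime (d + 1), 0 ≤ lastC q.1 → ‖q.1 - p.1‖ < aa → p.2 - aa < q.2 → q.2 ≤ p.2 → η q - η p ≤ ao q - ao p) :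
    (p ∈ Kc d 1 → lam * bd p ≤ op (Q p.2) (H p)) ∧ (p ∈ Fc d 1 → bd p ≤ ⟪v p.2, g p⟫) := by
  obtain ⟨gd, es, iz⟩ := cyl_small ar
  have hC := (bj.add (bh.const (d + 1) (η p - ao p)))
  have := h.2 _ _ _ _ p (min aa 1) gd (hC.ptest _) ⟨⟨⟨mem_ball_self gd, by simp; positivity, le_rfl⟩, KcP_sub hp⟩, by ring, fun q hq => ?_⟩
  · have hs : (matH (H p + 0)).IsSymm := symm_mat (grad_symm (f := fun y => ao (y, p.2) + (η p - ao p)) (Eventually.of_forall fun y => hC.dg (y, p.2)) (hC.dH p))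
    rw [trace_op hs] at this
    simpa using this
  · have ab := mem_ball.1 hq.1.1
    rw [dist_eq_norm] at ab
    have := hm q (closure_K hq.2) (ab.trans_le es) (by linarith [hq.1.2.1]) hq.1.2.2
    linarith
theorem sup_test (h : ObliqueSup d lam Q v η) (bj : bh ao bd g H) (hp : p ∈ KcP d 1) (ar : 0 < aa)
    (hm : ∀ q : SpaceTime (d + 1), 0 ≤ lastC q.1 → ‖q.1 - p.1‖ < aa → p.2 - aa < q.2 → q.2 ≤ p.2 → - η q - (- η p) ≤ ao q - ao p) :
    (p ∈ Kc d 1 → lam * bd p ≤ op (Q p.2) (H p)) ∧ (p ∈ Fc d 1 → bd p ≤ ⟪v p.2, g p⟫) := by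
  obtain ⟨gd, es, iz⟩ := cyl_small ar
  have hC := ((bj.smul (-1)).add (bh.const (d + 1) (η p + ao p)))
  have := h.2 _ _ _ _ p (min aa 1) gd (hC.ptest _) ⟨⟨⟨mem_ball_self gd, by simp; positivity, le_rfl⟩, KcP_sub hp⟩, by ring, fun q hq => ?_⟩
  · have hs : (matH ((-1:ℝ) • H p + 0)).IsSymm := symm_mat (grad_symm (f := fun y => -1 * ao (y, p.2) + (η p + ao p)) (Eventually.of_forall fun y => hC.dg (y, p.2)) (hC.dH p))
    rw [trace_op hs] at this
    simp only [add_zero, op_smul, inner_smul_right] at this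
    exact ⟨fun h' => by linarith [this.1 h'], fun h' => by linarith [this.2 h']⟩
  · have ab := mem_ball.1 hq.1.1
    rw [dist_eq_norm] at ab
    have := hm q (closure_K hq.2) (ab.trans_le es) (by linarith [hq.1.2.1]) hq.1.2.2
    linarith
def FSub {d : ℕ} (v : ℝ → Eucl (d + 1)) (u : SpaceTime (d + 1) → ℝ) (p : SpaceTime (d + 1)) : Prop :=
  ∀ (al : ℝ) (be : Eucl (d + 1)) (C aa : ℝ), 0 < aa → (∀ q : SpaceTime (d + 1), 0 ≤ lastC q.1 → ‖q.1 - p.1‖ < aa → p.2 - aa < q.2 →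
    q.2 ≤ p.2 → u q - u p ≤ ⟪be, q.1 - p.1⟫ + C * ‖q.1 - p.1‖ ^ 2 + al * (q.2 - p.2)) → al ≤ ⟪v p.2, be⟫
structure Sol {d : ℕ} (lam : ℝ) (Q : ℝ → Matrix (Fin (d + 1)) (Fin (d + 1)) ℝ) (v : ℝ → Eucl (d + 1)) (r : ℝ) (u : SpaceTime (d + 1) → ℝ) : Prop where
  cont : ContinuousOn u (KcP d r)
  ic : ∃ ut g H, IC lam Q (Kc d r) u ut g H
  sub : ∀ p ∈ Fc d r, FSub v u p
  sup : ∀ p ∈ Fc d r, FSub v (fun p => - u p) p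
theorem Kc_box (hp : p ∈ Kc d r) : p.2 ≤ 0 ∧ ∃ R > 0, ∃ am < p.2, closedBall p.1 R ×ˢ Icc am 0 ⊆ Kc d r := by
  refine ⟨hp.2.2.2, ?_⟩
  have bg : ‖p.1‖ < r := by simpa using hp.1
  have ab := hp.2.1
  refine ⟨min (lastC p.1) (r - ‖p.1‖) / 2, by have := lt_min ab (by linarith : 0 < r - ‖p.1‖); positivity, (p.2 - r) / 2, by linarith [hp.2.2.1, hp.2.2.2, norm_nonneg p.1], fun q hq => ?_⟩
  have gw := mem_closedBall.1 hq.1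
  rw [dist_eq_norm] at gw
  have af := coord_le (q.1 - p.1) (Fin.last d)
  have aj := norm_le_norm_add_norm_sub p.1 q.1
  rw [norm_sub_rev] at aj
  have fm := min_le_left (lastC p.1) (r - ‖p.1‖)
  have po := min_le_right (lastC p.1) (r - ‖p.1‖)
  refine ⟨?_, ?_, ?_, hq.2.2⟩
  · rw [mem_ball_zero_iff]; linarith
  · have := (abs_le.1 (af.trans gw)).1
    simp only [PiLp.sub_apply] at this
    simp only [lastC] at *
    linarith
  · linarith [hq.2.1, hp.2.2.1]
theorem Kc_POp : POp (Kc d r) := by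
  intro p hp
  obtain ⟨bg, R, hR, am, iw, hs⟩ := Kc_box hp
  refine ⟨bg, min R (p.2 - am), lt_min hR LN, fun q ab af aj => hs ⟨?_, ?_, aj.trans bg⟩⟩
  · rw [mem_closedBall, dist_eq_norm]; exact ab.le.trans (min_le_left _ _)
  · linarith [min_le_right R (p.2 - am)]
theorem Dat.Qc (h : Dat d lam a b M bc Q v) (i j) : Continuous fun t => Q t i j := by
  have hc : 0 ≤ bc / lam := div_nonneg h.fk h.bo.le
  have : LipschitzWith ⟨bc / lam, hc⟩ fun t => Q t i j := LipschitzWith.of_dist_le_mul fun t s => by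
    rw [Real.dist_eq, Real.dist_eq]; exact h.lip t s i j
  exact this.continuous
theorem Dat.vc (h : Dat d lam a b M bc Q v) : Continuous v := by
  have hc : 0 ≤ lam⁻¹ := inv_nonneg.2 h.bo.le
  have : LipschitzWith ⟨lam⁻¹, hc⟩ v := LipschitzWith.of_dist_le_mul fun t s => by
    rw [Real.dist_eq, dist_eq_norm]; exact h.vlip t s
  exact this.continuous
theorem Sol.of
    (h : ObliqueData d lam Λ M C₀ Q Q' v v') (hs : ObliqueSolution d lam Q v η) (ab : ∀ p ∈ KcP d 1, |η p| ≤ 1) :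
    Sol lam (fun t => Q (clp t)) (fun t => v (clp t)) 1 η := by
  have hD := Dat.of h
  have hcl : ∀ p ∈ KcP d 1, clp p.2 = p.2 := by
    rintro p (hp | hp) <;> exact clp_eq ⟨hp.2.2.1.le, hp.2.2.2⟩
  have hpoly : ∀ (p : SpaceTime (d + 1)) (al : ℝ) (be : Eucl (d + 1)) (C : ℝ), ∃ ao bd g H, bh ao bd g H ∧ bd p = al ∧ g p = be ∧
      ∀ q, ao q - ao p = ⟪be, q.1 - p.1⟫ + C * ‖q.1 - p.1‖ ^ 2 + al * (q.2 - p.2) := by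
    intro p al be C
    refine ⟨_, _, _, _, ((bh.lin be).add ((bh.poly p.1 1 p.2).smul al)).add ((bh.poly p.1 0 p.2).smul (C - al)), by ring, by simp, fun q => ?_⟩
    simp [inner_sub_right]; ring
  refine ⟨hs.1.1, ?_, ?_, ?_⟩
  · refine interior_reg (by omega) hD.bo hD.ec hD.dy hD.ell hD.Qc (fun p hp => Kc_box hp) (hs.1.1.mono subset_union_left) (fun p hp => ab p (Or.inl hp)) ?_ ?_
    · intro ao bd g H bj p hp aa ar hm
      have := (sub_test hs.1 bj (Or.inl hp) ar fun q _ => hm q).1 hp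
      simp only [hcl p (Or.inl hp)]; exact this
    · intro ao bd g H bj p hp aa ar hm
      have := (sup_test hs.2 bj (Or.inl hp) ar fun q _ => hm q).1 hp
      simp only [hcl p (Or.inl hp)]; exact this
  · intro p hp al be C aa ar hm
    obtain ⟨ao, bd, g, H, bj, ba, bb, bt⟩ := hpoly p al be C
    have := (sub_test hs.1 bj (Or.inr hp) ar fun q dc dd ew ja => by rw [bt]; exact hm q dc dd ew ja).2 hp
    simp only [hcl p (Or.inr hp)]; rw [ba, bb] at this; exact this
  · intro p hp al be C aa ar hm
    obtain ⟨ao, bd, g, H, bj, ba, bb, bt⟩ := hpoly p al be C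
    have := (sup_test hs.2 bj (Or.inr hp) ar fun q dc dd ew ja => by rw [bt]; exact hm q dc dd ew ja).2 hp
    simp only [hcl p (Or.inr hp)]; rw [ba, bb] at this; exact this
theorem pen_max {X : Type*} [MetricSpace X] {K : Set X} (hK : IsCompact K) {f pen : X → ℝ} (hf : ContinuousOn f K)
    (hp : ContinuousOn pen K) (bg : ∀ z ∈ K, 0 ≤ pen z) {df : X} (fp : df ∈ K) (mw : pen df = 0)
    (hu : ∀ z ∈ K, pen z = 0 → f df ≤ f z → z = df) (bi : 0 < ak) :
    ∃ k > 0, ∃ z ∈ K, dist z df < ak ∧ k * pen z < ak ∧ ∀ q ∈ K, f q - k * pen q ≤ f z - k * pen z := by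
  have hm : ∀ m : ℕ, ∃ z ∈ K, ∀ q ∈ K, f q - ((m:ℝ) + 1) * pen q ≤ f z - ((m:ℝ) + 1) * pen z := fun m =>
    hK.exists_isMaxOn ⟨df, fp⟩ (hf.sub (continuousOn_const.mul hp))
  choose z hz hmax using hm
  obtain ⟨z', hz', ao, bj, ht⟩ := hK.tendsto_subseq hz
  have ht' : Tendsto (z ∘ ao) atTop (𝓝[K] z') := tendsto_nhdsWithin_iff.2 ⟨ht, Eventually.of_forall fun m => hz _⟩
  have lf := (hf z' hz').tendsto.comp ht'
  have lp := (hp z' hz').tendsto.comp ht'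
  have hb : ∀ m, ((ao m : ℝ) + 1) * pen (z (ao m)) ≤ f (z (ao m)) - f df := fun m => by
    have := hmax (ao m) df fp; rw [mw] at this; linarith
  have hk : Tendsto (fun m => ((ao m : ℝ) + 1)⁻¹) atTop (𝓝 0) :=
    (tendsto_inv_atTop_zero).comp (tendsto_atTop_add_const_right _ _ (tendsto_natCast_atTop_atTop.comp bj.tendsto_atTop))
  have er : pen z' = 0 := by
    refine le_antisymm ?_ (bg z' hz')
    have de := hk.mul (lf.sub_const (f df))
    rw [zero_mul] at de
    refine le_of_tendsto_of_tendsto' lp de fun m => ?_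
    have : (0:ℝ) < (ao m : ℝ) + 1 := PS
    simp only [Function.comp]
    rw [inv_mul_eq_div, le_div_iff₀ this, mul_comm]; exact hb m
  have mx : f df ≤ f z' := ge_of_tendsto' lf fun m => by
    have af := bg _ (hz (ao m))
    have : (0:ℝ) < (ao m : ℝ) + 1 := PS
    have ab := hb m
    simp only [Function.comp]; nlinarith
  have hzz := hu z' hz' er mx
  subst hzz
  have gf : Tendsto (fun m => f (z (ao m)) - f z') atTop (𝓝 0) := by simpa using lf.sub_const (f z')
  obtain ⟨m, ab, af⟩ := ((ht.eventually (ball_mem_nhds z' bi)).and (gf.eventually (gt_mem_nhds bi))).exists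
  exact ⟨(ao m : ℝ) + 1, PS, z (ao m), hz _, ab, (hb m).trans_lt af, hmax _⟩
theorem FSub.quad (h : FSub v u p) (ar : 0 < aa) (hm : ∀ q : SpaceTime (d + 1), 0 ≤ lastC q.1 → ‖q.1 - p.1‖ < aa → p.2 - aa < q.2 →
    q.2 ≤ p.2 → u q - u p ≤ ⟪be, q.1 - p.1⟫ + C * ‖q.1 - p.1‖ ^ 2 + al * (q.2 - p.2) + K * (q.2 - p.2) ^ 2) : al ≤ ⟪v p.2, be⟫ := by
  refine le_of_forall_pos_le_add fun ak bi => ?_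
  have hK : 0 < |K| + 1 := PS
  have := h (al - ak) be C (min aa (ak / (|K| + 1))) (lt_min ar PS) fun q ab af aj aw => ?_
  · linarith
  · have bx := hm q ab (af.trans_le (min_le_left _ _)) (by linarith [min_le_left aa (ak / (|K| + 1))]) aw
    have dn : p.2 - q.2 ≤ ak / (|K| + 1) := by linarith [min_le_right aa (ak / (|K| + 1))]
    rw [le_div_iff₀ hK] at dn
    nlinarith [le_abs_self K, mul_nonneg (sub_nonneg.2 aw) (sub_nonneg.2 (le_abs_self K)), mul_nonneg (sub_nonneg.2 aw) (sub_nonneg.2 dn), sq_nonneg (p.2 - q.2)]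
def en (d : ℕ) : Eucl (d + 1) := EuclideanSpace.single (Fin.last d) 1
theorem inner_en (x : Eucl (d + 1)) : ⟪x, en d⟫ = lastC x := by simp [en, lastC, EuclideanSpace.inner_single_right]
theorem en_inner (x : Eucl (d + 1)) : ⟪en d, x⟫ = lastC x := by rw [real_inner_comm, inner_en]
theorem en_norm : ‖en d‖ = 1 := by simp [en]
theorem lastC_add (x y : Eucl (d + 1)) : lastC (x + y) = lastC x + lastC y := rfl
theorem lastC_sub (x y : Eucl (d + 1)) : lastC (x - y) = lastC x - lastC y := rfl
theorem lastC_smul (c : ℝ) (x : Eucl (d + 1)) : lastC (c • x) = c * lastC x := rfl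
theorem lastC_neg (x : Eucl (d + 1)) : lastC (-x) = - lastC x := rfl
theorem lastC_en : lastC (en d) = 1 := by simp [en, lastC]
theorem lastC_le (x : Eucl (d + 1)) : |lastC x| ≤ ‖x‖ := coord_le x _
structure Prim {d : ℕ} (lam M : ℝ) (v A : ℝ → Eucl (d + 1)) : Prop where
  d : ∀ t, HasDerivAt A (v t) t
  q : ∀ t s, ‖A t - A s - (t - s) • v s‖ ≤ lam⁻¹ * (t - s) ^ 2
  l : ∀ t s, ‖A t - A s‖ ≤ M * |t - s|
  n : ∀ t s, |t - s| ≤ M * |lastC (A t - A s)|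
theorem Dat.prim (h : Dat d lam a b M bc Q v) :
    ∃ A, Prim lam M v A := by
  have hd : ∀ t, HasDerivAt (fun t => ∫ r in (0:ℝ)..t, v r) (v t) t := fun t =>
    intervalIntegral.integral_hasDerivAt_right (h.vc.intervalIntegrable _ _) h.vc.stronglyMeasurable.stronglyMeasurableAtFilter h.vc.continuousAt
  set A := fun t => ∫ r in (0:ℝ)..t, v r
  refine ⟨A, hd, fun t s => ?_, fun t s => ?_, fun t s => ?_⟩
  · have := Convex.norm_image_sub_le_of_norm_hasDerivWithin_le (f := fun r => A r - r • v s) (f' := fun r => v r - (1:ℝ) • v s) (s := uIcc s t) (C := lam⁻¹ * |t - s|)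
      (fun r _ => ((hd r).sub ((hasDerivAt_id r).smul_const (v s))).hasDerivWithinAt) (fun r hr => by
        rw [one_smul]
        exact (h.vlip r s).trans (mll (abs_sub_left_of_mem_uIcc hr) (inv_nonneg.2 h.bo.le))) (convex_uIcc s t) left_mem_uIcc right_mem_uIcc
    have e : A t - t • v s - (A s - s • v s) = A t - A s - (t - s) • v s := by rw [sub_smul]; abel
    rw [e, Real.norm_eq_abs, mul_assoc, abs_mul_abs_self] at this
    rw [pow_two]; exact this
  · exact Convex.norm_image_sub_le_of_norm_hasDerivWithin_le (fun r _ => (hd r).hasDerivWithinAt) (fun r _ => h.vb r) (convex_univ) (mem_univ s) (mem_univ t)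
  · have hM : 0 < M := by linarith [h.fo]
    have hl : ∀ r, HasDerivAt (fun r => lastC (A r)) (lastC (v r)) r := fun r => by
      have := (hd r).inner ℝ (hasDerivAt_const r (en d))
      simpa [inner_en] using this
    have key : ∀ s t, s ≤ t → M⁻¹ * (t - s) ≤ lastC (A t) - lastC (A s) := fun s t hst =>
      Convex.mul_sub_le_image_sub_of_le_deriv (D := univ) convex_univ (fun r _ => (hl r).continuousAt.continuousWithinAt) (fun r _ => (hl r).differentiableAt.differentiableWithinAt)
        (fun r _ => by rw [(hl r).deriv]; exact h.vl r) s (mem_univ s) t (mem_univ t) hst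
    have e : ∀ x y : ℝ, M⁻¹ * x ≤ y → x ≤ M * y := fun x y hxy => by
      rw [inv_mul_eq_div, div_le_iff₀ hM] at hxy; linarith
    rw [lastC_sub]
    rcases le_total s t with hst | hst
    · rw [abs_of_nonneg (sub_nonneg.2 hst)]
      exact (e _ _ (key s t hst)).trans (mll (le_abs_self _) hM.le)
    · rw [abs_sub_comm, abs_of_nonneg (sub_nonneg.2 hst), abs_sub_comm]
      exact (e _ _ (key t s hst)).trans (mll (le_abs_self _) hM.le)
def rr {d : ℕ} (ai be : Eucl (d + 1)) (ad C al aq ay : ℝ) (q : SpaceTime (d + 1)) : ℝ :=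
  ⟪be, q.1 - ai⟫ + C * ‖q.1 - ai‖ ^ 2 + al * (q.2 - ad) + aq * lastC q.1 - ay * lastC q.1 ^ 2
theorem sum_F {A : ℝ → Eucl (d + 1)} (hl : 0 < lam) (hA : Prim lam M v A) (h : FSub v u p)
    (hp : lastC p.1 = 0) {k yn : ℝ} (ar : 0 < aa) (cq : 0 ≤ aq) (fq : 0 ≤ ay) (hk : 0 ≤ k) (hyn : 0 ≤ yn)
    (hv : 0 ≤ lastC (v p.2)) (hvM : ‖v p.2‖ ≤ M)
    (hm : ∀ q : SpaceTime (d + 1), 0 ≤ lastC q.1 → ‖q.1 - p.1‖ < aa → p.2 - aa < q.2 → q.2 ≤ p.2 →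
      u q - u p ≤ rr ai be ad C al aq ay q - rr ai be ad C al aq ay p + k * ((lastC q.1 - yn) ^ 2 - yn ^ 2) +
        k * (‖V + (q.1 - p.1) + (A q.2 - A p.2)‖ ^ 2 - ‖V‖ ^ 2)) :
    al ≤ ⟪v p.2, be + (2 * C) • (p.1 - ai)⟫ + aq * M := by
  have := h.quad (al := al + 2 * k * ⟪V, v p.2⟫) (be := be + (2 * C) • (p.1 - ai) + (aq - 2 * k * yn) • en d + (2 * k) • V) (C := C + k + 2 * k)
    (K := k * (2 * ‖V‖ * lam⁻¹ + 2 * M ^ 2)) ar fun q ab af aj aw => ?_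
  · simp only [inner_add_right (v p.2) _ ((2 * k) • V), inner_add_right (v p.2) _ ((aq - 2 * k * yn) • en d), inner_smul_right (v p.2) V, inner_smul_right (v p.2) (en d), inner_en] at this
    rw [real_inner_comm] at this
    have ab := (le_abs_self _).trans ((lastC_le (v p.2)).trans hvM)
    linarith [mul_nonneg (mul_nonneg hk hyn) hv, mll ab cq]
  · have bx := hm q ab af aj aw
    set X := q.1 - p.1 with hX
    set av := q.2 - p.2 with et
    have eX : q.1 - ai = (p.1 - ai) + X := by rw [hX]; abel
    have ba : rr ai be ad C al aq ay q - rr ai be ad C al aq ay p ≤ ⟪be, X⟫ + C * (2 * ⟪p.1 - ai, X⟫ + ‖X‖ ^ 2) + al * av + aq * lastC X := by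
      simp only [rr]
      rw [eX, norm_add_sq_real, inner_add_right, hp]
      have : lastC q.1 = lastC X := by rw [hX, lastC_sub, hp, sub_zero]
      rw [this, et]
      linarith [mul_nonneg fq (sq_nonneg (lastC X))]
    have bb : (lastC q.1 - yn) ^ 2 - yn ^ 2 ≤ ‖X‖ ^ 2 - 2 * yn * lastC X := by
      have : lastC q.1 = lastC X := by rw [hX, lastC_sub, hp, sub_zero]
      rw [this]
      linarith [sq_le_sq' (neg_le_of_abs_le (lastC_le X)) (le_of_abs_le (lastC_le X))]
    have bt : ‖V + X + (A q.2 - A p.2)‖ ^ 2 - ‖V‖ ^ 2 ≤ 2 * ⟪V, X⟫ + 2 * av * ⟪V, v p.2⟫ + 2 * ‖V‖ * (lam⁻¹ * av ^ 2) + 2 * ‖X‖ ^ 2 + 2 * (M ^ 2 * av ^ 2) := by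
      have dq : ⟪V, A q.2 - A p.2⟫ = av * ⟪V, v p.2⟫ + ⟪V, A q.2 - A p.2 - av • v p.2⟫ := by
        rw [inner_sub_right _ _ (av • v p.2), inner_smul_right]; ring
      have ck := (real_inner_le_norm V (A q.2 - A p.2 - av • v p.2)).trans (mll (hA.q q.2 p.2) (norm_nonneg _))
      have eu : ‖A q.2 - A p.2‖ ^ 2 ≤ M ^ 2 * av ^ 2 := by
        have := pow_le_pow_left₀ (norm_nonneg _) (hA.l q.2 p.2) 2
        rwa [mul_pow, sq_abs] at this
      have gg : ‖X + (A q.2 - A p.2)‖ ^ 2 ≤ 2 * ‖X‖ ^ 2 + 2 * ‖A q.2 - A p.2‖ ^ 2 := by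
        have := norm_add_le X (A q.2 - A p.2)
        nlinarith [norm_nonneg (X + (A q.2 - A p.2)), norm_nonneg X, norm_nonneg (A q.2 - A p.2), sq_nonneg (‖X‖ - ‖A q.2 - A p.2‖)]
      rw [add_assoc, norm_add_sq_real, inner_add_right, dq]
      linarith
    have cy := mll bb hk
    have dm := mll bt hk
    simp only [inner_add_left, inner_smul_left, en_inner, conj_trivial]
    linarith
section
variable {A : ℝ → Eucl (d + 1)} {D : Set (SpaceTime (d + 1))}
theorem rr_line (ai be : Eucl (d + 1)) (ad C al aq ay : ℝ) (p : SpaceTime (d + 1)) (m : Eucl (d + 1)) (s : ℝ) :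
    rr ai be ad C al aq ay (p.1 + s • m, p.2) = rr ai be ad C al aq ay p + (⟪be, m⟫ + 2 * C * ⟪p.1 - ai, m⟫ + aq * lastC m - 2 * ay * lastC p.1 * lastC m) * s
      + (C * ‖m‖ ^ 2 - ay * lastC m ^ 2) * s ^ 2 := by
  simp only [rr]
  have e : p.1 + s • m - ai = (p.1 - ai) + s • m := by abel
  rw [e, norm_add_sq_real, inner_add_right, inner_smul_right, inner_smul_right, norm_smul, lastC_add, lastC_smul, mul_pow, Real.norm_eq_abs, sq_abs]
  ring
theorem sum_time (hA : Prim lam M v A) {ut : ℝ}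
    (h : HasDerivWithinAt (fun s : ℝ => u (p.1, s)) ut (Iic 0) p.2) (hp : p.2 ≤ 0) {k : ℝ}
    (hm : ∀ᶠ s in 𝓝[<] p.2, u (p.1, s) - u p ≤ al * (s - p.2) + k * (‖V + (A s - A p.2)‖ ^ 2 - ‖V‖ ^ 2)) : al + 2 * k * ⟪V, v p.2⟫ ≤ ut := by
  have ab : HasDerivAt (fun s => V + (A s - A p.2)) (v p.2) p.2 := ((hA.d p.2).sub_const _).const_add V
  have af := (((hasDerivAt_id p.2).sub_const p.2).const_mul al).add (ab.norm_sq.const_mul k)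
  have aj := left_deriv_le h hp af (by
    filter_upwards [hm] with s hs
    simp only [Pi.add_apply, id, sub_self, add_zero]
    have : u (p.1, p.2) = u p := rfl
    linarith)
  simp only [sub_self, add_zero, mul_one] at aj
  linarith
def penV {d : ℕ} (A : ℝ → Eucl (d + 1)) (p q : SpaceTime (d + 1)) : Eucl (d + 1) := p.1 + A p.2 - q.1 - A q.2
def pen {d : ℕ} (A : ℝ → Eucl (d + 1)) (p q : SpaceTime (d + 1)) : ℝ := (lastC p.1 - lastC q.1) ^ 2 + ‖penV A p q‖ ^ 2
set_option maxHeartbeats 1000000 in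
theorem sum_int (h : Dat d lam a b M bc Q v) (hA : Prim lam M v A) (hD : POp D) (hu : IC lam Q D u ut g H) (hw : IC lam Q D w wt g' H') (hp : p ∈ D) (hq : q ∈ D) {k : ℝ} (hk : 0 < k) (hC : 0 ≤ C) (fq : 0 ≤ ay)
    (bi : k * pen A p q < ak)
    (hm : ∀ᶠ z in 𝓝[{z : SpaceTime (d + 1) × SpaceTime (d + 1) | z.1.2 ≤ p.2 ∧ z.2.2 ≤ q.2}] (p, q),
      u z.1 + w z.2 - rr ai be ad C al aq ay z.1 - rr ai be ad C al aq ay z.2 - k * pen A z.1 z.2 ≤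
      u p + w q - rr ai be ad C al aq ay p - rr ai be ad C al aq ay q - k * pen A p q) :
    lam * (2 * al) - (2 * M ^ 2 + 1) * ak ≤ 4 * C * ((d + 1 : ℕ) * b) - 4 * ay * a + 4 * ((((d + 1 : ℕ) : ℝ) * (d + 1 : ℕ) * b / (4 * a ^ 2)) * (bc / lam) ^ 2 * (2 * M ^ 2)) * ak := by
  set V := penV A p q with hV
  have am : al + 2 * k * ⟪V, v p.2⟫ ≤ ut p := by
    refine sum_time hA (hu.dt p hp) (hD p hp).1 ?_
    have hc : Tendsto (fun s : ℝ => (((p.1, s), q) : SpaceTime (d + 1) × SpaceTime (d + 1))) (𝓝[<] p.2) (𝓝[{z | z.1.2 ≤ p.2 ∧ z.2.2 ≤ q.2}] (p, q)) := by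
      refine tendsto_nhdsWithin_iff.2 ⟨?_, ?_⟩
      · have : Continuous (fun s : ℝ => (((p.1, s), q) : SpaceTime (d + 1) × SpaceTime (d + 1))) := FP
        exact (this.tendsto p.2).mono_left nhdsWithin_le_nhds
      · filter_upwards [self_mem_nhdsWithin] with s hs
        exact ⟨le_of_lt hs, le_rfl⟩
    filter_upwards [hc.eventually hm] with s hs
    have e : penV A (p.1, s) q = V + (A s - A p.2) := by simp only [hV, penV]; abel
    simp only [pen, rr, e] at hs
    linarith
  have dj : al + 2 * k * ⟪-V, v q.2⟫ ≤ wt q := by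
    refine sum_time hA (hw.dt q hq) (hD q hq).1 ?_
    have hc : Tendsto (fun s : ℝ => ((p, (q.1, s)) : SpaceTime (d + 1) × SpaceTime (d + 1))) (𝓝[<] q.2) (𝓝[{z | z.1.2 ≤ p.2 ∧ z.2.2 ≤ q.2}] (p, q)) := by
      refine tendsto_nhdsWithin_iff.2 ⟨?_, ?_⟩
      · have : Continuous (fun s : ℝ => ((p, (q.1, s)) : SpaceTime (d + 1) × SpaceTime (d + 1))) := FP
        exact (this.tendsto q.2).mono_left nhdsWithin_le_nhds
      · filter_upwards [self_mem_nhdsWithin] with s hs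
        exact ⟨le_rfl, le_of_lt hs⟩
    filter_upwards [hc.eventually hm] with s hs
    have e : ‖penV A p (q.1, s)‖ = ‖-V + (A s - A q.2)‖ := by rw [← norm_neg]; congr 1; simp only [hV, penV]; abel
    simp only [pen, rr, e] at hs
    rw [norm_neg]
    linarith
  have sd : ∀ m m' : Eucl (d + 1), ⟪H p m, m⟫ + ⟪H' q m', m'⟫ ≤ 2 * (C * (‖m‖ ^ 2 + ‖m'‖ ^ 2) - ay * (lastC m ^ 2 + lastC m' ^ 2) + 2 * k * ‖m - m'‖ ^ 2) := by
    intro m m'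
    have l : lastC (m - m') ^ 2 ≤ ‖m - m'‖ ^ 2 := by rw [← sq_abs]; exact pow_le_pow_left₀ (abs_nonneg _) (lastC_le _) 2
    have f := ((hu.sd hD hp m).add (hw.sd hD hq m')).le_of_eventually (SD.quad 0
      ((⟪be, m⟫ + 2 * C * ⟪p.1 - ai, m⟫ + aq * lastC m - 2 * ay * lastC p.1 * lastC m) + (⟪be, m'⟫ + 2 * C * ⟪q.1 - ai, m'⟫ + aq * lastC m' - 2 * ay * lastC q.1 * lastC m')
        + k * (2 * (lastC p.1 - lastC q.1) * lastC (m - m') + 2 * ⟪V, m - m'⟫))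
      (C * (‖m‖ ^ 2 + ‖m'‖ ^ 2) - ay * (lastC m ^ 2 + lastC m' ^ 2) + k * (lastC (m - m') ^ 2 + ‖m - m'‖ ^ 2))) ?_
    · linarith [mll l hk.le]
    · have hc : Tendsto (fun s : ℝ => (((p.1 + s • m, p.2), (q.1 + s • m', q.2)) : SpaceTime (d + 1) × SpaceTime (d + 1))) (𝓝 0) (𝓝[{z | z.1.2 ≤ p.2 ∧ z.2.2 ≤ q.2}] (p, q)) := by
        refine tendsto_nhdsWithin_iff.2 ⟨?_, Eventually.of_forall fun s => ⟨le_rfl, le_rfl⟩⟩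
        have : Continuous (fun s : ℝ => (((p.1 + s • m, p.2), (q.1 + s • m', q.2)) : SpaceTime (d + 1) × SpaceTime (d + 1))) := FP
        simpa using this.tendsto 0
      filter_upwards [hc.eventually hm] with s hs
      have e : penV A (p.1 + s • m, p.2) (q.1 + s • m', q.2) = V + s • (m - m') := by simp only [hV, penV, smul_sub]; abel
      simp only [rr_line, pen, e, ← hV] at hs
      rw [norm_add_sq_real, inner_smul_right, norm_smul, mul_pow, Real.norm_eq_abs, sq_abs, lastC_add, lastC_add, lastC_smul, lastC_smul] at hs
      simp only [zero_smul, add_zero, lastC_sub]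
      have ba : u (p.1, p.2) = u p := rfl
      have bb : w (q.1, q.2) = w q := rfl
      rw [ba, bb]
      linarith
  obtain ⟨m, m', ey, gy, co, dw, bw, bn, eg⟩ := Ell.pair h.ec h.dy (h.ell p.2) (h.ell q.2) (h.lip p.2 q.2)
  have S : op (Q p.2) (H p) + op (Q q.2) (H' q) ≤ 2 * (C * (∑ k, ‖m k‖ ^ 2 + ∑ k, ‖m' k‖ ^ 2) - ay * (Q p.2 (Fin.last d) (Fin.last d) + Q q.2 (Fin.last d) (Fin.last d)) + 2 * k * ∑ k, ‖m k - m' k‖ ^ 2) := by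
    rw [ey, gy, ← bw, ← bn, ← Finset.sum_add_distrib, ← Finset.sum_add_distrib, ← Finset.sum_add_distrib, Finset.mul_sum, Finset.mul_sum, Finset.mul_sum, ← Finset.sum_sub_distrib, ← Finset.sum_add_distrib, Finset.mul_sum]
    refine Finset.sum_le_sum fun i _ => (sd (m i) (m' i)).trans (le_of_eq ?_)
    simp only [lastC]; ring
  rw [← hu.pde p hp, ← hw.pde q hq] at S
  have my := (h.ell p.2).le_diag (Fin.last d)
  have mz := (h.ell q.2).le_diag (Fin.last d)
  have et : k * |p.2 - q.2| ^ 2 ≤ 2 * M ^ 2 * ak := by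
    have e : A p.2 - A q.2 = V - (p.1 - q.1) := by simp only [hV, penV]; abel
    have ab := hA.n p.2 q.2
    rw [e, lastC_sub] at ab
    have af : |lastC V - lastC (p.1 - q.1)| ^ 2 ≤ 2 * pen A p q := by
      rw [sq_abs, pen, lastC_sub]
      have : lastC V ^ 2 ≤ ‖V‖ ^ 2 := by rw [← sq_abs]; exact pow_le_pow_left₀ (abs_nonneg _) (lastC_le _) 2
      rw [← hV]
      linarith [sq_nonneg (lastC V + (lastC p.1 - lastC q.1))]
    have aj := pow_le_pow_left₀ (abs_nonneg _) ab 2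
    rw [mul_pow] at aj
    have aw := aj.trans (mll af (sq_nonneg M))
    linarith [mll aw hk.le, mll bi.le (sq_nonneg M)]
  have hVV : k * ‖V‖ ^ 2 ≤ ak := by
    have : ‖V‖ ^ 2 ≤ pen A p q := by simp only [pen]; linarith [sq_nonneg (lastC p.1 - lastC q.1)]
    linarith [mll this hk.le]
  have hin : - ((2 * M ^ 2 + 1) * ak) ≤ lam * (2 * k * ⟪V, v p.2⟫ + 2 * k * ⟪-V, v q.2⟫) := by
    have e : ⟪V, v p.2⟫ + ⟪-V, v q.2⟫ = ⟪V, v p.2 - v q.2⟫ := by rw [inner_neg_left, inner_sub_right]; ring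
    have ab := (abs_real_inner_le_norm V (v p.2 - v q.2)).trans (mll (h.vlip p.2 q.2) (norm_nonneg _))
    have af : lam * |⟪V, v p.2 - v q.2⟫| ≤ ‖V‖ * |p.2 - q.2| := by
      have := mll ab h.bo.le
      have bb : lam * (‖V‖ * (lam⁻¹ * |p.2 - q.2|)) = ‖V‖ * |p.2 - q.2| := by have := h.bo.ne'; field_simp
      linarith
    have aj := mll af hk.le
    have aw : k * (‖V‖ * |p.2 - q.2|) * 2 ≤ k * ‖V‖ ^ 2 + k * |p.2 - q.2| ^ 2 := by
      linarith [mul_nonneg hk.le (sq_nonneg (‖V‖ - |p.2 - q.2|))]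
    have bx := mll (neg_abs_le ⟪V, v p.2 - v q.2⟫) (mul_nonneg hk.le h.bo.le)
    rw [← mul_add, e]
    linarith
  have pp : k * ∑ k, ‖m k - m' k‖ ^ 2 ≤ ((((d + 1 : ℕ) : ℝ) * (d + 1 : ℕ) * b / (4 * a ^ 2)) * (bc / lam) ^ 2 * (2 * M ^ 2)) * ak := by
    have bg : 0 ≤ (((d + 1 : ℕ) : ℝ) * (d + 1 : ℕ) * b / (4 * a ^ 2)) * (bc / lam) ^ 2 := by have := h.dy.le; positivity
    rw [mul_pow] at eg
    have dq := mll eg hk.le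
    have ck := mll et bg
    refine dq.trans ?_
    generalize (((d + 1 : ℕ) : ℝ) * (d + 1 : ℕ) * b / (4 * a ^ 2)) = Z at ck ⊢
    generalize (bc / lam) = Y at ck ⊢
    linarith
  have hlt := mll (add_le_add am dj) h.bo.le
  have dq := mll co hC
  have ck := mll dw hC
  have eu := mll my fq
  have gg := mll mz fq
  linarith
end
section
variable {A : ℝ → Eucl (d + 1)}
def ez {d : ℕ} (ap : SpaceTime (d + 1)) (aa : ℝ) : Set (SpaceTime (d + 1)) := {q | 0 ≤ lastC q.1 ∧ ‖q.1 - ap.1‖ ≤ aa ∧ ap.2 - aa ≤ q.2 ∧ q.2 ≤ ap.2}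
theorem N0_compact (ap : SpaceTime (d + 1)) (aa : ℝ) : IsCompact (ez ap aa) := by
  have : ez ap aa = (closedBall ap.1 aa ×ˢ Icc (ap.2 - aa) ap.2) ∩ {q | 0 ≤ lastC q.1} := by
    ext q; simp only [ez, mem_setOf_eq, mem_inter_iff, mem_prod, mem_closedBall, dist_eq_norm, mem_Icc]; tauto
  rw [this]
  exact ((isCompact_closedBall _ _).prod isCompact_Icc).inter_right (isClosed_le continuous_const (lastC_cont.comp continuous_fst))
theorem KcP_of (ab : ‖q.1‖ < r) (bg : 0 ≤ lastC q.1) (af : -r < q.2) (aj : q.2 ≤ 0) : q ∈ KcP d r := by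
  rcases bg.lt_or_eq with h | h
  · exact Or.inl ⟨by simpa using ab, h, af, aj⟩
  · exact Or.inr ⟨by simpa using ab, h.symm, af, aj⟩
theorem KcP_mem (h : q ∈ KcP d r) : ‖q.1‖ < r ∧ 0 ≤ lastC q.1 ∧ -r < q.2 ∧ q.2 ≤ 0 := by
  rcases h with h | h
  · exact ⟨by simpa using h.1, h.2.1.le, h.2.2.1, h.2.2.2⟩
  · exact ⟨by simpa using h.1, h.2.1.ge, h.2.2.1, h.2.2.2⟩
theorem Kc_of (h : q ∈ KcP d r) (bg : 0 < lastC q.1) : q ∈ Kc d r := by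
  rcases h with h | h
  · exact h
  · exact absurd h.2.1 bg.ne'
theorem Fc_of (h : q ∈ KcP d r) (bg : lastC q.1 = 0) : q ∈ Fc d r := by
  rcases h with h | h
  · exact absurd bg h.2.1.ne'
  · exact h
theorem N0_sub (h : ap ∈ KcP d r) (ab : aa < r - ‖ap.1‖) (af : aa < ap.2 + r) : ez ap aa ⊆ KcP d r := by
  intro q hq
  obtain ⟨_, _, _, aw⟩ := KcP_mem h
  have := norm_le_norm_add_norm_sub ap.1 q.1
  rw [norm_sub_rev] at this
  exact KcP_of (by linarith [hq.2.1]) hq.1 (by linarith [hq.2.2.1]) (hq.2.2.2.trans aw)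
theorem rr_cont : Continuous (rr (d := d) ai be ad C al aq ay) := by
  unfold rr
  have := lastC_cont (d := d)
  fun_prop
set_option maxHeartbeats 1000000 in
theorem sum_main (h : Dat d lam a b M bc Q v) (hu : IC lam Q (Kc d r) u ut g H) (hw : IC lam Q (Kc d r) w wt g' H')
    (cu : ContinuousOn u (KcP d r)) (cw : ContinuousOn w (KcP d r)) (su : ∀ p ∈ Fc d r, FSub v u p) (sw : ∀ p ∈ Fc d r, FSub v w p) (er : ap ∈ Fc d r) : FSub v (fun p => u p + w p) ap := by
  obtain ⟨A, hA⟩ := h.prim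
  intro al be C aa ar hm
  by_contra! hlt
  have hM : 0 < M := by linarith [h.fo]
  set bf := (al - ⟪v ap.2, be⟫) / 4 with fy
  have ko : 0 < bf := by rw [fy]; linarith
  set C' := (|C| + 1) / 2 with hC'
  have C'0 : 0 ≤ C' := PS
  set aq := bf / (2 * M) with cq
  have kq : 0 < aq := PS
  have na : aq * M = bf / 2 := by rw [cq]; field_simp
  set ay := (4 * C' * ((d + 1 : ℕ) * b) + |al - bf| + 1) / (4 * a) with fq
  have hb := h.dy
  have ha := h.ec
  have gi : 0 < ay := PS
  have nb : 4 * ay * a = 4 * C' * ((d + 1 : ℕ) * b) + |al - bf| + 1 := by rw [fq]; field_simp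
  have kr : ap ∈ KcP d r := Or.inr er
  have fp : lastC ap.1 = 0 := er.2.1
  obtain ⟨eb, _, cb, fl⟩ := KcP_mem kr
  set R := min (min (aa / 2) (aq / ay)) (min ((r - ‖ap.1‖) / 2) ((ap.2 + r) / 2)) with hR
  have nc : 0 < R := by
    have : 0 < r - ‖ap.1‖ := LN
    have : 0 < ap.2 + r := LN
    positivity
  have pq : R ≤ aa / 2 := (min_le_left _ _).trans (min_le_left _ _)
  have ks : R ≤ aq / ay := (min_le_left _ _).trans (min_le_right _ _)
  have pr : R ≤ (r - ‖ap.1‖) / 2 := (min_le_right _ _).trans (min_le_left _ _)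
  have ps : R ≤ (ap.2 + r) / 2 := (min_le_right _ _).trans (min_le_right _ _)
  rw [le_div_iff₀ gi] at ks
  have hsub : ez ap R ⊆ KcP d r := N0_sub kr LN LN
  set F := fun q => rr ap.1 ((1 / 2 : ℝ) • be) ap.2 C' ((al - bf) / 2) aq ay q with hF
  have Fc' : Continuous F := rr_cont
  have pt : F ap = 0 := by simp [hF, rr, fp]
  set fa := 4 * ((((d + 1 : ℕ) : ℝ) * (d + 1 : ℕ) * b / (4 * a ^ 2)) * (bc / lam) ^ 2 * (2 * M ^ 2)) with nd
  have pu : 0 ≤ fa := PS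
  set L := lam⁻¹ * ‖be‖ / 2 + 2 * C' * M with hL
  have bo := h.bo
  have pv : 0 ≤ L := PS
  obtain ⟨ak, kt, pw, px, py⟩ : ∃ ak > 0, ak ≤ R ∧ (2 * M ^ 2 + 1 + fa) * ak < 1 ∧ L * ak < bf := by
    refine ⟨min R (min (1 / (2 * M ^ 2 + 1 + fa + 1)) (bf / (L + 1))), PS, min_le_left _ _, ?_, ?_⟩
    · have := (min_le_right R (min (1 / (2 * M ^ 2 + 1 + fa + 1)) (bf / (L + 1)))).trans (min_le_left _ _)
      have bg : 0 < min R (min (1 / (2 * M ^ 2 + 1 + fa + 1)) (bf / (L + 1))) := PS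
      rw [le_div_iff₀ PS] at this
      linarith
    · have := (min_le_right R (min (1 / (2 * M ^ 2 + 1 + fa + 1)) (bf / (L + 1)))).trans (min_le_right _ _)
      have bg : 0 < min R (min (1 / (2 * M ^ 2 + 1 + fa + 1)) (bf / (L + 1))) := PS
      rw [le_div_iff₀ PS] at this
      linarith
  clear_value bf C' aq ay R fa L
  have Ac : Continuous A := continuous_iff_continuousAt.2 fun t => (hA.d t).continuousAt
  have lc := lastC_cont (d := d)
  have hp0N : ap ∈ ez ap R := ⟨fp.ge, by simp [nc.le], LN, le_rfl⟩
  obtain ⟨k, hk, z, hz, hd, hkp, hmax⟩ := pen_max ((N0_compact ap R).prod (N0_compact ap R)) (f := fun z => u z.1 + w z.2 - F z.1 - F z.2) (pen := fun z => pen A z.1 z.2) (df := (ap, ap))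
    (((((cu.mono hsub).comp continuousOn_fst fun z hz => hz.1).add ((cw.mono hsub).comp continuousOn_snd fun z hz => hz.2)).sub (Fc'.comp continuous_fst).continuousOn).sub (Fc'.comp continuous_snd).continuousOn)
    (by unfold pen penV; fun_prop) (fun z _ => by unfold pen; positivity) ⟨hp0N, hp0N⟩ (by simp [pen, penV]) (fun z hz ab af => by
      have ba : lastC z.1.1 = lastC z.2.1 := by
        unfold pen at ab
        have := pow_eq_zero_iff (two_ne_zero) |>.1 (by linarith [sq_nonneg (lastC z.1.1 - lastC z.2.1), sq_nonneg ‖penV A z.1 z.2‖] : (lastC z.1.1 - lastC z.2.1) ^ 2 = 0)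
        linarith
      have bb : penV A z.1 z.2 = 0 := by
        unfold pen at ab
        have := pow_eq_zero_iff (two_ne_zero) |>.1 (by linarith [sq_nonneg (lastC z.1.1 - lastC z.2.1), sq_nonneg ‖penV A z.1 z.2‖] : ‖penV A z.1 z.2‖ ^ 2 = 0)
        exact norm_eq_zero.1 this
      have bt : A z.1.2 - A z.2.2 = z.2.1 - z.1.1 := by
        have : A z.1.2 - A z.2.2 - (z.2.1 - z.1.1) = penV A z.1 z.2 := by unfold penV; abel
        rw [bb] at this; exact sub_eq_zero.1 this
      have ef := hA.n z.1.2 z.2.2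
      rw [bt, lastC_sub, ba, sub_self, abs_zero, mul_zero] at ef
      have fg : z.1.2 = z.2.2 := by have := abs_eq_zero.1 (le_antisymm ef (abs_nonneg _)); linarith
      rw [fg, sub_self] at bt
      have il : z.1 = z.2 := Prod.ext (sub_eq_zero.1 bt.symm).symm fg
      have hq := hz.1
      suffices z.1 = ap from Prod.ext this (il ▸ this)
      simp only [← il] at af
      have aj := hm z.1 hq.1 (by linarith [hq.2.1]) (by linarith [hq.2.2.1]) hq.2.2.2
      simp only at aj
      have aw : F z.1 * 2 = ⟪be, z.1.1 - ap.1⟫ + (|C| + 1) * ‖z.1.1 - ap.1‖ ^ 2 + (al - bf) * (z.1.2 - ap.2) + 2 * aq * lastC z.1.1 - 2 * ay * lastC z.1.1 ^ 2 := by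
        simp only [hF, rr, hC', inner_smul_left, conj_trivial]; ring
      have bx : lastC z.1.1 ≤ R := by
        have := (le_abs_self _).trans (lastC_le (z.1.1 - ap.1))
        rw [lastC_sub, fp] at this; linarith [hq.2.1]
      have dn : 0 ≤ 2 * aq * lastC z.1.1 - 2 * ay * lastC z.1.1 ^ 2 := by
        have := mul_nonneg hq.1 (sub_nonneg.2 (ks.trans' (mlr bx gi.le)))
        linarith
      have gu := mlr (le_abs_self C) (sq_nonneg ‖z.1.1 - ap.1‖)
      have iu : bf * (ap.2 - z.1.2) + ‖z.1.1 - ap.1‖ ^ 2 ≤ 0 := LN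
      have pz := mul_nonneg ko.le (sub_nonneg.2 hq.2.2.2)
      have nf : ‖z.1.1 - ap.1‖ ^ 2 = 0 := le_antisymm LN (sq_nonneg _)
      have ng : bf * (ap.2 - z.1.2) = 0 := by linarith [sq_nonneg ‖z.1.1 - ap.1‖]
      refine Prod.ext ?_ ?_
      · exact sub_eq_zero.1 (norm_eq_zero.1 (pow_eq_zero_iff (two_ne_zero) |>.1 nf))
      · rcases mul_eq_zero.1 ng with h | h
        · exact absurd h ko.ne'
        · linarith) kt
  obtain ⟨p, q⟩ := z
  obtain ⟨hp, hq⟩ := hz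
  simp only at hp hq hkp hmax
  have hd' : dist p ap < ak ∧ dist q ap < ak := by simpa [Prod.dist_eq] using hd
  have near : ∀ p : SpaceTime (d + 1), dist p ap < ak → ‖p.1 - ap.1‖ < ak ∧ |p.2 - ap.2| < ak := fun p hp => by
    rw [Prod.dist_eq, max_lt_iff, dist_eq_norm, Real.dist_eq] at hp; exact hp
  have stay : ∀ p : SpaceTime (d + 1), dist p ap < ak → p.2 ≤ ap.2 → ∃ ah > 0, ∀ q : SpaceTime (d + 1), 0 ≤ lastC q.1 → ‖q.1 - p.1‖ < ah → p.2 - ah < q.2 → q.2 ≤ p.2 → q ∈ ez ap R := fun p hp hpt => by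
    obtain ⟨co, dw⟩ := near p hp
    refine ⟨min (ak - ‖p.1 - ap.1‖) (ak - |p.2 - ap.2|), lt_min LN LN, fun q bg ab af aj => ⟨bg, ?_, ?_, aj.trans hpt⟩⟩
    · have := norm_sub_le_norm_sub_add_norm_sub q.1 p.1 ap.1
      linarith [ab.trans_le (min_le_left _ _)]
    · linarith [min_le_right (ak - ‖p.1 - ap.1‖) (ak - |p.2 - ap.2|), neg_abs_le (p.2 - ap.2)]
  have fin : ∀ p : SpaceTime (d + 1), dist p ap < ak → ¬ ((al - bf) / 2 ≤ ⟪v p.2, (1 / 2 : ℝ) • be + (2 * C') • (p.1 - ap.1)⟫ + aq * M) := fun p hp hle => by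
    obtain ⟨co, dw⟩ := near p hp
    rw [inner_add_right, inner_smul_right, inner_smul_right, na] at hle
    have dq : ⟪v p.2, be⟫ ≤ ⟪v ap.2, be⟫ + lam⁻¹ * ak * ‖be‖ := by
      have := (real_inner_le_norm (v p.2 - v ap.2) be).trans (mlr ((h.vlip p.2 ap.2).trans (mll dw.le PS)) (norm_nonneg _))
      rw [inner_sub_left] at this; linarith
    have ck : ⟪v p.2, p.1 - ap.1⟫ ≤ M * ak := (real_inner_le_norm _ _).trans (mul_le_mul (h.vb _) co.le (norm_nonneg _) hM.le)
    have eu := mll ck (by positivity : 0 ≤ 2 * C')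
    have gg : L * ak = lam⁻¹ * ak * ‖be‖ / 2 + 2 * C' * (M * ak) := by rw [hL]; ring
    linarith
  have hv : ∀ t, 0 ≤ lastC (v t) := fun t => (inv_nonneg.2 hM.le).trans (h.vl t)
  obtain ⟨ah, gj, bk⟩ := stay p hd'.1 hp.2.2.2
  obtain ⟨nh, ku, gc⟩ := stay q hd'.2 hq.2.2.2
  rcases hp.1.lt_or_eq with hpn | hpn
  · rcases hq.1.lt_or_eq with hqn | hqn
    · have := sum_int h hA Kc_POp hu hw (Kc_of (hsub hp) hpn) (Kc_of (hsub hq) hqn) (ai := ap.1) (be := (1 / 2 : ℝ) • be) (ad := ap.2) (C := C') (al := (al - bf) / 2) (aq := aq) (ay := ay) (k := k) hk C'0 gi.le hkp (by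
        rw [eventually_nhdsWithin_iff]
        have bl : ∀ᶠ z : SpaceTime (d + 1) × SpaceTime (d + 1) in 𝓝 (p, q), 0 < lastC z.1.1 ∧ 0 < lastC z.2.1 ∧ z.1 ∈ ball p ah ∧ z.2 ∈ ball q nh := by
          refine (((lc.comp (continuous_fst.comp continuous_fst)).tendsto (p, q)).eventually (lt_mem_nhds hpn)).and ((((lc.comp (continuous_fst.comp continuous_snd)).tendsto (p, q)).eventually (lt_mem_nhds hqn)).and
            (((continuous_fst.tendsto (p, q)).eventually (ball_mem_nhds p gj)).and ((continuous_snd.tendsto (p, q)).eventually (ball_mem_nhds q ku))))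
        filter_upwards [bl] with z ⟨dr, ds, cv, ed⟩ ⟨fi, fr⟩
        rw [mem_ball, Prod.dist_eq, max_lt_iff, dist_eq_norm, Real.dist_eq] at cv ed
        exact hmax z ⟨bk _ dr.le cv.1 (by linarith [neg_abs_le (z.1.2 - p.2)]) fi, gc _ ds.le ed.1 (by linarith [neg_abs_le (z.2.2 - q.2)]) fr⟩)
      rw [nb, ← nd] at this
      have ab := mul_nonneg (sub_nonneg.2 h.cd) (abs_nonneg (al - bf))
      have af := mll (neg_abs_le (al - bf)) bo.le
      linarith
    · refine fin q hd'.2 ?_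
      refine sum_F bo hA (sw q (Fc_of (hsub hq) hqn.symm)) hqn.symm (V := - penV A p q) (yn := lastC p.1) (k := k) ku kq.le gi.le hk.le hp.1 (hv _) (h.vb _) (ad := ap.2) (ay := ay) fun x gk jb jc jd => ?_
      have := hmax (p, x) ⟨hp, gc x gk jb jc jd⟩
      have e : ‖penV A p x‖ = ‖- penV A p q + (x.1 - q.1) + (A x.2 - A q.2)‖ := by rw [← norm_neg]; congr 1; simp only [penV]; abel
      simp only [pen, e, ← hqn] at this
      rw [norm_neg]
      simp only [hF] at this
      linarith
  · refine fin p hd'.1 ?_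
    refine sum_F bo hA (su p (Fc_of (hsub hp) hpn.symm)) hpn.symm (V := penV A p q) (yn := lastC q.1) (k := k) gj kq.le gi.le hk.le hq.1 (hv _) (h.vb _) (ad := ap.2) (ay := ay) fun x gk jb jc jd => ?_
    have := hmax (x, q) ⟨bk x gk jb jc jd, hq⟩
    have e : penV A x q = penV A p q + (x.1 - p.1) + (A x.2 - A p.2) := by simp only [penV]; abel
    simp only [pen, e, ← hpn] at this
    simp only [hF] at this
    linarith
theorem Sol.neg (h : Sol lam Q v r u) : Sol lam Q v r (fun p => - u p) := by
  obtain ⟨ut, g, H, hi⟩ := h.ic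
  exact ⟨h.cont.neg, ⟨_, _, _, hi.neg⟩, h.sup, by simpa using h.sub⟩
theorem Sol.add (hD : Dat d lam a b M bc Q v) (h : Sol lam Q v r u) (h' : Sol lam Q v r w) : Sol lam Q v r (fun p => u p + w p) := by
  obtain ⟨ut, g, H, hi⟩ := h.ic
  obtain ⟨wt, g', H', hi'⟩ := h'.ic
  refine ⟨h.cont.add h'.cont, ⟨_, _, _, hi.add hi'⟩, fun p hp => sum_main hD hi hi' h.cont h'.cont h.sub h'.sub hp, fun p hp => ?_⟩
  have := sum_main hD hi.neg hi'.neg h.cont.neg h'.cont.neg h.sup h'.sup hp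
  simpa [neg_add, add_comm] using this
theorem FSub.smul (h : FSub v u p) {c : ℝ} (hc : 0 < c) : FSub v (fun p => c * u p) p := by
  intro al be C aa ar hm
  have := h (c⁻¹ * al) (c⁻¹ • be) (c⁻¹ * C) aa ar fun q ab af aj aw => by
    have := hm q ab af aj aw
    rw [inner_smul_left, conj_trivial]
    have e : u q - u p = c⁻¹ * (c * u q - c * u p) := by field_simp
    rw [e]
    refine (mll this (inv_nonneg.2 hc.le)).trans (le_of_eq (by ring))
  rw [inner_smul_right] at this
  exact le_of_mul_le_mul_left this (inv_pos.2 hc)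
theorem Sol.smul (h : Sol lam Q v r u) {c : ℝ} (hc : 0 < c) : Sol lam Q v r (fun p => c * u p) := by
  obtain ⟨ut, g, H, hi⟩ := h.ic
  exact ⟨continuousOn_const.mul h.cont, ⟨_, _, _, hi.smul c⟩, fun p hp => (h.sub p hp).smul hc, fun p hp => by
    have := (h.sup p hp).smul hc; simpa using this⟩
theorem Sol.sub' (hD : Dat d lam a b M bc Q v) (h : Sol lam Q v r u) (h' : Sol lam Q v r w) : Sol lam Q v r (fun p => u p - w p) := by
  simpa [sub_eq_add_neg] using h.add hD h'.neg
theorem KcP_tr {k : Eucl (d + 1)} (hk : lastC k = 0) (hr : r' + ‖k‖ ≤ r) : (p ∈ KcP d r' → (p.1 + k, p.2) ∈ KcP d r) ∧ (p ∈ Fc d r' → (p.1 + k, p.2) ∈ Fc d r) ∧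
    (p ∈ Kc d r' → (p.1 + k, p.2) ∈ Kc d r) := by
  have key : p ∈ KcP d r' → (p.1 + k, p.2) ∈ KcP d r := fun hp => by
    obtain ⟨ab, af, aj, aw⟩ := KcP_mem hp
    exact KcP_of ((norm_add_le _ _).trans_lt LN) (by simpa [lastC_add, hk] using af) (by simp only; linarith [norm_nonneg k]) aw
  refine ⟨key, fun hp => Fc_of (key (Or.inr hp)) (by simpa [lastC_add, hk] using hp.2.1), fun hp => Kc_of (key (Or.inl hp)) (by simpa [lastC_add, hk] using hp.2.1)⟩
theorem FSub.trans {k : Eucl (d + 1)} (hk : lastC k = 0) (h : FSub v u (p.1 + k, p.2)) : FSub v (fun p => u (p.1 + k, p.2)) p := by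
  intro al be C aa ar hm
  refine h al be C aa ar fun q ab af aj aw => ?_
  have := hm (q.1 - k, q.2) (by simpa [lastC_sub, hk] using ab) (by rw [sub_sub, add_comm k]; exact af) aj aw
  simp only [sub_add_cancel, sub_sub, add_comm k] at this
  exact this
theorem Sol.trans (h : Sol lam Q v r u) {k : Eucl (d + 1)} (hk : lastC k = 0) (hr : r' + ‖k‖ ≤ r) : Sol lam Q v r' (fun p => u (p.1 + k, p.2)) := by
  obtain ⟨ut, g, H, hi⟩ := h.ic
  exact ⟨h.cont.comp FP fun p hp => (KcP_tr hk hr).1 hp, ⟨_, _, _, hi.trans k fun p hp => (KcP_tr hk hr).2.2 hp⟩,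
    fun p hp => (h.sub _ ((KcP_tr hk hr).2.1 hp)).trans hk, fun p hp => FSub.trans (u := fun p => - u p) hk (h.sup _ ((KcP_tr hk hr).2.1 hp))⟩
theorem Sol.mono (h : Sol lam Q v r u) (hr : r' ≤ r) : Sol lam Q v r' u := by
  simpa using h.trans (k := 0) (r' := r') (by simp [lastC]) (by simpa using hr)
end
theorem F_bar_aux {c x ai : ℝ} (hS : 0 < S) (hc : 0 < c) (fs : 0 < ai) (hx : ai / 2 ≤ x) :
    S * gh (c / x) - S * gh (c / ai) ≤ - (S * (c / ai ^ 2 - c ^ 2 / (4 * ai ^ 3))) * (x - ai) + S * (2 * c / ai ^ 3) * (x - ai) ^ 2 := by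
  have hx' : 0 < x := LN
  have ba : 1 / x - 1 / ai = - (x - ai) / ai ^ 2 + (x - ai) ^ 2 / (ai ^ 2 * x) := by field_simp; ring
  have bb : (x - ai) ^ 2 / (ai ^ 2 * x) ≤ 2 * (x - ai) ^ 2 / ai ^ 3 := by
    rw [div_le_div_iff₀ PS PS]
    linarith [mul_nonneg (mul_nonneg (sq_nonneg (x - ai)) (sq_nonneg ai)) (by linarith : 0 ≤ 2 * x - ai)]
  have bt : 0 ≤ (x - ai) ^ 2 / (ai ^ 2 * x) := PS
  set Y := 1 / x - 1 / ai with hY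
  have ef : gh (c / x) - gh (c / ai) = c * Y - c ^ 2 / 8 * (2 * (1 / ai) * Y + Y ^ 2) := by
    simp only [gh, hY]; field_simp; ring
  rw [← mul_sub, ef]
  have fg : c * Y - c ^ 2 / 8 * (2 * (1 / ai) * Y + Y ^ 2) ≤ c * (- (x - ai) / ai ^ 2 + 2 * (x - ai) ^ 2 / ai ^ 3) - c ^ 2 / 4 * (1 / ai) * (- (x - ai) / ai ^ 2) := by
    have dq := mll (ba.le.trans (add_le_add_right bb _)) hc.le
    have ck := mll (ba.ge.trans' (le_add_of_nonneg_right bt)) (by positivity : 0 ≤ c ^ 2 / 4 * (1 / ai))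
    linarith [mul_nonneg (sq_nonneg c) (sq_nonneg Y)]
  refine (mll fg hS.le).trans (le_of_eq ?_)
  field_simp; ring
def om {d : ℕ} (ci B D : ℝ) (c : Eucl (d + 1)) (ad : ℝ) (p : SpaceTime (d + 1)) : ℝ :=
  ci + (p.2 - ad) + B * lastC p.1 - D * lastC p.1 ^ 2 - ‖p.1 - c‖ ^ 2
theorem om_cont {D : ℝ} : Continuous (om (d := d) ci B D c ad) := by
  have := lastC_cont (d := d)
  unfold om; fun_prop
theorem om_line {D : ℝ} (z : Eucl (d + 1)) (t : ℝ) (X : Eucl (d + 1)) (s : ℝ) :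
    om ci B D c ad (z + X, s) = om ci B D c ad (z, t) + (s - t) + (B * lastC X - 2 * D * lastC z * lastC X - 2 * ⟪z - c, X⟫) - (D * lastC X ^ 2 + ‖X‖ ^ 2) := by
  have : z + X - c = (z - c) + X := by abel
  simp only [om, this, norm_add_sq_real, lastC_add]; ring
theorem F_bar {U : SpaceTime (d + 1) → ℝ} (h : FSub v U p) (hp : lastC p.1 = 0)
    {D : ℝ} {k : ℝ} (hD : 0 ≤ D) (hS : 0 < S) (hk : 0 < k) (aw : k < 4 * om ci B D c ad p)
    (hm : ∀ᶠ q in 𝓝 p, 0 ≤ lastC q.1 → q.2 ≤ p.2 → U q - S * gh (k / om ci B D c ad q) ≤ U p - S * gh (k / om ci B D c ad p)) :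
    B * lastC (v p.2) - 2 * ⟪v p.2, p.1 - c⟫ ≤ 1 := by
  set ai := om ci B D c ad p with fs
  have ni : 0 < ai := LN
  set f := S * (k / ai ^ 2 - k ^ 2 / (4 * ai ^ 3)) with hf
  have kv : 0 < f := by
    have : k / ai ^ 2 - k ^ 2 / (4 * ai ^ 3) = k / ai ^ 2 * ((4 * ai - k) / (4 * ai)) := by field_simp
    rw [hf, this]
    have : 0 < 4 * ai - k := LN
    positivity
  set be := B • en d - (2:ℝ) • (p.1 - c) with hbe
  have hev := hm.and ((om_cont.tendsto p).eventually (lt_mem_nhds (by linarith : ai / 2 < om ci B D c ad p)))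
  obtain ⟨ak, kt, bi⟩ := Metric.eventually_nhds_iff.1 hev
  have := h.quad (al := -f) (be := (-f) • be) (C := f * (D + 1) + S * (2 * k / ai ^ 3) * (2 * (‖be‖ + D + 1) ^ 2)) (K := S * (2 * k / ai ^ 3) * 2) (aa := min ak 1) PS fun q ab af aj aw => ?_
  · rw [inner_smul_right, hbe, inner_sub_right, inner_smul_right, inner_smul_right, inner_en] at this
    have bx : 0 ≤ f * (1 - (B * lastC (v p.2) - 2 * ⟪v p.2, p.1 - c⟫)) := LN
    have := nonneg_of_mul_nonneg_right bx kv
    linarith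
  · obtain ⟨cf, cx⟩ := bi (y := q) (by
      rw [Prod.dist_eq, dist_eq_norm, Real.dist_eq, max_lt_iff, abs_of_nonpos LN]
      exact ⟨af.trans_le (min_le_left _ _), by linarith [min_le_left ak 1]⟩)
    have ft := cf ab aw
    have fb := F_bar_aux hS hk ni cx.le
    set X := q.1 - p.1 with hX
    set av := q.2 - p.2 with et
    have e : om ci B D c ad q - ai = av + ⟪be, X⟫ - (D * lastC X ^ 2 + ‖X‖ ^ 2) := by
      have := om_line (ci := ci) (B := B) (D := D) (c := c) (ad := ad) p.1 p.2 X q.2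
      rw [hX, add_sub_cancel, ← hX, hp] at this
      have e' : om ci B D c ad q = om ci B D c ad (q.1, q.2) := rfl
      rw [e', this, hbe, inner_sub_left (B • en d), inner_smul_left, inner_smul_left, en_inner, conj_trivial, conj_trivial]
      simp only [fs, et]; ring
    rw [e] at fb
    have nj : ‖X‖ ≤ 1 := af.le.trans (min_le_right _ _)
    have cd : lastC X ^ 2 ≤ ‖X‖ ^ 2 := by rw [← sq_abs]; exact pow_le_pow_left₀ (abs_nonneg _) (lastC_le _) 2
    have nk := norm_nonneg X
    have de : D * lastC X ^ 2 + ‖X‖ ^ 2 ≤ (D + 1) * ‖X‖ ^ 2 := by linarith [mll cd hD]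
    have bo : 0 ≤ D * lastC X ^ 2 + ‖X‖ ^ 2 := PS
    have gf : |⟪be, X⟫ - (D * lastC X ^ 2 + ‖X‖ ^ 2)| ≤ (‖be‖ + D + 1) * ‖X‖ := by
      refine (abs_sub _ _).trans ?_
      rw [abs_of_nonneg bo]
      have := abs_real_inner_le_norm be X
      have := mll (mll nj nk) (by linarith : 0 ≤ D + 1)
      linarith
    have gz := pow_le_pow_left₀ (abs_nonneg _) gf 2
    rw [sq_abs, mul_pow] at gz
    have nl : (av + ⟪be, X⟫ - (D * lastC X ^ 2 + ‖X‖ ^ 2)) ^ 2 ≤ 2 * av ^ 2 + 2 * ((‖be‖ + D + 1) ^ 2 * ‖X‖ ^ 2) := by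
      linarith [sq_nonneg (av - (⟪be, X⟫ - (D * lastC X ^ 2 + ‖X‖ ^ 2)))]
    have qa := mll nl (by positivity : 0 ≤ S * (2 * k / ai ^ 3))
    have qb := mll de kv.le
    rw [inner_smul_left, conj_trivial]
    generalize S * (2 * k / ai ^ 3) = Z at *
    generalize (‖be‖ + D + 1) ^ 2 = Y at *
    rw [← hf] at fb
    linarith
set_option maxHeartbeats 1000000 in
theorem tanA (hDt : Dat d lam a b M bc Q v) (hs : Sol lam Q v r u) {D : ℝ} (hS : 0 < S)
    (hu : ∀ p ∈ KcP d r, |u p| ≤ S) (hr : r ≤ 1) (ar : 0 < aa) (cn : aa ≤ 1) (hB : 0 ≤ B) (hD : 0 ≤ D) (hA : 4 ≤ A)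
    (hcyl : ∀ x t, ‖x - c‖ ≤ aa → 0 ≤ lastC x → t ∈ Icc (ad - aa ^ 2) ad → (x, t) ∈ KcP d (r - aa))
    (hBD : ∀ s, B * s - D * s ^ 2 ≤ aa ^ 2 / 2) (kb : 0 ≤ lastC c) (hc : 0 ≤ B * lastC c - D * lastC c ^ 2)
    (hF : ∀ z, lastC z = 0 → ‖z - c‖ ≤ aa → M * (1 + 2 * M) < B)
    (hAA : (d + 1 : ℕ) * b * (2 * (B + 2 * D + 2) ^ 2 + 2 * (D + 1)) + 1 < a * A ^ 2)
    (h : Eucl (d + 1)) (nm : lastC h = 0) (hh : A * ‖h‖ ≤ 2 * aa ^ 2) :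
    u (c + (1/2:ℝ) • h, ad) - u (c - (1/2:ℝ) • h, ad) ≤ S * (2 * A / aa ^ 2) * ‖h‖ := by
  obtain ⟨ut, g, H, hi⟩ := hs.ic
  set au := om (aa ^ 2 / 2) B D c ad with dk
  have da : 0 < A := LN
  have lc := lastC_cont (d := d)
  set R : Set (Eucl (d + 1) × Eucl (d + 1) × ℝ) := {q | q.2.2 ≤ ad ∧ 0 ≤ lastC q.1 ∧ lastC q.2.1 = 0 ∧ A * ‖q.2.1‖ ≤ 4 * au (q.1, q.2.2)} with hR
  have ej : Continuous au := om_cont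
  have gl : aa ^ 2 ≤ aa := by nlinarith
  have ea : ∀ q ∈ R, ‖q.1 - c‖ ≤ aa ∧ ‖(1/2:ℝ) • q.2.1‖ ≤ aa ∧ q.2.2 ∈ Icc (ad - aa ^ 2) ad ∧ au (q.1, q.2.2) ≤ aa ^ 2 := by
    rintro ⟨z, k, t⟩ ⟨ab, af, aj, aw⟩
    simp only at ab af aj aw ⊢
    have bx := hBD (lastC z)
    have dn : au (z, t) = aa ^ 2 / 2 + (t - ad) + (B * lastC z - D * lastC z ^ 2) - ‖z - c‖ ^ 2 := by simp only [dk, om]; ring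
    have gu : 0 ≤ A * ‖k‖ := PS
    have iu : 0 ≤ ‖z - c‖ ^ 2 := PS
    refine ⟨abs_le_of_sq_le_sq' LN ar.le |>.2, ?_, ⟨LN, ab⟩, LN⟩
    rw [norm_smul]; norm_num
    have := mlr hA (norm_nonneg k)
    linarith
  have hin : ∀ q ∈ R, (q.1, q.2.2) ∈ KcP d (r - aa) ∧ lastC ((1/2:ℝ) • q.2.1) = 0 ∧ lastC (-((1/2:ℝ) • q.2.1)) = 0 ∧ r - aa + ‖(1/2:ℝ) • q.2.1‖ ≤ r ∧ r - aa + ‖-((1/2:ℝ) • q.2.1)‖ ≤ r := by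
    intro q hq
    obtain ⟨ab, af, aj, _⟩ := ea q hq
    refine ⟨hcyl _ _ ab hq.2.1 aj, ?_, ?_, LN, by rw [norm_neg]; linarith⟩
    · rw [lastC_smul, hq.2.2.1, mul_zero]
    · rw [lastC_neg, lastC_smul, hq.2.2.1, mul_zero, neg_zero]
  have gm : ∀ q ∈ R, (q.1 + (1/2:ℝ) • q.2.1, q.2.2) ∈ KcP d r ∧ (q.1 - (1/2:ℝ) • q.2.1, q.2.2) ∈ KcP d r := by
    intro q hq
    obtain ⟨ab, af, aj, aw, bx⟩ := hin q hq
    have ba := (KcP_tr af aw).1 ab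
    have bb := (KcP_tr aj bx).1 ab
    simp only [← sub_eq_add_neg] at bb
    exact ⟨ba, bb⟩
  have hRc : IsCompact R := by
    refine IsCompact.of_isClosed_subset ((isCompact_closedBall c aa).prod
      ((isCompact_closedBall (0 : Eucl (d + 1)) (2 * aa)).prod (isCompact_Icc (a := ad - aa ^ 2) (b := ad)))) ?_ ?_
    · have bl : IsClosed {q : Eucl (d + 1) × Eucl (d + 1) × ℝ | q.2.2 ≤ ad} := isClosed_le FP continuous_const
      have bq : IsClosed {q : Eucl (d + 1) × Eucl (d + 1) × ℝ | A * ‖q.2.1‖ ≤ 4 * au (q.1, q.2.2)} :=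
        isClosed_le FP (continuous_const.mul (ej.comp FP))
      have cr : IsClosed {q : Eucl (d + 1) × Eucl (d + 1) × ℝ | 0 ≤ lastC q.1} := isClosed_le continuous_const FP
      have el : IsClosed {q : Eucl (d + 1) × Eucl (d + 1) × ℝ | lastC q.2.1 = 0} := isClosed_eq FP continuous_const
      exact bl.inter (cr.inter (el.inter bq))
    · intro q hq
      obtain ⟨ab, af, aj, _⟩ := ea q hq
      rw [norm_smul] at af; norm_num at af
      exact ⟨by simpa [dist_eq_norm] using ab, by simpa using (by linarith : ‖q.2.1‖ ≤ 2 * aa), aj⟩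
  have hU : ContinuousOn (UU u) R :=
    (hs.cont.comp FP fun q hq => (gm q hq).1).sub (hs.cont.comp FP fun q hq => (gm q hq).2)
  have hUb : ∀ q ∈ R, UU u q ≤ 2 * S := by
    intro q hq
    have ab := abs_le.1 (hu _ (gm q hq).1)
    have af := abs_le.1 (hu _ (gm q hq).2)
    simp only [UU]; linarith
  have hωc0 : aa ^ 2 / 2 ≤ au (c, ad) := by simp only [dk, om]; simp; linarith
  have hp : (c, h, ad) ∈ R := ⟨le_rfl, kb, nm, by simp only; linarith⟩
  by_contra hcon
  have hlt : TT S A au (c, h, ad) < UU u (c, h, ad) := by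
    refine lt_of_le_of_lt ?_ (not_le.1 hcon)
    simp only [TT, gh]
    rw [mul_assoc]
    refine mll ?_ hS.le
    have ab : A * ‖h‖ / au (c, ad) ≤ A * ‖h‖ / (aa ^ 2 / 2) := by gcongr
    have af : A * ‖h‖ / (aa ^ 2 / 2) = 2 * A / aa ^ 2 * ‖h‖ := by field_simp
    linarith [sq_nonneg (A * ‖h‖ / au (c, ad))]
  obtain ⟨⟨z, k, t⟩, hm, dz, dp, hUm, hmax⟩ := select hRc hS da hU
    (ej.comp FP).continuousOn (fun q hq => hq.2.2.2) hUb hp hlt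
  obtain ⟨eb, fx, cb, fl⟩ := ea _ hm
  obtain ⟨fd, gn, je, jf, jg⟩ := hin _ hm
  have jh := gm _ hm
  obtain ⟨dl, cy, dm, nn⟩ := hm
  simp only at dz dp eb fx cb fl fd gn je jf jg jh dl cy dm nn
  rcases cy.lt_or_eq with hz | hz
  · have key := core (G := B + 2 * D + 2) (du := D + 1) (ee := 1) (W := aa ^ 2) (dv := 1) (z := z) (h := k)
      (t := t) (au := au) Kc_POp hi hDt.ec hDt.dy hDt.bo hS da (hDt.ell t) (Kc_of jh.1 (by simp only; rw [lastC_add, gn, add_zero]; exact hz))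
      (Kc_of jh.2 (by simp only; rw [lastC_sub, gn, sub_zero]; exact hz)) dz dp fl LN ?_ ?_ NN (by linarith [hDt.cd]) ?_ ?_ ?_
    · have ab : aa ^ 2 ≤ 1 := LN
      have af : 0 ≤ ((d + 1 : ℕ) : ℝ) * b := by have := hDt.dy; positivity
      have aj := mll (mll ab (by linarith : 0 ≤ D + 1)) af
      linarith
    · intro ag
      have dr : lastC z ≤ 1 := by
        have := (le_abs_self _).trans (lastC_le z)
        linarith [(KcP_mem fd).1]
      refine ⟨B * lastC ag - 2 * D * lastC z * lastC ag - 2 * ⟪z - c, ag⟫, D * lastC ag ^ 2 + ‖ag‖ ^ 2, ?_, PS, ?_, fun s => ?_⟩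
      · have dq := lastC_le ag
        have ck := (abs_real_inner_le_norm (z - c) ag).trans (mlr (eb.trans cn) (norm_nonneg ag))
        have eu : |B * lastC ag| ≤ B * ‖ag‖ := by rw [abs_mul, abs_of_nonneg hB]; gcongr
        have gg : |2 * D * lastC z * lastC ag| ≤ 2 * D * ‖ag‖ := by
          rw [abs_mul, abs_of_nonneg PS]
          calc 2 * D * lastC z * |lastC ag| ≤ 2 * D * 1 * ‖ag‖ := by gcongr
            _ = _ := by ring
        rw [abs_le] at ck eu gg ⊢
        constructor <;> linarith
      · have : lastC ag ^ 2 ≤ ‖ag‖ ^ 2 := by rw [← sq_abs]; exact pow_le_pow_left₀ (abs_nonneg _) (lastC_le _) 2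
        linarith [mll this hD]
      · rw [dk, om_line z t (s • ag) t, lastC_smul, inner_smul_right, norm_smul, mul_pow, mul_pow, Real.norm_eq_abs, sq_abs]; ring
    · have := ((hasDerivAt_id t).sub_const ad).const_add (aa ^ 2 / 2) |>.add_const (B * lastC z) |>.sub_const (D * lastC z ^ 2) |>.sub_const (‖z - c‖ ^ 2)
      simpa [dk, om] using this
    · intro ag
      have : ContinuousAt (fun s : ℝ => 4 * au (z + s • ag, t)) 0 := (continuous_const.mul (ej.comp FP)).continuousAt
      have de : ContinuousAt (fun s : ℝ => lastC (z + s • ag)) 0 := FP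
      filter_upwards [this.eventually (lt_mem_nhds (a := A * ‖k‖) (by simpa using dp)), de.eventually (lt_mem_nhds (a := 0) (by simpa using hz))] with s hs gx
      exact hmax _ ⟨cb.2, gx.le, dm, hs.le⟩
    · have : ContinuousAt (fun s : ℝ => 4 * au (z, t) - A * ‖k + (2 * s / ‖k‖) • k‖) 0 := FP
      filter_upwards [this.eventually (lt_mem_nhds (a := 0) (by simpa using dp))] with s hs
      exact hmax _ ⟨cb.2, cy, by rw [lastC_add, lastC_smul, dm]; ring, by simp only; linarith⟩
    · have : ContinuousAt (fun s : ℝ => 4 * au (z, s)) t := (continuous_const.mul (ej.comp FP)).continuousAt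
      filter_upwards [(this.eventually (lt_mem_nhds (a := A * ‖k‖) dp)).filter_mono nhdsWithin_le_nhds, self_mem_nhdsWithin] with s hs hs'
      exact hmax _ ⟨(le_of_lt hs').trans cb.2, cy, dm, hs.le⟩
  · have hsol := (hs.trans gn jf).sub' hDt (hs.trans je jg)
    have hfs := hsol.sub (z, t) (Fc_of fd hz.symm)
    have hk' : 0 < A * ‖k‖ := mul_pos da (norm_pos_iff.2 dz)
    have := F_bar hfs hz.symm hD hS hk' dp (by
      have bl : ContinuousAt (fun q => 4 * au q) (z, t) := (continuous_const.mul ej).continuousAt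
      filter_upwards [bl.eventually (lt_mem_nhds (a := A * ‖k‖) dp)] with q hq ab af
      have := hmax (q.1, k, q.2) ⟨af.trans cb.2, ab, dm, hq.le⟩
      simpa only [UU, TT, sub_eq_add_neg] using this)
    simp only at this
    have cf := hF z hz.symm eb
    have cx := hDt.vl t
    have hM := hDt.fo
    have ft := (real_inner_le_norm (v t) (z - c)).trans (mul_le_mul (hDt.vb t) (eb.trans cn) (norm_nonneg _) LN)
    have fb := mll cx hB
    have ia : 1 + 2 * M < B * M⁻¹ := by rw [← div_eq_mul_inv, lt_div_iff₀ LN]; linarith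
    linarith
theorem tan (d : ℕ) (ha : 0 < a) (hb : 0 < b) (hM : 1 ≤ M) (ar : 0 < aa) (cn : aa ≤ 1) : ∃ C > 0, ∀ {lam bc : ℝ} {Q v}, Dat d lam a b M bc Q v →
    ∀ {r u} {S : ℝ}, r ≤ 1 → 0 < S → Sol lam Q v r u → (∀ p ∈ KcP d r, |u p| ≤ S) → ∀ p ∈ KcP d (r - 3 * aa), ∀ h, lastC h = 0 → ‖h‖ ≤ aa →
    |u (p.1 + h, p.2) - u p| ≤ C * S * ‖h‖ := by
  have hch : ∀ x : ℝ, ∃ A : ℝ, 4 ≤ A ∧ x < a * A ^ 2 := fun x => by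
    refine ⟨max 4 (|x| / a + 1), le_max_left _ _, ?_⟩
    have ab := le_max_right 4 (|x| / a + 1)
    have aj : 0 ≤ |x| / a := PS
    have af : |x| / a + 1 ≤ max 4 (|x| / a + 1) ^ 2 := by nlinarith
    have aw := mll af ha.le
    have bx : a * (|x| / a + 1) = |x| + a := by field_simp
    linarith [le_abs_self x]
  set B := M * (2 + 2 * M) with hB
  have ib : 0 < B := PS
  set D := B ^ 2 / (2 * aa ^ 2) with hD
  have ky : 0 < D := PS
  set az := B / D with bv
  have fn : 0 < az := PS
  obtain ⟨A, kz, hA⟩ := hch (((d + 1 : ℕ) * b * (2 * (B + 2 * D + 2) ^ 2 + 2 * (D + 1)) + 1))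
  set ah := min aa (az / 2) with bk
  have gj : 0 < ah := PS
  have la : ah ≤ aa := min_le_left _ _
  have qc : ah < az := (min_le_right _ _).trans_lt LN
  set C := 2 * A / ah ^ 2 with hC
  have fj : 2 * A / aa ^ 2 ≤ C := by rw [hC]; gcongr
  refine ⟨C, PS, ?_⟩
  intro lam bc Q v hDt r u S hr hS hs hu p hp h hh np
  have key : ∀ k, lastC k = 0 → ‖k‖ ≤ aa → ∀ c t, ‖c‖ < r - 2 * aa → 0 ≤ lastC c → -(r - 2 * aa) < t → t ≤ 0 → u (c + (1/2:ℝ) • k, t) - u (c - (1/2:ℝ) • k, t) ≤ C * S * ‖k‖ := by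
    intro k hk qd c t bl bq cr el
    by_cases hbig : A * ‖k‖ ≤ 2 * ah ^ 2
    · have cyl : ∀ cp ≤ aa, 0 < cp → ∀ x s, ‖x - c‖ ≤ cp → 0 ≤ lastC x → s ∈ Icc (t - cp ^ 2) t → (x, s) ∈ KcP d (r - cp) := by
        intro cp ab af x s aj aw bx
        have := norm_le_norm_add_norm_sub c x
        rw [norm_sub_rev] at this
        have dn : cp ^ 2 ≤ cp := by nlinarith
        exact KcP_of (by simp only; linarith) aw (by simp only; linarith [bx.1]) (bx.2.trans el)
      by_cases hcn : lastC c ≤ az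
      · have ab : ah ^ 2 ≤ aa ^ 2 := by gcongr
        have := tanA hDt hs hS hu hr ar cn ib.le ky.le kz (cyl aa le_rfl ar) (fun s => by
          have e : B * s - D * s ^ 2 = aa ^ 2 / 2 - (B * s / aa - aa) ^ 2 / 2 := by rw [hD]; field_simp; ring
          rw [e]; linarith [sq_nonneg (B * s / aa - aa)]) bq (by
          rw [bv, le_div_iff₀ ky] at hcn
          have := mul_nonneg bq (sub_nonneg.2 hcn)
          linarith) (fun z _ _ => by rw [hB]; linarith) hA k hk LN
        refine this.trans ?_
        rw [mul_comm C S]; gcongr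
      · refine (tanA hDt hs hS hu hr gj (la.trans cn) le_rfl le_rfl kz (cyl ah la gj) (fun s => by
          have : 0 ≤ ah ^ 2 := sq_nonneg _
          linarith) bq (by simp) (fun z hz hzc => ?_) (lt_of_le_of_lt ?_ hA) k hk hbig).trans (le_of_eq ?_)
        · have := (neg_le_abs _).trans ((lastC_le (z - c)).trans hzc)
          rw [lastC_sub, hz] at this
          linarith [not_le.1 hcn]
        · gcongr <;> linarith
        · rw [mul_comm C S]
    · have cm : (c, t) ∈ KcP d (r - aa) := KcP_of (by simp only; linarith) bq (by simp only; linarith) el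
      have km : ‖(1/2:ℝ) • k‖ ≤ aa := by rw [norm_smul]; norm_num; linarith [norm_nonneg k]
      have bp := hu _ ((KcP_tr (r := r) (k := (1/2:ℝ) • k) (by rw [lastC_smul, hk, mul_zero]) LN).1 cm)
      have ce := hu _ ((KcP_tr (r := r) (k := -((1/2:ℝ) • k)) (by rw [lastC_neg, lastC_smul, hk, mul_zero, neg_zero]) (by rw [norm_neg]; linarith)).1 cm)
      simp only [← sub_eq_add_neg] at bp ce
      have : 2 * ah ^ 2 ≤ 2 * A * ‖k‖ := by have := mul_nonneg (by linarith : 0 ≤ A) (norm_nonneg k); linarith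
      have aj : 2 ≤ C * ‖k‖ := by rw [hC, div_mul_eq_mul_div, le_div_iff₀ PS]; exact this
      have := mll aj hS.le
      rw [abs_le] at bp ce
      linarith
  obtain ⟨ab, af, aj, aw⟩ := KcP_mem hp
  have cj : lastC ((1/2:ℝ) • h) = 0 := by rw [lastC_smul, hh, mul_zero]
  have kn : ‖(1/2:ℝ) • h‖ ≤ aa := by rw [norm_smul]; norm_num; linarith [norm_nonneg h]
  have lb : ‖p.1 + (1/2:ℝ) • h‖ < r - 2 * aa := (norm_add_le _ _).trans_lt LN
  have ld : 0 ≤ lastC (p.1 + (1/2:ℝ) • h) := by rw [lastC_add, cj, add_zero]; exact af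
  have ba : p.1 + (1/2:ℝ) • h + (1/2:ℝ) • h = p.1 + h := by rw [add_assoc, ← add_smul]; norm_num
  have bb : p.1 + (1/2:ℝ) • h - (1/2:ℝ) • h = p.1 := by abel
  have es := key h hh np _ p.2 lb ld LN aw
  have iz := key (-h) (by rw [lastC_neg, hh, neg_zero]) (by rwa [norm_neg]) _ p.2 lb ld LN aw
  rw [smul_neg, ← sub_eq_add_neg, sub_neg_eq_add, ba, bb, norm_neg] at iz
  rw [ba, bb] at es
  exact abs_le.2 ⟨LN, es⟩
theorem sub_en_sq (x : Eucl (d + 1)) (s : ℝ) : ‖x - s • en d‖ ^ 2 = ‖x‖ ^ 2 - 2 * s * lastC x + s ^ 2 := by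
  rw [norm_sub_sq_real, inner_smul_right, inner_en, norm_smul, en_norm, mul_one, Real.norm_eq_abs, sq_abs]; ring
theorem sub_en_le (x : Eucl (d + 1)) (bg : 0 ≤ s) (h : s ≤ lastC x) : ‖x - s • en d‖ ≤ ‖x‖ := by
  refine abs_le_of_sq_le_sq' ?_ (norm_nonneg _) |>.2
  rw [sub_en_sq]
  nlinarith
def pj (x : Eucl (d + 1)) : Eucl (d + 1) := x - lastC x • en d
theorem pj_last (x : Eucl (d + 1)) : lastC (pj x) = 0 := by rw [pj, lastC_sub, lastC_smul, lastC_en]; ring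
theorem pj_le (x : Eucl (d + 1)) : ‖pj x‖ ≤ ‖x‖ := by
  refine abs_le_of_sq_le_sq' ?_ (norm_nonneg _) |>.2
  rw [pj, sub_en_sq]
  linarith [sq_nonneg (lastC x)]
theorem pj_inner (w z : Eucl (d + 1)) : ⟪w, pj z⟫ = ⟪pj w, z⟫ := by
  simp only [pj, inner_sub_left, inner_sub_right, inner_smul_left, inner_smul_right, inner_en, en_inner, conj_trivial]; ring
theorem KcP_dn (hq : q ∈ KcP d r) (bg : 0 ≤ s) (h : s ≤ lastC q.1) : (q.1 - s • en d, q.2) ∈ KcP d r := by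
  obtain ⟨ab, af, aj, aw⟩ := KcP_mem hq
  exact KcP_of ((sub_en_le _ bg h).trans_lt ab) (by rw [lastC_sub, lastC_smul, lastC_en]; linarith) aj aw
def NL (u : SpaceTime (d + 1) → ℝ) (A B K : ℝ) (ai x : Eucl (d + 1)) (s t : ℝ) : Prop :=
  ∀ᶠ z : Eucl (d + 1) × ℝ × ℝ in 𝓝 0, z.2.2 ≤ 0 → s + z.2.1 ≤ lastC (x + z.1) →
    u (x + z.1, t + z.2.2) - u (x + z.1 - (s + z.2.1) • en d, t + z.2.2) - (u (x, t) - u (x - s • en d, t)) ≤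
    A * z.2.1 - B * (2 * s * z.2.1 + z.2.1 ^ 2) + K * (2 * ⟪x - ai, z.1⟫ + ‖z.1‖ ^ 2) - K * z.2.2
theorem nrm_int (hDt : Dat d lam a b M bc Q v) (hi : IC lam Q (Kc d r) u ut g H) (hK : 0 ≤ K)
    (hN : NL u A B K ai x s t) (hx : (x, t) ∈ Kc d r) (hy : (x - s • en d, t) ∈ Kc d r) (hsx : s < lastC x) :
    -(lam * K) ≤ a * (2 * K - 8 * B) + 2 * K * ((d + 1 : ℕ) * b) := by
  have lc := lastC_cont (d := d)
  set y := x - s • en d with hyd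
  have key : ∀ ag c, ⟪H (x, t) ag, ag⟫ - ⟪H (y, t) (ag - c • en d), ag - c • en d⟫ ≤ 2 * (K * ‖ag‖ ^ 2 - B * c ^ 2) := by
    intro ag c
    refine ((hi.sd Kc_POp hx ag).sub (hi.sd Kc_POp hy (ag - c • en d))).le_of_eventually
      (SD.quad 0 (A * c - 2 * B * s * c + 2 * K * ⟪x - ai, ag⟫) _) ?_
    have ab : Tendsto (fun ah : ℝ => (ah • ag, ah * c, (0:ℝ))) (𝓝 0) (𝓝 0) := Continuous.tendsto' FP _ _ (by simp)
    have af : ContinuousAt (fun ah : ℝ => lastC (x + ah • ag) - s - ah * c) 0 := FP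
    filter_upwards [ab.eventually hN, af.eventually (lt_mem_nhds (a := 0) (by simpa using hsx))] with ah ba bb
    have := ba le_rfl LN
    simp only [add_zero, inner_smul_right, norm_smul, mul_pow, Real.norm_eq_abs, sq_abs] at this
    have e : x + ah • ag - (s + ah * c) • en d = y + ah • (ag - c • en d) := by rw [hyd]; module
    rw [e] at this
    simp only [zero_smul, add_zero]
    linarith
  have ht : -K ≤ ut (x, t) - ut (y, t) := by
    refine left_deriv_le ((hi.dt _ hx).sub (hi.dt _ hy)) (Kc_POp _ hx).1 (by simpa using (hasDerivAt_id t).const_mul (-K)) ?_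
    have ab : Tendsto (fun av : ℝ => ((0 : Eucl (d + 1)), (0:ℝ), av - t)) (𝓝[<] t) (𝓝 0) :=
      (Continuous.tendsto' FP _ _ (by simp)).mono_left nhdsWithin_le_nhds
    filter_upwards [ab.eventually hN, self_mem_nhdsWithin] with av ba bb
    have := ba (by simpa using le_of_lt bb) (by simpa using hsx.le)
    simp only [add_zero, inner_zero_right, norm_zero, add_sub_cancel, Pi.sub_apply] at this ⊢
    rw [← hyd] at this
    linarith
  obtain ⟨m, hm, hms⟩ := Ell.refl hDt.ec.le (hDt.ell t) (en d) en_norm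
  have eh := hi.pde _ hx
  have eo := hi.pde _ hy
  rw [hm] at eh eo
  have bp := key (en d) 2
  have bb : en d - (2:ℝ) • en d = - en d := by module
  rw [bb, map_neg, inner_neg_neg, en_norm] at bp
  have ce : ∑ k, ⟪H (x, t) (m k), m k⟫ - ∑ k, ⟪H (y, t) (m k), m k⟫ ≤ 2 * K * ∑ k, ‖m k‖ ^ 2 := by
    rw [← Finset.sum_sub_distrib, Finset.mul_sum]
    refine Finset.sum_le_sum fun k _ => ?_
    have := key (m k) 0
    rw [zero_smul, sub_zero] at this
    linarith
  have go := mll hms (by linarith : 0 ≤ 2 * K)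
  have nq := mll bp hDt.ec.le
  have nr := mll ht hDt.bo.le
  linarith
theorem nrm_F (hDt : Dat d lam a b M bc Q v) (hi : IC lam Q (Kc d r) u ut g H) (hK : 0 ≤ K) (hB : 0 ≤ B)
    (hN : NL u A B K ai x s t) (hx : (x, t) ∈ Kc d r) (hs : s = lastC x) (hF : FSub v (fun p => - u p) (x - s • en d, t)) (cq : 0 < aq) (ji : 0 ≤ dh) (hCT : 0 ≤ CT)
    (ab : ∀ k, lastC k = 0 → ‖k‖ ≤ aq → |u (x + k, t) - u (x, t)| ≤ CT * ‖k‖) (ar : ‖x - ai‖ ≤ 1) (hsB : 4 * B * s ≤ A)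
    (af : ∀ k, lastC k = 0 → ‖k‖ ≤ aq → u (x - s • en d + k, t) + u (x - s • en d - k, t) - 2 * u (x - s • en d, t) ≤ dh * ‖k‖ ^ 2)
    (hBB : (dh + 2 * K) * ((d + 1 : ℕ) * b) < 2 * B * a) (hA : 2 * M * (K + 1 + (2 * K + CT) * M) < A) : False := by
  have lc := lastC_cont (d := d)
  set y := x - s • en d with hyd
  have br : 0 < s := by rw [hs]; exact hx.2.1
  have key : ∀ ag, ⟪H (x, t) ag, ag⟫ ≤ (dh + 2 * K) * ‖ag‖ ^ 2 - 2 * B * lastC ag ^ 2 := by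
    intro ag
    refine (hi.sd Kc_POp hx ag).le_of_bound ?_
    have bl : Tendsto (fun ah : ℝ => (ah • ag, ah * lastC ag, (0:ℝ))) (𝓝[>] 0) (𝓝 0) := (Continuous.tendsto' FP _ _ (by simp)).mono_left nhdsWithin_le_nhds
    have bq : Tendsto (fun ah : ℝ => (-ah • ag, -ah * lastC ag, (0:ℝ))) (𝓝[>] 0) (𝓝 0) := (Continuous.tendsto' FP _ _ (by simp)).mono_left nhdsWithin_le_nhds
    have cr : Tendsto (fun ah : ℝ => ‖ah • pj ag‖) (𝓝[>] 0) (𝓝 0) := (Continuous.tendsto' FP _ _ (by simp)).mono_left nhdsWithin_le_nhds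
    filter_upwards [bl.eventually hN, bq.eventually hN, cr.eventually (gt_mem_nhds cq)] with ah ba bb bt
    have dq := ba le_rfl (by simp only [lastC_add, lastC_smul]; linarith)
    have ck := bb le_rfl (by simp only [lastC_add, lastC_smul]; linarith)
    have eu := af (ah • pj ag) (by rw [lastC_smul, pj_last, mul_zero]) bt.le
    have cf : x + ah • ag - (s + ah * lastC ag) • en d = y + ah • pj ag := by rw [hyd, pj]; module
    have cx : x + -ah • ag - (s + -ah * lastC ag) • en d = y - ah • pj ag := by rw [hyd, pj]; module
    rw [cf] at dq
    rw [cx] at ck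
    simp only [add_zero, inner_smul_right, norm_smul, mul_pow, Real.norm_eq_abs, sq_abs, abs_neg, zero_smul] at dq ck eu ⊢
    have gg := mll (mll (pow_le_pow_left₀ (norm_nonneg _) (pj_le ag) 2) (sq_nonneg ah)) ji
    linarith
  obtain ⟨m, hm, hms, hmq⟩ := (hDt.ell t).vecs hDt.ec.le
  have eh := hi.pde _ hx
  have bp : ∑ k, ⟪H (x, t) (m k), m k⟫ ≤ (dh + 2 * K) * ∑ k, ‖m k‖ ^ 2 - 2 * B * Q t (Fin.last d) (Fin.last d) := by
    rw [← hmq, Finset.mul_sum, Finset.mul_sum, ← Finset.sum_sub_distrib]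
    refine Finset.sum_le_sum fun k _ => (key (m k)).trans (le_of_eq ?_)
    simp only [lastC]; ring
  have ce := mll hms (by linarith : 0 ≤ dh + 2 * K)
  have go := mll (Ell.le_diag (hDt.ell t) (Fin.last d)) (by linarith : 0 ≤ 2 * B)
  have hneg : ut (x, t) < 0 := by
    rw [← hm] at bp
    have : lam * ut (x, t) < 0 := by simp only at eh; linarith
    exact (pos_iff_neg_of_mul_neg this).1 hDt.bo
  obtain ⟨C, jj, qe, ns⟩ := hi.tay Kc_POp hx
  obtain ⟨gl, qg, nt⟩ := hi.tim Kc_POp hx one_pos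
  obtain ⟨jk, qh, nu⟩ := Metric.eventually_nhds_iff.1 hN
  set w := (2 * K) • (x - ai) - g (x, t) with hw
  have F := hF (-K - ut (x, t) - 1) (pj w + (2 * B * s - A) • en d) (K + |C|) (min jj (min gl jk)) PS fun q bw bn ch bu => ?_
  · rw [inner_add_right, pj_inner, inner_smul_right, inner_en, hw, inner_sub_right, inner_smul_right] at F
    simp only at F
    have jl := hDt.vl t
    have jm := (pj_le (v t)).trans (hDt.vb t)
    have hM := hDt.fo
    have gp : |⟪g (x, t), pj (v t)⟫| ≤ CT * M := by
      refine (HasDerivAt.le_of_lip' (hi.line hx (pj (v t))) (C := CT * ‖pj (v t)‖) PS ?_).trans (by gcongr)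
      have cr : Tendsto (fun ah : ℝ => ‖ah • pj (v t)‖) (𝓝 0) (𝓝 0) := Continuous.tendsto' FP _ _ (by simp)
      filter_upwards [cr.eventually (gt_mem_nhds cq)] with ah bt
      have := ab (ah • pj (v t)) (by rw [lastC_smul, pj_last, mul_zero]) bt.le
      simp only [zero_smul, add_zero, sub_zero, Real.norm_eq_abs]
      refine this.trans (le_of_eq ?_)
      rw [norm_smul, Real.norm_eq_abs]; ring
    have jn : ⟪pj (v t), x - ai⟫ ≤ M * 1 := (real_inner_le_norm _ _).trans (mul_le_mul jm ar (norm_nonneg _) LN)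
    rw [real_inner_comm (g (x, t))] at F
    have lg := mll jn (by linarith : 0 ≤ 2 * K)
    have lh : A / 2 * M⁻¹ ≤ (A - 2 * B * s) * lastC (v t) :=
      mul_le_mul LN jl PS (by linarith [mul_nonneg hB br.le])
    have qi : K + 1 + (2 * K + CT) * M < A / 2 * M⁻¹ := by
      rw [← div_eq_mul_inv, lt_div_iff₀ LN]; linarith
    linarith [(abs_le.1 gp).1]
  · have ie : lastC y = 0 := by rw [hyd, hs]; exact pj_last x
    set k := pj (q.1 - y) with hk
    set l := lastC q.1 with hl
    simp only at bn ch bu ⊢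
    have cd : lastC (q.1 - y) = l := by rw [lastC_sub, ie, sub_zero]
    have bp : ‖k‖ ≤ ‖q.1 - y‖ := pj_le _
    have de : |l| ≤ ‖q.1 - y‖ := by rw [← cd]; exact lastC_le _
    have kl : lastC k = 0 := pj_last _
    have dl := bn.trans_le (min_le_left _ _)
    have cy := bn.trans_le ((min_le_right _ _).trans (min_le_left _ _))
    have dm := bn.trans_le ((min_le_right _ _).trans (min_le_right _ _))
    have dw := (min_le_right jj (min gl jk)).trans (min_le_left _ _)
    have eg := (min_le_right jj (min gl jk)).trans (min_le_right _ _)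
    have dc := ns k (bp.trans_lt dl)
    have dd := nt (x + k, q.2) (by simpa using bp.trans_lt cy) (by simp only; linarith) bu
    have ew := nu (y := (k, -l, q.2 - t)) (by
      rw [dist_zero_right, Prod.norm_def, Prod.norm_def, max_lt_iff, max_lt_iff, norm_neg, Real.norm_eq_abs, Real.norm_eq_abs, abs_of_nonpos (a := q.2 - t) LN]
      exact ⟨bp.trans_lt dm, de.trans_lt dm, LN⟩) (by simp only; linarith) (by simp only [lastC_add, kl]; linarith)
    have e : x + k - (s + -l) • en d = q.1 := by rw [hk, pj, cd, hyd]; module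
    simp only [e, add_sub_cancel] at ew
    rw [inner_add_left, ← pj_inner, inner_smul_left, conj_trivial, en_inner, ← hk, cd, hw, inner_sub_left (_ • _), inner_smul_left, conj_trivial]
    have bb : u q = u (q.1, q.2) := rfl
    rw [bb]
    rw [← hyd] at ew
    have go := mll (pow_le_pow_left₀ (norm_nonneg _) bp 2) (by positivity : 0 ≤ K + |C|)
    have nq := mlr (le_abs_self C) (sq_nonneg ‖k‖)
    have nr := mul_nonneg hB (sq_nonneg l)
    simp only at dc dd
    linarith
theorem nrmA (hDt : Dat d lam a b M bc Q v) (hs : Sol lam Q v r u)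
    (hu : ∀ p ∈ KcP d r, |u p| ≤ 1) (ar : 0 < aa) (cn : aa ≤ 1) (hK : 2 < K * aa ^ 2) (hB : 0 < B) (da : 0 < A)
    (hcyl : ∀ x t, ‖x - ai‖ ≤ aa → 0 ≤ lastC x → t ∈ Icc (ad - aa) ad → (x, t) ∈ KcP d r) (cq : 0 < aq) (ji : 0 ≤ dh) (hCT : 0 ≤ CT)
    (ab : ∀ p ∈ KcP d r, ∀ k, lastC k = 0 → ‖k‖ ≤ aq → |u (p.1 + k, p.2) - u p| ≤ CT * ‖k‖)
    (af : ∀ p ∈ KcP d r, ∀ k, lastC k = 0 → ‖k‖ ≤ aq → u (p.1 + k, p.2) + u (p.1 - k, p.2) - 2 * u p ≤ dh * ‖k‖ ^ 2)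
    (hBB : (dh + 2 * K) * ((d + 1 : ℕ) * b) < 2 * B * a) (li : K + a * (2 * K) < 4 * (a * B)) (hA : 2 * M * (K + 1 + (2 * K + CT) * M) < A) (hAB : 32 * B < 3 * A ^ 2) (ca : 0 ≤ br) (bz : br ≤ lastC ai) (gx : 4 * B * br ≤ A) :
    u (ai, ad) - u (ai - br • en d, ad) ≤ A * br := by
  obtain ⟨ut, g, H, hi⟩ := hs.ic
  have lc := lastC_cont (d := d)
  have fe : 0 < K := pos_of_mul_pos_left LN (sq_nonneg aa)
  set R : Set (Eucl (d + 1) × ℝ × ℝ) := {q | ‖q.1 - ai‖ ≤ aa ∧ q.2.2 ∈ Icc (ad - aa) ad ∧ 0 ≤ q.2.1 ∧ q.2.1 ≤ lastC q.1 ∧ 4 * B * q.2.1 ≤ A} with hR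
  set jo : Eucl (d + 1) × ℝ × ℝ → ℝ := fun q => u (q.1, q.2.2) - u (q.1 - q.2.1 • en d, q.2.2) - A * q.2.1 + B * q.2.1 ^ 2 - K * (‖q.1 - ai‖ ^ 2 + (ad - q.2.2)) with jp
  have dl : ∀ q ∈ R, (q.1, q.2.2) ∈ KcP d r := fun q hq => hcyl _ _ hq.1 (hq.2.2.1.trans hq.2.2.2.1) hq.2.1
  have cy : ∀ q ∈ R, (q.1 - q.2.1 • en d, q.2.2) ∈ KcP d r := fun q hq => KcP_dn (q := (q.1, q.2.2)) (dl q hq) hq.2.2.1 hq.2.2.2.1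
  have hRc : IsCompact R := by
    refine IsCompact.of_isClosed_subset ((isCompact_closedBall ai aa).prod ((isCompact_Icc (a := 0) (b := A / (4 * B))).prod (isCompact_Icc (a := ad - aa) (b := ad)))) ?_ ?_
    · have bl : IsClosed {q : Eucl (d + 1) × ℝ × ℝ | ‖q.1 - ai‖ ≤ aa} := isClosed_le FP continuous_const
      have bq : IsClosed {q : Eucl (d + 1) × ℝ × ℝ | q.2.2 ∈ Icc (ad - aa) ad} := isClosed_Icc.preimage FP
      have cr : IsClosed {q : Eucl (d + 1) × ℝ × ℝ | 0 ≤ q.2.1} := isClosed_le continuous_const FP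
      have el : IsClosed {q : Eucl (d + 1) × ℝ × ℝ | q.2.1 ≤ lastC q.1} := isClosed_le FP FP
      have jq : IsClosed {q : Eucl (d + 1) × ℝ × ℝ | 4 * B * q.2.1 ≤ A} := isClosed_le FP continuous_const
      exact bl.inter (bq.inter (cr.inter (el.inter jq)))
    · intro q hq
      exact ⟨by simpa [dist_eq_norm] using hq.1, ⟨hq.2.2.1, by rw [le_div_iff₀ PS]; linarith [hq.2.2.2.2]⟩, hq.2.1⟩
  have hc : ContinuousOn jo R := by
    have bl : ContinuousOn (fun q : Eucl (d + 1) × ℝ × ℝ => u (q.1, q.2.2)) R := hs.cont.comp FP dl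
    have bq : ContinuousOn (fun q : Eucl (d + 1) × ℝ × ℝ => u (q.1 - q.2.1 • en d, q.2.2)) R := hs.cont.comp FP cy
    have cr : Continuous (fun q : Eucl (d + 1) × ℝ × ℝ => A * q.2.1) := FP
    have el : Continuous (fun q : Eucl (d + 1) × ℝ × ℝ => B * q.2.1 ^ 2) := FP
    have jq : Continuous (fun q : Eucl (d + 1) × ℝ × ℝ => K * (‖q.1 - ai‖ ^ 2 + (ad - q.2.2))) := FP
    exact (((bl.sub bq).sub cr.continuousOn).add el.continuousOn).sub jq.continuousOn
  have hp : (ai, br, ad) ∈ R := ⟨by simp [ar.le], ⟨by simp only; linarith, le_rfl⟩, ca, bz, gx⟩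
  by_contra hcon
  have hpos : 0 < jo (ai, br, ad) := by
    simp only [jp, sub_self, norm_zero]
    have := mul_nonneg hB.le (sq_nonneg br)
    linarith
  obtain ⟨⟨x, s, t⟩, hm, hmax⟩ := hRc.exists_isMaxOn ⟨_, hp⟩ hc
  have hmp : 0 < jo (x, s, t) := hpos.trans_le (hmax hp)
  have bp := dl _ hm
  have ce := cy _ hm
  have nv := abs_le.1 (hu _ bp)
  have nw := abs_le.1 (hu _ ce)
  obtain ⟨cf, ⟨cx, ft⟩, fb, ia, lj⟩ := hm
  simp only [jp] at hmp
  simp only at bp ce cf cx ft fb ia lj nv nw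
  have am : 0 ≤ ad - t := LN
  have dq : 0 ≤ A * s - B * s ^ 2 := by
    have := mul_nonneg fb (by linarith : 0 ≤ A - B * s * 4)
    have := mul_nonneg da.le fb
    linarith
  have ck : 0 ≤ K * ‖x - ai‖ ^ 2 := PS
  have eu : 0 ≤ K * (ad - t) := PS
  have cd : 4 * B * s < A := lt_of_le_of_ne lj fun h => by
    have e : A * s - B * s ^ 2 = 3 * A ^ 2 / (16 * B) := by
      have : s = A / (4 * B) := by field_simp; linarith
      rw [this]; field_simp; ring
    have : 2 < 3 * A ^ 2 / (16 * B) := by rw [lt_div_iff₀ PS]; linarith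
    linarith
  have de : ‖x - ai‖ < aa := lt_of_le_of_ne cf fun h => by rw [h] at hmp ck; linarith
  have gf : ad - aa < t := lt_of_le_of_ne cx fun h => by
    have e : ad - t = aa := LN
    have : aa ^ 2 ≤ aa := by nlinarith
    have := mll this fe.le
    rw [e] at hmp; linarith
  have gz : 0 < s := lt_of_le_of_ne fb fun h => by rw [← h] at hmp; simp at hmp; linarith
  have hN : NL u A B K ai x s t := by
    have bl : ContinuousAt (fun z : Eucl (d + 1) × ℝ × ℝ => ‖x + z.1 - ai‖) 0 := FP
    have bq : ContinuousAt (fun z : Eucl (d + 1) × ℝ × ℝ => t + z.2.2) 0 := FP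
    have cr : ContinuousAt (fun z : Eucl (d + 1) × ℝ × ℝ => s + z.2.1) 0 := FP
    have el : ContinuousAt (fun z : Eucl (d + 1) × ℝ × ℝ => 4 * B * (s + z.2.1)) 0 := FP
    filter_upwards [bl.tendsto.eventually_lt_const (u := aa) (by simpa using de), bq.eventually (lt_mem_nhds (a := ad - aa) (by simpa using gf)),
      cr.eventually (lt_mem_nhds (a := 0) (by simpa using gz)), el.tendsto.eventually_lt_const (u := A) (by simpa using cd)] with z dr ds cv ed fi fr
    have := hmax (show (x + z.1, s + z.2.1, t + z.2.2) ∈ R from ⟨dr.le, ⟨ds.le, by simp only; linarith⟩, cv.le, fr, ed.le⟩)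
    simp only [jp, mem_setOf_eq] at this
    have e : x + z.1 - ai = (x - ai) + z.1 := by abel
    rw [e, norm_add_sq_real] at this
    linarith
  have kx : (x, t) ∈ Kc d r := Kc_of bp (gz.trans_le ia)
  rcases ia.lt_or_eq with h | h
  · have := nrm_int hDt hi fe.le hN kx (Kc_of ce (by rw [lastC_sub, lastC_smul, lastC_en]; linarith)) h
    have bw := mlr hDt.cd fe.le
    have bn : 0 ≤ dh * ((d + 1 : ℕ) * b) := by have := hDt.dy; positivity
    linarith [mul_pos hDt.ec hB]
  · exact nrm_F hDt hi fe.le hB.le hN kx h (hs.sup _ (Fc_of ce (by rw [lastC_sub, lastC_smul, lastC_en]; linarith))) cq ji hCT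
      (ab _ bp) (cf.trans cn) cd.le (af _ ce) hBB hA
theorem nrm (d : ℕ) (ha : 0 < a) (hb : 0 < b) (hM : 1 ≤ M) (ar : 0 < aa) (cn : aa ≤ 1) : ∃ C > 0, ∀ {lam bc : ℝ} {Q v}, Dat d lam a b M bc Q v →
    ∀ {r u}, r ≤ 1 → Sol lam Q v r u → (∀ p ∈ KcP d r, |u p| ≤ 1) → ∀ p ∈ KcP d (r - 7 * aa), ∀ s, 0 ≤ s → s ≤ lastC p.1 →
    u p - u (p.1 - s • en d, p.2) ≤ C * s := by
  obtain ⟨T, ig, hT⟩ := tan d ha hb hM ar cn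
  have fe : 0 < 3 / aa ^ 2 := PS
  have hK : 2 < 3 / aa ^ 2 * aa ^ 2 := by field_simp; norm_num
  generalize 3 / aa ^ 2 = K at fe hK
  have dy : 0 < ((d + 1 : ℕ) : ℝ) * b := PS
  obtain ⟨B, ir, ny, li⟩ : ∃ B, 0 < B ∧ (T * T + 2 * K) * ((d + 1 : ℕ) * b) < 2 * B * a ∧ K + a * (2 * K) < 4 * (a * B) := by
    have eh : 0 < (T * T + 2 * K) * ((d + 1 : ℕ) * b) := PS
    have eo : 0 < K + a * (2 * K) := PS
    refine ⟨((T * T + 2 * K) * ((d + 1 : ℕ) * b) + (K + a * (2 * K))) / a, PS, ?_, ?_⟩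
    · rw [mul_div_assoc', div_mul_cancel₀ _ ha.ne']; linarith
    · rw [mul_div_cancel₀ _ ha.ne']; linarith
  set A := 2 * M * (K + 1 + (2 * K + T) * M) + 11 * B + 1 with hA
  have kd : 0 < 2 * M * (K + 1 + (2 * K + T) * M) := PS
  have da : 0 < A := LN
  have hAB : 32 * B < 3 * A ^ 2 := by nlinarith
  refine ⟨A + 2 * (4 * B / A), PS, fun {lam bc Q v} hDt {r u} hr hs hu p hp s ca bz => ?_⟩
  obtain ⟨bw, bn, ch, bu⟩ := KcP_mem hp
  have am := hT hDt hr one_pos hs hu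
  by_cases hsm : 4 * B * s ≤ A
  · have := nrmA (ai := p.1) (ad := p.2) (r := r - 6 * aa) (K := K) (A := A) (B := B) (CT := T) (dh := T * T) (aq := aa) hDt (hs.mono LN)
      (fun q hq => hu q ?_) ar cn hK ir da (fun x t ab af aj => ?_) ar PS ig.le (fun q hq k cj bp => ?_) (fun q hq k cj bp => ?_) ny li LN hAB ca bz hsm
    · refine this.trans ?_
      gcongr
      have : 0 ≤ 2 * (4 * B / A) := PS
      linarith
    · obtain ⟨ab, af, aj, aw⟩ := KcP_mem hq
      exact KcP_of LN af LN aw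
    · have := norm_le_norm_add_norm_sub p.1 x
      rw [norm_sub_rev] at this
      exact KcP_of (by simp only; linarith) af (by simp only; linarith [aj.1]) (aj.2.trans bu)
    · obtain ⟨ab, af, aj, aw⟩ := KcP_mem hq
      simpa using am q (KcP_of LN af LN aw) k cj bp
    · rcases eq_or_ne k 0 with rfl | hk
      · simp
        have : u q = u (q.1, q.2) := rfl
        linarith
      have kp : 0 < ‖k‖ := norm_pos_iff.2 hk
      have w := hT hDt (S := T * 1 * ‖k‖) (r := r - 3 * aa) LN PS ((hs.trans cj (by linarith : r - 3 * aa + ‖k‖ ≤ r)).sub' hDt (hs.mono LN))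
        (fun z hz => am z hz k cj bp) q (by rw [sub_sub]; convert hq using 2; ring) (-k) (by rw [lastC_neg, cj, neg_zero]) (by rwa [norm_neg])
      simp only [norm_neg, neg_add_cancel_right, ← sub_eq_add_neg, sub_add_cancel] at w
      have e : u (q.1, q.2) = u q := rfl
      rw [e] at w
      linarith [(abs_le.1 w).1]
  · have qj : r - 7 * aa ≤ r := LN
    have ab := hu p (KcP_of LN bn LN bu)
    obtain ⟨dr, ds, cv, ed⟩ := KcP_mem (KcP_dn hp ca bz)
    have af := hu _ (KcP_of (q := (p.1 - s • en d, p.2)) LN ds LN ed)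
    have aj : 1 ≤ 4 * B / A * s := by rw [div_mul_eq_mul_div, le_div_iff₀ da]; linarith
    have := mul_nonneg da.le ca
    linarith [(abs_le.1 ab).2, (abs_le.1 af).1]
theorem lip (d : ℕ) (ha : 0 < a) (hb : 0 < b) (hM : 1 ≤ M) (ar : 0 < aa) (cn : aa ≤ 1) : ∃ C > 0, ∀ {lam bc : ℝ} {Q v}, Dat d lam a b M bc Q v →
    ∀ {r u} {S : ℝ}, r ≤ 1 → 0 < S → Sol lam Q v r u → (∀ p ∈ KcP d r, |u p| ≤ S) → ∀ t x y, (x, t) ∈ KcP d (r - 7 * aa) → (y, t) ∈ KcP d (r - 7 * aa) → ‖x - y‖ ≤ aa →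
    |u (x, t) - u (y, t)| ≤ C * S * ‖x - y‖ := by
  obtain ⟨T, ig, hT⟩ := tan d ha hb hM ar cn
  obtain ⟨N, ez, hN⟩ := nrm d ha hb hM ar cn
  refine ⟨N + T, PS, fun {lam bc Q v} hDt {r u S} hr hS hs hu => ?_⟩
  have key : ∀ t x y, (x, t) ∈ KcP d (r - 7 * aa) → (y, t) ∈ KcP d (r - 7 * aa) → ‖x - y‖ ≤ aa → lastC y ≤ lastC x → |u (x, t) - u (y, t)| ≤ (N + T) * S * ‖x - y‖ := by
    intro t x y hx hy hxy hl
    set s := lastC (x - y) with hsd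
    have br : 0 ≤ s := by rw [hsd, lastC_sub]; linarith
    have fw : s ≤ lastC x := by rw [hsd, lastC_sub]; linarith [(KcP_mem hy).2.1]
    have ip : s ≤ ‖x - y‖ := (le_abs_self _).trans (lastC_le _)
    have lk : ∀ p ∈ KcP d r, |S⁻¹ * u p| ≤ 1 := fun p hp => by
      rw [abs_mul, abs_of_pos (inv_pos.2 hS), inv_mul_le_iff₀ hS, mul_one]; exact hu p hp
    have co := hN hDt hr (hs.smul (inv_pos.2 hS)) lk (x, t) hx s br fw
    have dw := hN hDt hr (hs.smul (inv_pos.2 hS)).neg (fun p hp => by rw [abs_neg]; exact lk p hp) (x, t) hx s br fw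
    simp only at co dw
    have eg : |S⁻¹ * (u (x, t) - u (x - s • en d, t))| ≤ N * s := by rw [abs_le]; constructor <;> linarith
    rw [abs_mul, abs_of_pos (inv_pos.2 hS), inv_mul_le_iff₀ hS] at eg
    have hd := KcP_dn hx br fw
    obtain ⟨dr, ds, cv, ed⟩ := KcP_mem hd
    have bp := (pj_le (x - y)).trans hxy
    have em := hT hDt hr hS hs hu (x - s • en d, t) (KcP_of LN ds LN ed) (-pj (x - y)) (by rw [lastC_neg, pj_last, neg_zero]) (by rwa [norm_neg])
    have e : x - s • en d + -pj (x - y) = y := by rw [pj, ← hsd]; abel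
    simp only [e, norm_neg] at em
    have kc := mll (pj_le (x - y)) (by positivity : 0 ≤ T * S)
    have qk := mll ip (by positivity : 0 ≤ S * N)
    rw [abs_le] at eg em ⊢
    constructor <;> linarith
  intro t x y hx hy hxy
  rcases le_total (lastC y) (lastC x) with h | h
  · exact key t x y hx hy hxy h
  · rw [abs_sub_comm, norm_sub_rev]; exact key t y x hy hx (by rwa [norm_sub_rev]) h
theorem timF
    (hDt : Dat d lam a b M bc Q v) (hs : Sol lam Q v r u) {am : ℝ} (hC : 0 < C) (ar : 0 < aa) (fs : lastC ai = 0) (hst : br ≤ am)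
    (hcyl : ∀ x t, ‖x - ai‖ ≤ aa → 0 ≤ lastC x → t ∈ Icc br am → (x, t) ∈ KcP d r ∧ |u (x, t) - u (ai, t)| ≤ C * ‖x - ai‖ ∧ |u (x, t) - u (pj x, t)| ≤ C * lastC x) :
    u (ai, am) - u (ai, br) ≤ (4 * C * M + 1) * (am - br) := by
  by_contra hcon
  push Not at hcon
  set L := 4 * C * M + 1 with hL
  set bm := u (ai, am) - u (ai, br) - L * (am - br) with nz
  have ql : 0 < bm := LN
  obtain ⟨k, cj, bp, ce⟩ : ∃ k, 0 < k ∧ C ^ 2 < 4 * k * bm ∧ C < k * aa := by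
    refine ⟨C ^ 2 / bm + C / aa + 1, PS, ?_, ?_⟩
    · have e : 4 * (C ^ 2 / bm + C / aa + 1) * bm = 4 * C ^ 2 + 4 * bm * (C / aa + 1) := by field_simp; ring
      have : 0 < 4 * bm * (C / aa + 1) := PS
      rw [e]; linarith [sq_nonneg C]
    · have e : (C ^ 2 / bm + C / aa + 1) * aa = C + (C ^ 2 / bm + 1) * aa := by field_simp; ring
      have : 0 < (C ^ 2 / bm + 1) * aa := PS
      rw [e]; linarith
  set G : SpaceTime (d + 1) → ℝ := fun q => u q - L * q.2 - k * ‖q.1 - ai‖ ^ 2 - 2 * C * lastC q.1 with hG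
  set K : Set (SpaceTime (d + 1)) := (closedBall ai aa ×ˢ Icc br am) ∩ {q | 0 ≤ lastC q.1} with hK
  have Kc : IsCompact K := ((isCompact_closedBall ai aa).prod isCompact_Icc).inter_right (isClosed_le continuous_const (lastC_cont.comp continuous_fst))
  have Km : ∀ x t, ‖x - ai‖ ≤ aa → 0 ≤ lastC x → t ∈ Icc br am → (x, t) ∈ K := fun x t ab af aj => ⟨⟨by rwa [mem_closedBall, dist_eq_norm], aj⟩, af⟩
  have Gc : ContinuousOn G K := by
    refine ((((hs.cont.mono fun q hq => (hcyl q.1 q.2 ?_ hq.2 hq.1.2).1).sub FP).sub FP).sub ?_)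
    · rw [← dist_eq_norm]; exact hq.1.1
    · exact (continuous_const.mul (lastC_cont.comp continuous_fst)).continuousOn
  have fu : ∀ t ∈ Icc br am, (ai, t) ∈ K := fun t ht => Km _ _ (by simpa using ar.le) fs.ge ht
  obtain ⟨⟨x, t⟩, hm, hmax⟩ := Kc.exists_isMaxOn ⟨_, fu am ⟨hst, le_rfl⟩⟩ Gc
  have hmax : ∀ q ∈ K, G q ≤ G (x, t) := fun q hq => hmax hq
  obtain ⟨⟨ab, af⟩, aj⟩ := hm
  have ab : ‖x - ai‖ ≤ aa := by rw [← dist_eq_norm]; exact ab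
  have aj : 0 ≤ lastC x := aj
  have af : t ∈ Icc br am := af
  obtain ⟨bl, bq, cr⟩ := hcyl x t ab aj af
  have ba := hmax _ (fu am ⟨hst, le_rfl⟩)
  have bb := hmax _ (fu t af)
  have pjs : pj x - ai = pj (x - ai) := by rw [pj, pj, lastC_sub, fs, sub_zero]; abel
  have pl : ‖pj x - ai‖ ≤ ‖x - ai‖ := by rw [pjs]; exact pj_le _
  have bt := hmax _ (Km (pj x) t (pl.trans ab) (pj_last x).ge af)
  simp only [hG, fs, sub_self, norm_zero, pj_last] at ba bb bt
  have eo := mll (pow_le_pow_left₀ (norm_nonneg _) pl 2) cj.le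
  have xn : lastC x = 0 := by
    have : C * lastC x ≤ 0 := by linarith [(abs_le.1 cr).2]
    by_contra h
    have := mul_pos hC (lt_of_le_of_ne aj (Ne.symm h))
    linarith
  have nx := norm_nonneg (x - ai)
  rw [xn] at ba bb
  have kn : k * ‖x - ai‖ ≤ C := by
    rcases nx.eq_or_lt with h | h
    · rw [← h, mul_zero]; exact hC.le
    · refine le_of_mul_le_mul_right ?_ h
      linarith [(abs_le.1 bq).2]
  have ts : br < t := by
    rcases af.1.eq_or_lt with h | h
    · exfalso
      rw [← h] at ba bq
      have bw := (abs_le.1 bq).2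
      have bn : bm ≤ C * ‖x - ai‖ - k * ‖x - ai‖ ^ 2 := by rw [nz]; linarith
      have ch := mll bn (by positivity : 0 ≤ 4 * k)
      linarith [sq_nonneg (2 * (k * ‖x - ai‖) - C)]
    · exact h
  have xr : ‖x - ai‖ < aa := lt_of_mul_lt_mul_left (kn.trans_lt ce) cj.le
  have fin := hs.sub (x, t) (Fc_of bl xn) L ((2 * k) • (x - ai) + (2 * C) • en d) k (min (aa - ‖x - ai‖) (t - br)) (lt_min LN LN)
    fun q oa cf cx ft => by
      simp only at cf cx ft ⊢
      have fd := cf.trans_le (min_le_left _ _)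
      have gn := min_le_right (aa - ‖x - ai‖) (t - br)
      have je := norm_sub_le_norm_sub_add_norm_sub q.1 x ai
      have := hmax _ (Km q.1 q.2 LN oa ⟨LN, ft.trans af.2⟩)
      simp only [hG] at this
      have e : ‖q.1 - ai‖ ^ 2 = ‖q.1 - x‖ ^ 2 + 2 * ⟪x - ai, q.1 - x⟫ + ‖x - ai‖ ^ 2 := by
        rw [← sub_add_sub_cancel q.1 x ai, norm_add_sq_real, real_inner_comm]
      rw [e] at this
      rw [inner_add_left, real_inner_smul_left, real_inner_smul_left, en_inner, lastC_sub]
      have e' : u q = u (q.1, q.2) := rfl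
      rw [e']
      linarith
  have dq := real_inner_le_norm (v t) ((2 * k) • (x - ai) + (2 * C) • en d)
  have ck : ‖(2 * k) • (x - ai) + (2 * C) • en d‖ ≤ 4 * C := by
    refine (norm_add_le _ _).trans ?_
    rw [norm_smul, norm_smul, en_norm, Real.norm_of_nonneg PS, Real.norm_of_nonneg PS]
    linarith
  have eu := mul_le_mul (hDt.vb t) ck (norm_nonneg _) (by linarith [hDt.fo])
  simp only at fin
  linarith
theorem SD_sqrt {h : ℝ} (hh : 0 < h) (m A : ℝ) : SD (fun s => A * √(h + s * m)) (-(A / 4) * m ^ 2 / (√h) ^ 3) := by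
  have hd : ∀ s, 0 < h + s * m → HasDerivAt (fun s => √(h + s * m)) (m / (2 * √(h + s * m))) s := fun s hs => by
    have := (((hasDerivAt_id s).mul_const m).const_add h).sqrt hs.ne'
    simpa using this
  have hy := Real.sqrt_pos.2 hh
  refine SD.of_deriv (f' := fun s => A * (m / (2 * √(h + s * m)))) ?_ ?_
  · have : ∀ᶠ s in 𝓝 (0:ℝ), 0 < h + s * m := (Continuous.tendsto' FP 0 h (by simp)).eventually (lt_mem_nhds hh)
    filter_upwards [this] with s hs
    exact (hd s hs).const_mul A
  · have ab := hd 0 (by simpa using hh)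
    have af := ((ab.const_mul 2).fun_inv (by simpa using hy.ne')).const_mul (A * m)
    simp only [zero_mul, add_zero] at af
    have e : (fun s => A * (m / (2 * √(h + s * m)))) = fun s => A * m * (2 * √(h + s * m))⁻¹ := by ext s; ring
    rw [e]
    exact af.congr_deriv (by field_simp; ring)
theorem SD_inv4 {w : ℝ} (hw : 0 < w) (ay bm : ℝ) : SD (fun s => (w + ay * s - bm * s ^ 2)⁻¹ ^ 4) (8 * bm * w⁻¹ ^ 5 + 20 * ay ^ 2 * w⁻¹ ^ 6) := by
  have hq : ∀ s, HasDerivAt (fun s => w + ay * s - bm * s ^ 2) (ay - 2 * bm * s) s := fun s => by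
    have := (((hasDerivAt_id s).const_mul ay).const_add w).sub (((hasDerivAt_id s).pow 2).const_mul bm)
    exact this.congr_deriv (by simp; ring)
  have hi : ∀ s, 0 < w + ay * s - bm * s ^ 2 → HasDerivAt (fun s => (w + ay * s - bm * s ^ 2)⁻¹) (-(ay - 2 * bm * s) * (w + ay * s - bm * s ^ 2)⁻¹ ^ 2) s := fun s hs => by
    exact ((hq s).fun_inv hs.ne').congr_deriv (by field_simp)
  refine SD.of_deriv (f' := fun s => -4 * (ay - 2 * bm * s) * (w + ay * s - bm * s ^ 2)⁻¹ ^ 5) ?_ ?_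
  · have : ∀ᶠ s in 𝓝 (0:ℝ), 0 < w + ay * s - bm * s ^ 2 := (Continuous.tendsto' FP 0 w (by simp)).eventually (lt_mem_nhds hw)
    filter_upwards [this] with s hs
    exact ((hi s hs).fun_pow 4).congr_deriv (by push_cast; ring)
  · have ab := (hi 0 (by simpa using hw)).fun_pow 5
    have af : HasDerivAt (fun s => -4 * (ay - 2 * bm * s)) (8 * bm) 0 := by
      exact ((((hasDerivAt_id (0:ℝ)).const_mul (2 * bm)).const_sub ay).const_mul (-4)).congr_deriv (by ring)
    exact (af.mul ab).congr_deriv (by simp; ring)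
def Ps (A aa : ℝ) (c : Eucl (d + 1)) (ad : ℝ) (q : SpaceTime (d + 1)) : ℝ := A * √(lastC q.1) + (om (aa ^ 2) 0 0 c ad q)⁻¹ ^ 4
theorem tau_int (hDt : Dat d lam a b M bc Q v) (hi : IC lam Q (Kc d r) u ut g H) {av : ℝ} (et : 0 < av) (hA : 0 ≤ A) (hB : 0 ≤ B)
    (hx : (x, t) ∈ Kc d r) (hy : (x, t - av) ∈ Kc d r) (hxc : ‖x - c‖ ≤ 1) (ob : lastC x ≤ 1) (jr : 0 < om (aa ^ 2) 0 0 c ad (x, t)) (gp : om (aa ^ 2) 0 0 c ad (x, t) ≤ 1)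
    (hm : ∀ᶠ q in 𝓝 (x, t), q.2 ≤ t → lam / av * (u q - u (q.1, q.2 - av)) - Ps A aa c ad q ≤ lam / av * (u (x, t) - u (x, t - av)) - Ps A aa c ad (x, t))
    (hH : ‖H (x, t - av)‖ * lastC x ≤ B) (hZ : (om (aa ^ 2) 0 0 c ad (x, t))⁻¹ ^ 4 * lastC x ≤ (d + 1 : ℕ) * b * B)
    (hAA : 4 * ((4 + 88 * ((d + 1 : ℕ) * b)) * ((d + 1 : ℕ) * b * B + 1) ^ 3 + (d + 1 : ℕ) * (d + 1 : ℕ) * bc * B) < A * a) : False := by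
  have ai : 0 < lastC x := hx.2.1
  set k := lam / av with hk
  have cj : 0 < k := div_pos hDt.bo et
  set w := om (aa ^ 2) 0 0 c ad (x, t) with hw
  set i := w⁻¹ with hid
  have fd : 1 ≤ i := (one_le_inv₀ jr).2 gp
  set y := √(lastC x) with hyd
  have ie : 0 < y := Real.sqrt_pos.2 ai
  have yy : y ^ 2 = lastC x := Real.sq_sqrt ai.le
  have od : y ≤ 1 := Real.sqrt_le_one.2 ob
  have oe : i ^ 5 ≤ i ^ 6 := pow_le_pow_right₀ fd NN
  have jg : 0 ≤ i ^ 5 := PS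
  have key : ∀ m, k * (⟪H (x, t) m, m⟫ - ⟪H (x, t - av) m, m⟫) ≤ -(A / 4) / y ^ 3 * (lastC m * lastC m) + 88 * i ^ 6 * ‖m‖ ^ 2 := by
    intro m
    have bg := (((hi.smul k).sd Kc_POp hx m).sub ((hi.smul k).sd Kc_POp hy m)).le_of_eventually
      ((SD_sqrt ai (lastC m) A).add (SD_inv4 jr (-2 * ⟪x - c, m⟫) (‖m‖ ^ 2))) (by
        have ab : Tendsto (fun ah : ℝ => (x + ah • m, t)) (𝓝 0) (𝓝 (x, t)) := Continuous.tendsto' FP _ _ (by simp)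
        filter_upwards [ab.eventually hm] with ah ba
        have := ba le_rfl
        have e : om (aa ^ 2) 0 0 c ad (x + ah • m, t) = w + -2 * ⟪x - c, m⟫ * ah - ‖m‖ ^ 2 * ah ^ 2 := by
          rw [om_line x t, ← hw, inner_smul_right, norm_smul, Real.norm_eq_abs, mul_pow, sq_abs]; ring
        simp only [Ps, e, ← hw, ← hid, lastC_add, lastC_smul] at this
        simp only [zero_smul, add_zero, zero_mul, mul_zero]
        norm_num at this ⊢
        have ei : i ^ 4 = (w ^ 4)⁻¹ := by rw [hid, inv_pow]
        linarith)
    have af : ⟪x - c, m⟫ ^ 2 ≤ ‖m‖ ^ 2 := by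
      rw [← sq_abs]
      refine pow_le_pow_left₀ (abs_nonneg _) ((abs_real_inner_le_norm _ _).trans ?_) 2
      exact mul_le_of_le_one_left (norm_nonneg _) hxc
    have aj := mll af (by positivity : 0 ≤ 80 * i ^ 6)
    have aw := mlr oe (by positivity : 0 ≤ 8 * ‖m‖ ^ 2)
    simp only [smul_apply, real_inner_smul_left, ← hid, ← hyd] at bg
    have e : -(A / 4) / y ^ 3 * (lastC m * lastC m) = -(A / 4) * lastC m ^ 2 / y ^ 3 := by ring
    rw [e]
    linarith
  have ht : -4 * i ^ 5 ≤ k * (ut (x, t) - ut (x, t - av)) := by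
    have hc : HasDerivWithinAt (fun s => u (x, s - av)) (ut (x, t - av)) (Iic 0) t := by
      have := (hi.dt _ hy).comp t ((hasDerivAt_id t).sub_const av).hasDerivWithinAt (s := Iic 0) (fun s hs => by simp only [mem_Iic, id] at hs ⊢; linarith)
      simpa [Function.comp_def] using this
    have bj : HasDerivAt (fun s => (om (aa ^ 2) 0 0 c ad (x, s))⁻¹ ^ 4) (-4 * i ^ 5) t := by
      have ab : HasDerivAt (fun s => om (aa ^ 2) 0 0 c ad (x, s)) 1 t := by
        have e : (fun s => om (aa ^ 2) 0 0 c ad (x, s)) = fun s => id s + (w - t) := by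
          ext s
          simp only [hw, om, id]; ring
        rw [e]; exact (hasDerivAt_id t).add_const (w - t)
      exact ((ab.fun_inv jr.ne').fun_pow 4).congr_deriv (by rw [← hw, hid]; push_cast; field_simp)
    refine left_deriv_le (((hi.dt _ hx).sub hc).const_mul k) (Kc_POp _ hx).1 bj ?_
    have ab : Tendsto (fun s : ℝ => (x, s)) (𝓝[<] t) (𝓝 (x, t)) := (Continuous.tendsto' FP _ _ rfl).mono_left nhdsWithin_le_nhds
    filter_upwards [ab.eventually hm, self_mem_nhdsWithin] with s ba bb
    have := ba (le_of_lt bb)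
    simp only [Ps, Pi.sub_apply] at this ⊢
    linarith
  obtain ⟨m, fm, hms, hmq⟩ := (hDt.ell t).vecs hDt.ec.le
  have eh := hi.pde _ hx
  have eo := hi.pde _ hy
  have bw := op_sub_left (Q t) (Q (t - av)) (H (x, t - av))
  have bn := op_abs_le (Q := Q t - Q (t - av)) (az := bc / lam * av) (fun i j => by
    have := hDt.lip t (t - av) i j
    rwa [sub_sub_cancel, abs_of_pos et] at this) (H (x, t - av))
  have ch : k * op (Q t - Q (t - av)) (H (x, t - av)) ≤ (d + 1 : ℕ) * (d + 1 : ℕ) * bc * ‖H (x, t - av)‖ := by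
    refine (mll ((le_abs_self _).trans bn) cj.le).trans_eq ?_
    rw [hk]; have := hDt.bo; field_simp
  have bu : k * (op (Q t) (H (x, t)) - op (Q t) (H (x, t - av))) ≤ -(A * a / 4) / y ^ 3 + 88 * i ^ 6 * ((d + 1 : ℕ) * b) := by
    rw [fm, fm, ← Finset.sum_sub_distrib, Finset.mul_sum]
    refine (Finset.sum_le_sum fun j _ => key (m j)).trans ?_
    rw [Finset.sum_add_distrib, ← Finset.mul_sum, ← Finset.mul_sum]
    refine add_le_add ?_ (mll hms PS)
    have : a ≤ ∑ j, lastC (m j) * lastC (m j) := ((hDt.ell t).le_diag (Fin.last d)).trans_eq (hmq _).symm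
    have := mll this (by positivity : 0 ≤ A / 4 / y ^ 3)
    have e : -(A * a / 4) / y ^ 3 = -(A / 4 / y ^ 3 * a) := by ring
    have e' : -(A / 4) / y ^ 3 = -(A / 4 / y ^ 3) := by ring
    rw [e, e']; linarith
  have am := mll ht hDt.bo.le
  have dj := mlr hDt.cd (by positivity : 0 ≤ 4 * i ^ 5)
  have ba : lam * (k * (ut (x, t) - ut (x, t - av))) = k * (op (Q t) (H (x, t)) - op (Q t) (H (x, t - av))) + k * op (Q t - Q (t - av)) (H (x, t - av)) := by
    rw [bw]
    simp only at eh eo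
    rw [← eh, ← eo]; ring
  have all : 0 ≤ (4 + 88 * ((d + 1 : ℕ) * b)) * i ^ 6 + (d + 1 : ℕ) * (d + 1 : ℕ) * bc * ‖H (x, t - av)‖ + -(A * a / 4) / y ^ 3 := LN
  have og := mul_nonneg all (by positivity : 0 ≤ y ^ 3)
  have bb : ((4 + 88 * ((d + 1 : ℕ) * b)) * i ^ 6 + (d + 1 : ℕ) * (d + 1 : ℕ) * bc * ‖H (x, t - av)‖ + -(A * a / 4) / y ^ 3) * y ^ 3 =
      (4 + 88 * ((d + 1 : ℕ) * b)) * (i ^ 2 * y) ^ 3 + (d + 1 : ℕ) * (d + 1 : ℕ) * bc * (‖H (x, t - av)‖ * y ^ 2) * y - A * a / 4 := by field_simp; ring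
  rw [bb, yy] at og
  have dr : (i ^ 2 * y) ^ 2 ≤ (d + 1 : ℕ) * b * B := by
    have : (i ^ 2 * y) ^ 2 = i ^ 4 * y ^ 2 := by ring
    rw [this, yy]; exact hZ
  have ds : i ^ 2 * y ≤ (d + 1 : ℕ) * b * B + 1 := by nlinarith only [dr, sq_nonneg (i ^ 2 * y - 1)]
  have cv := pow_le_pow_left₀ PS ds 3
  have dy := hDt.dy
  have fk := hDt.fk
  have ed := mll cv (by positivity : 0 ≤ 4 + 88 * (((d + 1 : ℕ) : ℝ) * b))
  have fi := mul_le_mul hH od ie.le hB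
  have fr := mll fi (by positivity : 0 ≤ ((d + 1 : ℕ) : ℝ) * (d + 1 : ℕ) * bc)
  linarith
theorem tau (hDt : Dat d lam a b M bc Q v) (hi : IC lam Q (Kc d r) u ut g H) (hu : ContinuousOn u (KcP d r)) (hr : r ≤ 1) {L ff : ℝ} (et : 0 < ff) (hA : 0 ≤ A) (hB : 0 ≤ B)
    (hL : 0 ≤ L) (ar : 0 < aa) (cn : aa ≤ 1) (hc : 0 < lastC c)
    (hcyl : ∀ x t, ‖x - c‖ ≤ aa → 0 ≤ lastC x → t ∈ Icc (ad - aa ^ 2 - ff) ad → (x, t) ∈ KcP d r)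
    (hH : ∀ x t, ‖x - c‖ ≤ aa → 0 < lastC x → t ∈ Icc (ad - aa ^ 2 - ff) ad → ‖H (x, t)‖ * lastC x ≤ B)
    (hF : ∀ x t s, ‖x - c‖ ≤ aa → lastC x = 0 → s ∈ Icc (ad - aa ^ 2 - ff) ad → t ∈ Icc s ad → u (x, t) - u (x, s) ≤ L * (t - s))
    (hAA : 4 * ((4 + 88 * ((d + 1 : ℕ) * b)) * ((d + 1 : ℕ) * b * B + 1) ^ 3 + (d + 1 : ℕ) * (d + 1 : ℕ) * bc * B) < A * a) :
    lam * ut (c, ad) ≤ L + A + aa⁻¹ ^ 8 := by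
  have bo := hDt.bo
  have lc := lastC_cont (d := d)
  have gl : aa ^ 2 ≤ 1 := pow_le_one₀ ar.le cn
  have fu : (c, ad) ∈ KcP d r := hcyl c ad (by simpa using ar.le) hc.le ⟨by linarith [sq_nonneg aa], le_rfl⟩
  have key : ∀ av, 0 < av → av ≤ ff → lam / av * (u (c, ad) - u (c, ad - av)) ≤ L + A + aa⁻¹ ^ 8 := by
    intro av ci qm
    by_contra hcon
    push Not at hcon
    set k := lam / av with hk
    have cj : 0 < k := div_pos bo ci
    set W : SpaceTime (d + 1) → ℝ := fun q => k * (u q - u (q.1, q.2 - av)) with hW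
    set N : Set (SpaceTime (d + 1)) := (closedBall c aa ×ˢ Icc (ad - aa ^ 2) ad) ∩ {q | 0 ≤ lastC q.1} with hN
    have Nc : IsCompact N := ((isCompact_closedBall c aa).prod isCompact_Icc).inter_right (isClosed_le continuous_const (lc.comp continuous_fst))
    have Nm : ∀ q ∈ N, ‖q.1 - c‖ ≤ aa ∧ 0 ≤ lastC q.1 ∧ q.2 ∈ Icc (ad - aa ^ 2) ad := fun q hq => ⟨by rw [← dist_eq_norm]; exact hq.1.1, hq.2, hq.1.2⟩
    have Nk : ∀ q ∈ N, q ∈ KcP d r ∧ (q.1, q.2 - av) ∈ KcP d r := fun q hq => by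
      obtain ⟨ab, af, aj, aw⟩ := Nm q hq
      exact ⟨hcyl q.1 q.2 ab af ⟨LN, aw⟩, hcyl q.1 (q.2 - av) ab af ⟨LN, LN⟩⟩
    have Wc : ContinuousOn W N := continuousOn_const.mul ((hu.mono fun q hq => (Nk q hq).1).sub
      (hu.comp (f := fun q : SpaceTime (d + 1) => (q.1, q.2 - av)) FP fun q hq => (Nk q hq).2))
    obtain ⟨js, iq⟩ := Nc.exists_bound_of_continuousOn Wc
    have Nin : ∀ q : SpaceTime (d + 1), 0 ≤ om (aa ^ 2) 0 0 c ad q → 0 ≤ lastC q.1 → q.2 ≤ ad → q ∈ N := fun q ab af aj => by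
      simp only [om] at ab
      refine ⟨⟨?_, by linarith [sq_nonneg ‖q.1 - c‖], aj⟩, af⟩
      rw [mem_closedBall, dist_eq_norm]
      exact le_of_sq_le_sq LN ar.le
    have oc : om (aa ^ 2) 0 0 c ad (c, ad) = aa ^ 2 := by simp [om]
    have cN : (c, ad) ∈ N := Nin _ (by rw [oc]; positivity) hc.le le_rfl
    have qn : 0 ≤ js := (norm_nonneg _).trans (iq _ cN)
    set az := (js + 1 + (aa ^ 2)⁻¹)⁻¹ with bv
    have fn : 0 < az := PS
    have oh : az ≤ (js + 1)⁻¹ := inv_anti₀ LN (by linarith [inv_pos.2 (by positivity : 0 < aa ^ 2)])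
    have ll : az ≤ aa ^ 2 := by
      rw [bv, inv_le_comm₀ PS PS]; linarith
    set K : Set (SpaceTime (d + 1)) := N ∩ {q | az ≤ om (aa ^ 2) 0 0 c ad q} with hK
    have Kcp : IsCompact K := Nc.inter_right (isClosed_le continuous_const om_cont)
    have fc : ContinuousOn (fun q => W q - Ps A aa c ad q) K := by
      refine (Wc.mono inter_subset_left).sub ?_
      unfold Ps
      refine ContinuousOn.add FP ((ContinuousOn.inv₀ om_cont.continuousOn fun q hq => ?_).pow 4)
      exact (fn.trans_le hq.2).ne'
    obtain ⟨⟨x, t⟩, ⟨hxN, hxo⟩, hmax⟩ := Kcp.exists_isMaxOn ⟨_, cN, by rw [mem_setOf_eq, oc]; exact ll⟩ fc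
    have hmax : ∀ q ∈ K, W q - Ps A aa c ad q ≤ W (x, t) - Ps A aa c ad (x, t) := fun q hq => hmax hq
    obtain ⟨co, dw, eg, em⟩ := Nm _ hxN
    obtain ⟨cf, cx⟩ := Nk _ hxN
    simp only at co dw eg em
    have hxo : az ≤ om (aa ^ 2) 0 0 c ad (x, t) := hxo
    have ba := hmax _ ⟨cN, by rw [mem_setOf_eq, oc]; exact ll⟩
    have bl : lastC c ≤ 1 := ((le_abs_self _).trans (lastC_le c)).trans (by linarith [(KcP_mem fu).1])
    have bb : Ps A aa c ad (c, ad) ≤ A + aa⁻¹ ^ 8 := by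
      simp only [Ps, oc]
      have := mll (Real.sqrt_le_one.2 bl) hA
      have e : (aa ^ 2)⁻¹ ^ 4 = aa⁻¹ ^ 8 := by rw [← inv_pow, ← pow_mul]
      rw [e]; linarith
    have bt : L < W (x, t) - Ps A aa c ad (x, t) := lt_of_lt_of_le (by simp only [hW]; linarith) ba
    have ey : om (aa ^ 2) 0 0 c ad (x, t) ≤ 1 := by simp only [om]; linarith [sq_nonneg ‖x - c‖]
    have jt : 0 < om (aa ^ 2) 0 0 c ad (x, t) := fn.trans_le hxo
    set w := om (aa ^ 2) 0 0 c ad (x, t) with hw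
    have fd : 1 ≤ w⁻¹ := (one_le_inv₀ jt).2 ey
    have br : 0 ≤ A * √(lastC x) := PS
    have ef : L + A * √(lastC x) + w⁻¹ ^ 4 < W (x, t) := by simp only [Ps, ← hw] at bt; linarith
    have jf : 0 ≤ w⁻¹ ^ 4 := PS
    have fg : az < w := by
      refine oh.trans_lt ?_
      rw [inv_lt_comm₀ LN jt]
      have := le_self_pow₀ fd (by norm_num : (4:ℕ) ≠ 0)
      linarith [(le_abs_self _).trans (iq _ hxN)]
    have xn : 0 < lastC x := by
      rcases dw.eq_or_lt with h | h
      · exfalso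
        have := mll (hF x t (t - av) co h.symm ⟨LN, LN⟩ ⟨LN, em⟩) cj.le
        have e : k * (L * (t - (t - av))) = lam * L := by rw [hk]; field_simp; ring
        have := mlr hDt.cd hL
        simp only [hW] at ef
        linarith
      · exact h
    have gk : lastC x ≤ 1 := ((le_abs_self _).trans (lastC_le x)).trans (by linarith [(KcP_mem cf).1])
    have hZ : W (x, t) * lastC x ≤ (d + 1 : ℕ) * b * B := by
      have := hi.tmv (x := x) (am := t - av) (dj := t) (C := (d + 1 : ℕ) * b * B / lastC x / lam) LN (KcP_mem cf).2.2.2 fun s hs => by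
        have hs' : s ∈ Icc (ad - aa ^ 2 - ff) ad := ⟨by linarith [hs.1], hs.2.trans em⟩
        have hm := Kc_of (hcyl x s co xn.le hs') xn
        refine ⟨hm, ?_⟩
        rw [le_div_iff₀ bo, mul_comm, hi.pde _ hm, le_div_iff₀ xn]
        have ab := (le_abs_self _).trans ((hDt.ell s).op_le hDt.ec.le (H (x, s)))
        have af := mlr ab xn.le
        have aj := mll (hH x s co xn hs') (by have := hDt.dy; positivity : 0 ≤ ((d + 1 : ℕ) : ℝ) * b)
        simp only at af ⊢
        linarith
      have := mll this (by positivity : 0 ≤ k * lastC x)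
      have e : k * lastC x * ((d + 1 : ℕ) * b * B / lastC x / lam * (t - (t - av))) = (d + 1 : ℕ) * b * B := by
        rw [hk]; field_simp; ring
      simp only [hW]
      linarith
    refine tau_int hDt hi ci hA hB (Kc_of cf xn) (Kc_of cx xn) (co.trans cn) gk jt ey ?_ (hH x _ co xn ⟨LN, LN⟩)
      ((mlr LN xn.le).trans hZ) hAA
    have jl : ∀ᶠ q in 𝓝 (x, t), az < om (aa ^ 2) 0 0 c ad q := (om_cont.tendsto _).eventually (lt_mem_nhds fg)
    have jm : ∀ᶠ q : SpaceTime (d + 1) in 𝓝 (x, t), 0 < lastC q.1 := ((lc.comp continuous_fst).tendsto (x, t)).eventually (lt_mem_nhds xn)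
    filter_upwards [jl, jm] with q ab af aj
    exact hmax q ⟨Nin q (fn.le.trans ab.le) af.le (aj.trans em), ab.le⟩
  have hm := Kc_of fu hc
  have := left_deriv_le (ao := fun s => -((L + A + aa⁻¹ ^ 8) / lam) * s) (hi.dt _ hm).neg (Kc_POp _ hm).1 (((hasDerivAt_id ad).const_mul (-((L + A + aa⁻¹ ^ 8) / lam))).congr_deriv (mul_one _)) (by
    filter_upwards [self_mem_nhdsWithin, mem_nhdsWithin_of_mem_nhds (Ioi_mem_nhds (by linarith : ad - ff < ad))] with s ab af
    simp only [mem_Iio, mem_Ioi] at ab af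
    have := key (ad - s) LN LN
    rw [div_mul_eq_mul_div, div_le_iff₀ LN, sub_sub_cancel] at this
    simp only [Pi.neg_apply]
    have e : -((L + A + aa⁻¹ ^ 8) / lam) * s - -((L + A + aa⁻¹ ^ 8) / lam) * ad = (L + A + aa⁻¹ ^ 8) * (ad - s) / lam := by ring
    rw [e, le_div_iff₀ bo]; linarith)
  rw [neg_le_neg_iff, le_div_iff₀ bo] at this
  linarith
theorem gb (hi : IC lam Q (Kc d r) u ut g H) (hr : r' ≤ r) (ar : 0 < aa) (hC : 0 ≤ C)
    (hl : ∀ t x y, (x, t) ∈ KcP d r' → (y, t) ∈ KcP d r' → ‖x - y‖ ≤ aa → |u (x, t) - u (y, t)| ≤ C * ‖x - y‖) (hp : p ∈ Kc d r') : ‖g p‖ ≤ C := by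
  obtain ⟨bw, bn, ch, bu⟩ := KcP_mem (Or.inl hp)
  have fz : p ∈ Kc d r := Kc_of (KcP_of (bw.trans_le hr) bn LN bu) hp.2.1
  refine norm_le_of_inner hC fun e he => grad_le hi fz e ?_
  have hn := Kc_POp.nhds hp
  have bl : Tendsto (fun s : ℝ => p.1 + (1 / 2 : ℝ) • s • e) (𝓝[>] 0) (𝓝 p.1) :=
    tendsto_nhdsWithin_of_tendsto_nhds ((by fun_prop : Continuous fun s : ℝ => p.1 + (1 / 2 : ℝ) • s • e).tendsto' _ _ (by simp))
  have bq : Tendsto (fun s : ℝ => p.1 - (1 / 2 : ℝ) • s • e) (𝓝[>] 0) (𝓝 p.1) :=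
    tendsto_nhdsWithin_of_tendsto_nhds ((by fun_prop : Continuous fun s : ℝ => p.1 - (1 / 2 : ℝ) • s • e).tendsto' _ _ (by simp))
  filter_upwards [bl.eventually hn, bq.eventually hn, self_mem_nhdsWithin, mem_nhdsWithin_of_mem_nhds (Iio_mem_nhds ar)] with s ab af aj aw
  simp only [mem_Ioi, mem_Iio] at aj aw
  have ba : p.1 + (1 / 2 : ℝ) • s • e - (p.1 - (1 / 2 : ℝ) • s • e) = s • e := by module
  have bb : ‖p.1 + (1 / 2 : ℝ) • s • e - (p.1 - (1 / 2 : ℝ) • s • e)‖ = s := by rw [ba, norm_smul, he, mul_one, Real.norm_of_nonneg aj.le]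
  have := hl p.2 _ _ (Or.inl ab) (Or.inl af) (bb.trans_le aw.le)
  rw [bb] at this
  exact (le_abs_self _).trans this
theorem oi (hDt : Dat d lam a b M bc Q v) (hi : IC lam Q (Kc d 1) u ut g H) {ax : ℝ} (hS : 0 ≤ S) (hA : 8 ≤ ax)
    (cz : (d + 1 : ℕ) * b * 40 + 1 < a * ax ^ 2) (hg : ∀ p ∈ Kc d (93 / 100), ‖g p‖ ≤ S) (hp : (x, t) ∈ Kc d (8 / 10)) :
    ‖H (x, t)‖ * lastC x ≤ 40 * S * ax := by
  obtain ⟨bw, bn, ch, bu⟩ := KcP_mem (Or.inl hp)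
  have gq := hp.2.1
  simp only at gq bw bn ch bu
  have qo := (abs_le.1 (lastC_le x)).2
  have hl := hDt.cd
  have := INTH (c := x) (ad := t) (ah := lastC x / 40) Kc_POp hi hDt.ec hDt.dy hDt.bo hS hA cz LN (fun s _ => hDt.ell s) (fun y s ab af => by
    have dr : lam * (lastC x / 40) ^ 2 ≤ 1 * (1 / 40) ^ 2 := by
      have := hDt.bo
      gcongr; linarith
    have ds : ‖y‖ ≤ ‖x‖ + ‖y - x‖ := by simpa using norm_add_le x (y - x)
    have cv := (abs_le.1 (lastC_le (y - x))).1
    rw [lastC_sub] at cv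
    have fi : s ≤ 0 := af.2.trans bu
    have fr : -(93 / 100) < s := by linarith [af.1]
    have ed : (y, s) ∈ Kc d (93 / 100) := Kc_of (KcP_of (by simp only; linarith) (by simp only; linarith) fr fi) (by simp only; linarith)
    exact ⟨Kc_of (KcP_of (by simp only; linarith) (by simp only; linarith) (by simp only; linarith) fi) (by simp only; linarith), hg _ ed⟩)
  have af := mlr this gq.le
  have e : S * ax / (lastC x / 40) * lastC x = 40 * S * ax := by field_simp
  rwa [e] at af
theorem utb (hDt : Dat d lam a b M bc Q v) (hs : Sol lam Q v 1 u) (hi : IC lam Q (Kc d 1) u ut g H) (hA : 0 ≤ A) (hB : 0 ≤ B) (hC : 0 < C)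
    (hl : ∀ t x y, (x, t) ∈ KcP d (93 / 100) → (y, t) ∈ KcP d (93 / 100) → ‖x - y‖ ≤ 1 / 100 → |u (x, t) - u (y, t)| ≤ C * ‖x - y‖)
    (hH : ∀ x t, (x, t) ∈ Kc d (8 / 10) → ‖H (x, t)‖ * lastC x ≤ B)
    (hAA : 4 * ((4 + 88 * ((d + 1 : ℕ) * b)) * ((d + 1 : ℕ) * b * B + 1) ^ 3 + (d + 1 : ℕ) * (d + 1 : ℕ) * bc * B) < A * a) (hp : p ∈ Kc d (1 / 2)) : lam * ut p ≤ (4 * C * M + 1) + A + 10 ^ 8 := by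
  obtain ⟨c, ad⟩ := p
  obtain ⟨bw, bn, ch, bu⟩ := KcP_mem (Or.inl hp)
  have gq := hp.2.1
  simp only at gq bw bn ch bu
  have hm : ∀ x t, ‖x - c‖ ≤ 11 / 100 → 0 ≤ lastC x → t ∈ Icc (ad - (1 / 10) ^ 2 - 1 / 10) ad → (x, t) ∈ KcP d (8 / 10) := fun x t ab af aj => by
    have ds : ‖x‖ ≤ ‖c‖ + ‖x - c‖ := by simpa using norm_add_le c (x - c)
    exact KcP_of (by simp only; linarith) af (by simp only; linarith [aj.1]) (aj.2.trans bu)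
  have up : ∀ {r' : ℝ} {q}, 8 / 10 ≤ r' → q ∈ KcP d (8 / 10) → q ∈ KcP d r' := fun h hq => by
    obtain ⟨bw, bn, ch, bu⟩ := KcP_mem hq
    exact KcP_of LN bn LN bu
  have hM := hDt.fo
  have := tau (aa := 1 / 10) (ff := 1 / 10) (L := 4 * C * M + 1) hDt hi hs.cont le_rfl NN hA hB PS NN NN gq
    (fun x t ab af aj => up NN (hm x t LN af aj)) (fun x t ab af aj => hH x t (Kc_of (hm x t LN af.le aj) af)) (fun x t s ab af aj aw => ?_) hAA
  · refine this.trans NN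
  · refine timF (aa := 1 / 100) hDt hs hC NN af aw.1 fun y w bp ce go => ?_
    have df : ‖y - c‖ ≤ 11 / 100 := by
      have : y - c = (y - x) + (x - c) := by abel
      rw [this]; exact (norm_add_le _ _).trans LN
    have kw : w ∈ Icc (ad - (1 / 10) ^ 2 - 1 / 10) ad := ⟨aj.1.trans go.1, go.2.trans aw.2⟩
    have dl := up (r' := 93 / 100) NN (hm y w df ce kw)
    have cy := up (r' := 93 / 100) NN (hm x w LN af.ge kw)
    have dm : (pj y, w) ∈ KcP d (93 / 100) := KcP_dn (q := (y, w)) dl ce le_rfl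
    have dr : lastC y ≤ 1 / 100 := by
      have := (abs_le.1 (lastC_le (y - x))).2
      rw [lastC_sub] at this; linarith
    have cv : ‖y - pj y‖ = lastC y := by
      rw [pj, sub_sub_cancel, norm_smul, en_norm, mul_one, Real.norm_of_nonneg ce]
    refine ⟨up NN (hm y w df ce kw), hl w y x dl cy bp, ?_⟩
    have := hl w y (pj y) dl dm (cv.trans_le dr)
    rwa [cv] at this
theorem hess_le {gr : Matrix (Fin (d + 1)) (Fin (d + 1)) ℝ} (hE : Ell a b gr) (ha : 0 < a) (hb : 0 < b) {T : ℝ} (hT : 0 ≤ T) (hK : 0 ≤ K) {h : Eucl (d + 1) →L[ℝ] Eucl (d + 1)}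
    (hs : ∀ ag cc, ⟪h ag, cc⟫ = ⟪h cc, ag⟫) (ht : ∀ e, lastC e = 0 → ‖h e‖ ≤ T * ‖e‖) (ho : |op gr h| ≤ K) :
    ‖h‖ ≤ 2 * T + (K + (d + 1 : ℕ) * b * (2 * T)) / a := by
  set m := lastC (h (en d)) with hm
  have am : ‖pj (h (en d))‖ ≤ T := norm_le_of_inner hT fun e he => by
    rw [← pj_inner, hs, inner_en]
    have ab := (le_abs_self _).trans (lastC_le (h (pj e)))
    have af := ht _ (pj_last e)
    have aj := pj_le e
    rw [he] at aj
    nlinarith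
  let E : Eucl (d + 1) →L[ℝ] Eucl (d + 1) := (innerSL ℝ (en d)).smulRight (en d)
  have hEx : ∀ x, E x = lastC x • en d := fun x => by simp [E, en_inner]
  have hEn : ‖E‖ ≤ 1 := ContinuousLinearMap.opNorm_le_bound _ zero_le_one fun x => by
    rw [hEx, norm_smul, en_norm, mul_one, one_mul]; exact lastC_le x
  have hR : ‖h - m • E‖ ≤ 2 * T := ContinuousLinearMap.opNorm_le_bound _ PS fun x => by
    have e : (h - m • E) x = h (pj x) + lastC x • pj (h (en d)) := by
      rw [ContinuousLinearMap.sub_apply, ContinuousLinearMap.smul_apply, hEx, pj, pj, map_sub, map_smul, ← hm]; module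
    rw [e]
    refine (norm_add_le _ _).trans ?_
    rw [norm_smul, Real.norm_eq_abs]
    have af := ht _ (pj_last x)
    have aj := mll (pj_le x) hT
    have aw := mul_le_mul (lastC_le x) am (norm_nonneg _) (norm_nonneg x)
    linarith
  have oE : op gr E = gr (Fin.last d) (Fin.last d) := by
    simp only [op, hEx]
    rw [Finset.sum_eq_single (Fin.last d), Finset.sum_eq_single (Fin.last d)]
    · simp [en, lastC]
    · intro j _ hj; simp [lastC, hj.symm]
    · simp
    · intro i _ hi; simp [en, hi]
    · simp
  have ey := hE.op_le ha.le (h - m • E)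
  rw [op_sub, op_smul, oE] at ey
  have gy : |m * gr (Fin.last d) (Fin.last d)| ≤ K + (d + 1 : ℕ) * b * (2 * T) := by
    have := mll hR (by positivity : 0 ≤ ((d + 1 : ℕ) : ℝ) * b)
    rw [abs_le] at *
    constructor <;> linarith [ey.1, ey.2, ho.1, ho.2]
  have lm := hE.le_diag (Fin.last d)
  rw [abs_mul, abs_of_nonneg (ha.le.trans lm)] at gy
  have oj : |m| ≤ (K + (d + 1 : ℕ) * b * (2 * T)) / a := by
    rw [le_div_iff₀ ha]
    exact (mll lm (abs_nonneg m)).trans gy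
  have e : h = (h - m • E) + m • E := by abel
  rw [e]
  refine (norm_add_le _ _).trans (add_le_add hR ?_)
  rw [norm_smul, Real.norm_eq_abs]
  exact (mul_le_of_le_one_right (abs_nonneg m) hEn).trans oj
theorem fin_est (d : ℕ) (ha : 0 < a) (hb : 0 < b) (hM : 1 ≤ M) (fh : 0 ≤ bc) : ∃ C > 0, ∀ {lam : ℝ} {Q v}, Dat d lam a b M bc Q v →
    ∀ {u ut g H}, Sol lam Q v 1 u → (∀ p ∈ KcP d 1, |u p| ≤ 1) → IC lam Q (Kc d 1) u ut g H → ∀ p ∈ Kc d (1 / 2), ‖g p‖ ≤ C ∧ ‖H p‖ ≤ C := by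
  obtain ⟨fj, bl, ab⟩ := lip d ha hb hM (aa := 1 / 100) NN NN
  obtain ⟨dh, bq, af⟩ := tan d ha hb hM (aa := 1 / 100) NN NN
  obtain ⟨ax, ok, cz⟩ : ∃ ax : ℝ, 8 ≤ ax ∧ (d + 1 : ℕ) * b * 40 + 1 < a * ax ^ 2 := by
    refine ⟨8 + ((d + 1 : ℕ) * b * 40 + 2) / a, le_add_of_nonneg_right PS, ?_⟩
    set y := ((d + 1 : ℕ) * b * 40 + 2) / a with hy
    have ie : 0 ≤ y := PS
    have e : a * y = (d + 1 : ℕ) * b * 40 + 2 := by rw [hy]; field_simp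
    have : a * y ≤ a * (8 + y) ^ 2 := mll (by nlinarith) ha.le
    linarith
  set B := 40 * fj * ax with hB
  have ib : 0 ≤ B := PS
  obtain ⟨A, ln, hA⟩ : ∃ A : ℝ, 0 ≤ A ∧ 4 * ((4 + 88 * ((d + 1 : ℕ) * b)) * ((d + 1 : ℕ) * b * B + 1) ^ 3 + (d + 1 : ℕ) * (d + 1 : ℕ) * bc * B) < A * a := by
    set Z := 4 * ((4 + 88 * ((d + 1 : ℕ) * b)) * ((d + 1 : ℕ) * b * B + 1) ^ 3 + (d + 1 : ℕ) * (d + 1 : ℕ) * bc * B) with hZ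
    have qp : 0 ≤ Z := PS
    exact ⟨(Z + 1) / a, PS, by rw [div_mul_cancel₀ _ ha.ne']; linarith⟩
  set K := (4 * fj * M + 1) + A + 10 ^ 8 with hK
  have fe : 0 ≤ K := PS
  set T := fj * dh with hT
  have ig : 0 < T := PS
  refine ⟨fj + (2 * T + (K + (d + 1 : ℕ) * b * (2 * T)) / a), PS, fun {lam Q v} hDt {u ut g H} hs hu hi p hp => ?_⟩
  have hl : ∀ t x y, (x, t) ∈ KcP d (93 / 100) → (y, t) ∈ KcP d (93 / 100) → ‖x - y‖ ≤ 1 / 100 → |u (x, t) - u (y, t)| ≤ fj * ‖x - y‖ := by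
    have := ab hDt le_rfl one_pos hs hu
    norm_num at this ⊢
    exact this
  have hg : ∀ p ∈ Kc d (93 / 100), ‖g p‖ ≤ fj := fun p hp => gb hi NN (by norm_num : (0:ℝ) < 1 / 100) bl.le hl hp
  have hHB : ∀ x t, (x, t) ∈ Kc d (8 / 10) → ‖H (x, t)‖ * lastC x ≤ B := fun x t h => oi hDt hi bl.le ok cz hg h
  have qq := utb hDt hs hi ln ib bl hl hHB hA hp
  have qr := utb hDt hs.neg hi.neg ln ib bl (fun t x y ab af aj => by
    have := hl t x y ab af aj
    rwa [← abs_neg, neg_sub, ← neg_sub_neg] at this) (fun x t h => by rw [norm_neg]; exact hHB x t h) hA hp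
  obtain ⟨bw, bn, ch, bu⟩ := KcP_mem (Or.inl hp)
  have up : ∀ {r' : ℝ}, 1 / 2 ≤ r' → p ∈ Kc d r' := fun h => Kc_of (KcP_of LN bn LN bu) hp.2.1
  have ho : |op (Q p.2) (H p)| ≤ K := by
    rw [← hi.pde p (up NN), abs_le]; constructor <;> linarith
  have hsy := grad_symm (f := fun y => u (y, p.2)) (g := fun y => g (y, p.2)) (x := p.1) (H := H p)
    ((Kc_POp.nhds (up (r' := 1) NN)).mono fun y hy => hi.dg (y, p.2) hy) (hi.dH p (up NN))
  have key : ∀ k, lastC k = 0 → ‖k‖ ≤ 1 / 100 → ‖g (p.1 + k, p.2) - g p‖ ≤ T * ‖k‖ := fun k cj bp => by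
    by_cases hk : k = 0
    · subst hk; simp
    have kp : 0 < ‖k‖ := norm_pos_iff.2 hk
    have es : (97 / 100 : ℝ) + ‖k‖ ≤ 1 := LN
    have gp := (hs.trans cj es).sub' hDt (hs.mono (by norm_num : (97 / 100 : ℝ) ≤ 1))
    have jn := (hi.trans (D' := Kc d (97 / 100)) k (fun p hp => (KcP_tr cj es).2.2 hp)).sub (hi.mono (fun p hp => by
      obtain ⟨bw, bn, ch, bu⟩ := KcP_mem (Or.inl hp)
      exact Kc_of (KcP_of LN bn LN bu) hp.2.1))
    have lg : ∀ p ∈ KcP d (97 / 100), |u (p.1 + k, p.2) - u p| ≤ dh * ‖k‖ := fun p hp => by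
      have := af hDt le_rfl one_pos hs hu p (by norm_num; exact hp) k cj bp
      rwa [mul_one] at this
    have lh := ab hDt NN PS gp lg
    refine gb (g := fun p => g (p.1 + k, p.2) - g p) (p := p) (r' := 97 / 100 - 7 * (1 / 100)) jn NN (by norm_num : (0:ℝ) < 1 / 100) PS (fun t x y dr ds cv => ?_) (up NN)
    refine (lh t x y dr ds cv).trans (le_of_eq (by rw [hT]; ring))
  have hTT : ∀ e, lastC e = 0 → ‖H p e‖ ≤ T * ‖e‖ := fun e he => by
    have ol := hi.dH p (up NN)
    have oo : HasDerivAt (fun s : ℝ => p.1 + s • e) e 0 := by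
      have := ((hasDerivAt_id (0:ℝ)).smul_const e).const_add p.1
      rwa [one_smul] at this
    have oq : HasDerivAt (fun s : ℝ => g (p.1 + s • e, p.2)) (H p e) 0 := by
      have ot : HasFDerivAt (fun y => g (y, p.2)) (H p) (p.1 + (0:ℝ) • e) := by simpa using ol
      exact ot.comp_hasDerivAt (0:ℝ) oo
    refine oq.le_of_lip' PS ?_
    have hc : Tendsto (fun s : ℝ => ‖s • e‖) (𝓝 0) (𝓝 0) := (by fun_prop : Continuous fun s : ℝ => ‖s • e‖).tendsto' _ _ (by simp)
    filter_upwards [hc.eventually (Iio_mem_nhds (by norm_num : (0:ℝ) < 1 / 100))] with s h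
    have := key (s • e) (by rw [lastC_smul, he, mul_zero]) (le_of_lt h)
    rw [norm_smul] at this
    simp only [zero_smul, add_zero, sub_zero]
    linarith
  have dq := hg p (up NN)
  have ck := hess_le (hDt.ell p.2) ha hb ig.le fe hsy hTT ho
  have eu : 0 ≤ 2 * T + (K + (d + 1 : ℕ) * b * (2 * T)) / a := PS
  exact ⟨LN, LN⟩
theorem derivative_bounds (d : ℕ) (hd : 1 ≤ d) (Λ M C₀ : ℝ)
    (hΛ : 1 ≤ Λ) (hM : 1 ≤ M) (hC₀ : 0 < C₀) :
    ∃ C : ℝ, 0 < C ∧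
      ∀ (lam : ℝ) (Q Q' : ℝ → Matrix (Fin (d + 1)) (Fin (d + 1)) ℝ)
        (v v' : ℝ → Eucl (d + 1)) (η : SpaceTime (d + 1) → ℝ),
        ObliqueData d lam Λ M C₀ Q Q' v v' →
        ObliqueSolution d lam Q v η →
        (∀ p ∈ KcP d 1, |η p| ≤ 1) →
        ∃ (g : SpaceTime (d + 1) → Eucl (d + 1))
          (H : SpaceTime (d + 1) → Matrix (Fin (d + 1)) (Fin (d + 1)) ℝ),
          ContinuousOn g (Kc d (1 / 2)) ∧ ContinuousOn H (Kc d (1 / 2)) ∧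
          ∀ p ∈ Kc d (1 / 2),
            HasGradientWithinAt (fun y => η (y, p.2)) (g p)
              {y | (y, p.2) ∈ Kc d (1 / 2)} p.1 ∧
            HasFDerivWithinAt (fun y => g (y, p.2))
              (LinearMap.toContinuousLinearMap (Matrix.toEuclideanLin (H p)))
              {y | (y, p.2) ∈ Kc d (1 / 2)} p.1 ∧
            ‖g p‖ ≤ C ∧ matOpNorm (H p) ≤ C := by
  have hL : 0 < Λ * M ^ 2 := PS
  obtain ⟨C, hC, key⟩ := fin_est d (inv_pos.2 hL) hL hM hC₀.le
  refine ⟨C, hC, fun lam Q Q' v v' η h hs ab => ?_⟩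
  have hS := Sol.of h hs ab
  obtain ⟨ut, g, H, hi⟩ := hS.ic
  have hsub : Kc d (1 / 2) ⊆ Kc d 1 := fun p hp => by
    obtain ⟨bw, bn, ch, bu⟩ := KcP_mem (Or.inl hp)
    exact Kc_of (KcP_of LN bn LN bu) hp.2.1
  refine ⟨g, fun p => matH (H p), hi.cg.mono hsub, ?_, fun p hp => ?_⟩
  · have := hi.cH.mono hsub
    refine continuousOn_pi.2 fun i => continuousOn_pi.2 fun j => ?_
    show ContinuousOn (fun p => (H p (EuclideanSpace.single j 1)) i) _
    fun_prop
  · obtain ⟨bp, ce⟩ := key (Dat.of h) hS ab hi p hp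
    refine ⟨hasGradientWithinAt_iff_hasFDerivWithinAt.2 (hgf.1 (hi.dg p (hsub hp))).hasFDerivWithinAt, ?_, bp, ?_⟩
    · rw [matH_lin]; exact (hi.dH p (hsub hp)).hasFDerivWithinAt
    · rw [matOpNorm, matH_lin]; exact ce
end
end
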